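/- arXiv:0808.1821 — 2 statements merged into one kernel-verified Lean document; each statement's English description precedes it below -/
import Mathlib

section
/- Let Φ be a polynomial automorphism of K^3 and let deg_1 be the standard homogeneous degree on K[x_1,x_2,x_3]. If the ideal of relations of Φ is principal, say I = (R), then R is tamely equivalent to one of the following polynomials: 0; x_3; x_1^r + x_2^s with gcd(r,s) = 1; x_1^k·x_3 + P(x_1,x_2) with k ≥ 1 and P ∈ K[x_1,x_2]. -/
open MvPolynomial

/-- Leading term of a polynomial with respect to the standard homogeneous degree. -/
noncomputable def ltStd {K : Type*} [CommSemiring K] {n : ℕ}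
    (p : MvPolynomial (Fin n) K) : MvPolynomial (Fin n) K :=
  homogeneousComponent p.totalDegree p

/-- The ideal of relations between the leading terms (for the standard degree) of the
components of an automorphism. -/
noncomputable def relIdealStd {K : Type*} [CommRing K] {n : ℕ}
    (f : Fin n → MvPolynomial (Fin n) K) : Ideal (MvPolynomial (Fin n) K) :=
  RingHom.ker
    (aeval (fun i => ltStd (f i)) : MvPolynomial (Fin n) K →ₐ[K] MvPolynomial (Fin n) K)

/-- An affine algebra automorphism of the polynomial ring: each variable is sent to a
polynomial of degree at most one. -/
def IsAffineAut {K : Type*} [CommRing K] {n : ℕ}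
    (ψ : MvPolynomial (Fin n) K ≃ₐ[K] MvPolynomial (Fin n) K) : Prop :=
  ∀ i, (ψ (X i)).totalDegree ≤ 1

/-- An elementary automorphism: up to a permutation of the variables, it adds to one
variable a polynomial in the remaining variables and fixes all other variables. -/
def IsElemAut {K : Type*} [CommRing K] {n : ℕ}
    (ψ : MvPolynomial (Fin n) K ≃ₐ[K] MvPolynomial (Fin n) K) : Prop :=
  ∃ (i : Fin n) (P : MvPolynomial (Fin n) K),
    i ∉ P.vars ∧ ψ (X i) = X i + P ∧ ∀ j, j ≠ i → ψ (X j) = X j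

/-- A tame automorphism is a composition of affine and elementary automorphisms. -/
def IsTame {K : Type*} [CommRing K] {n : ℕ}
    (ψ : MvPolynomial (Fin n) K ≃ₐ[K] MvPolynomial (Fin n) K) : Prop :=
  ψ ∈ Subgroup.closure {φ : MvPolynomial (Fin n) K ≃ₐ[K] MvPolynomial (Fin n) K |
    IsAffineAut φ ∨ IsElemAut φ}

/-- Two polynomials are tamely equivalent if they differ by composition with a tame
automorphism. -/
def TamelyEquiv {K : Type*} [CommRing K] {n : ℕ}
    (f g : MvPolynomial (Fin n) K) : Prop :=
  ∃ ψ : MvPolynomial (Fin n) K ≃ₐ[K] MvPolynomial (Fin n) K, IsTame ψ ∧ f = ψ g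

/-- A polynomial in the two variables `x₁, x₂`, viewed inside `K[x₁,x₂,x₃]`. -/
noncomputable def inj12 {K : Type*} [CommSemiring K]
    (p : MvPolynomial (Fin 2) K) : MvPolynomial (Fin 3) K :=
  rename Fin.castSucc p


set_option linter.unusedSectionVars false
section Tame
variable {K : Type*} [Field K]

/-- The conclusion of the theorem. -/
def Concl (R : MvPolynomial (Fin 3) K) : Prop :=
    TamelyEquiv R 0 ∨
    TamelyEquiv R (X 2) ∨
    (∃ r s : ℕ, Nat.gcd r s = 1 ∧ TamelyEquiv R (X 0 ^ r + X 1 ^ s)) ∨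
    (∃ (k : ℕ) (P : MvPolynomial (Fin 2) K), 1 ≤ k ∧
      TamelyEquiv R (X 0 ^ k * X 2 + inj12 P))

abbrev B3 (K : Type*) [Field K] := MvPolynomial (Fin 3) K

lemma TamelyEquiv.of_tame {R S : B3 K} {ψ : B3 K ≃ₐ[K] B3 K} (hψ : IsTame ψ)
    (h : TamelyEquiv (ψ R) S) : TamelyEquiv R S := by
  obtain ⟨φ, hφ, h⟩ := h
  refine ⟨ψ⁻¹ * φ, Subgroup.mul_mem _ (Subgroup.inv_mem _ hψ) hφ, ?_⟩
  have : R = ψ⁻¹ (ψ R) := (ψ.symm_apply_apply R).symm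
  rw [this, h]; rfl

lemma Concl.of_tame {R : B3 K} {ψ : B3 K ≃ₐ[K] B3 K} (hψ : IsTame ψ)
    (h : Concl (ψ R)) : Concl R := by
  rcases h with h | h | ⟨r, s, hrs, h⟩ | ⟨k, P, hk, h⟩
  · exact Or.inl (h.of_tame hψ)
  · exact Or.inr (Or.inl (h.of_tame hψ))
  · exact Or.inr (Or.inr (Or.inl ⟨r, s, hrs, h.of_tame hψ⟩))
  · exact Or.inr (Or.inr (Or.inr ⟨k, P, hk, h.of_tame hψ⟩))

/-- Permutation and scaling of the variables. -/
noncomputable def permScale (σ : Equiv.Perm (Fin 3)) (c : Fin 3 → K) (hc : ∀ i, c i ≠ 0) :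
    B3 K ≃ₐ[K] B3 K :=
  AlgEquiv.ofAlgHom (aeval fun l => C (c l) * X (σ l))
    (aeval fun m => C ((c (σ.symm m))⁻¹) * X (σ.symm m))
    (by
      ext1 i
      simp only [AlgHom.comp_apply, aeval_X, map_mul, algHom_C, algebraMap_eq, AlgHom.id_apply, Equiv.apply_symm_apply]
      rw [← mul_assoc, ← C_mul, inv_mul_cancel₀ (hc _)]; simp)
    (by
      ext1 i
      simp only [AlgHom.comp_apply, aeval_X, map_mul, algHom_C, algebraMap_eq, AlgHom.id_apply, Equiv.symm_apply_apply]
      rw [← mul_assoc, ← C_mul, mul_inv_cancel₀ (hc _)]; simp)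

lemma permScale_X (σ : Equiv.Perm (Fin 3)) (c : Fin 3 → K) (hc : ∀ i, c i ≠ 0) (i : Fin 3) :
    permScale σ c hc (X i) = C (c i) * X (σ i) := by
  simp [permScale]

lemma permScale_symm_X (σ : Equiv.Perm (Fin 3)) (c : Fin 3 → K) (hc : ∀ i, c i ≠ 0) (i : Fin 3) :
    (permScale σ c hc).symm (X i) = C ((c (σ.symm i))⁻¹) * X (σ.symm i) := by
  simp [permScale]

lemma permScale_tame (σ : Equiv.Perm (Fin 3)) (c : Fin 3 → K) (hc : ∀ i, c i ≠ 0) :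
    IsTame (permScale σ c hc) := by
  apply Subgroup.subset_closure
  left
  intro i
  rw [permScale_X]
  refine (totalDegree_mul _ _).trans ?_
  simp

lemma aeval_upd_of_notMem {i : Fin 3} {P Q : B3 K} (h : i ∉ P.vars) :
    aeval (fun j => if j = i then Q else X j) P = P := by
  conv_rhs => rw [← aeval_X_left_apply P]
  apply eval₂Hom_congr' rfl _ rfl
  intro j hj _
  have : j ≠ i := fun hh => h (hh ▸ hj)
  simp [this]

/-- Elementary automorphism. -/
noncomputable def elemEquiv (i : Fin 3) (P : B3 K) (h : i ∉ P.vars) : B3 K ≃ₐ[K] B3 K :=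
  AlgEquiv.ofAlgHom (aeval fun j => if j = i then X i + P else X j)
    (aeval fun j => if j = i then X i - P else X j)
    (by
      ext1 j
      simp only [AlgHom.comp_apply, aeval_X, AlgHom.id_apply]
      split_ifs with hj
      · subst hj
        rw [map_sub, aeval_upd_of_notMem h]
        simp
      · simp [hj])
    (by
      ext1 j
      simp only [AlgHom.comp_apply, aeval_X, AlgHom.id_apply]
      split_ifs with hj
      · subst hj
        rw [map_add, aeval_upd_of_notMem h]
        simp
      · simp [hj])

lemma elemEquiv_X_self (i : Fin 3) (P : B3 K) (h : i ∉ P.vars) :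
    elemEquiv i P h (X i) = X i + P := by simp [elemEquiv]
lemma elemEquiv_X_ne (i : Fin 3) (P : B3 K) (h : i ∉ P.vars) {j : Fin 3} (hj : j ≠ i) :
    elemEquiv i P h (X j) = X j := by simp [elemEquiv, hj]
lemma elemEquiv_symm_X_self (i : Fin 3) (P : B3 K) (h : i ∉ P.vars) :
    (elemEquiv i P h).symm (X i) = X i - P := by simp [elemEquiv]
lemma elemEquiv_symm_X_ne (i : Fin 3) (P : B3 K) (h : i ∉ P.vars) {j : Fin 3} (hj : j ≠ i) :
    (elemEquiv i P h).symm (X j) = X j := by simp [elemEquiv, hj]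
lemma elemEquiv_of_notMem (i : Fin 3) (P : B3 K) (h : i ∉ P.vars) {Q : B3 K} (hQ : i ∉ Q.vars) :
    elemEquiv i P h Q = Q := aeval_upd_of_notMem hQ
lemma elemEquiv_tame (i : Fin 3) (P : B3 K) (h : i ∉ P.vars) : IsTame (elemEquiv i P h) := by
  apply Subgroup.subset_closure
  right
  exact ⟨i, P, h, elemEquiv_X_self i P h, fun j hj => elemEquiv_X_ne i P h hj⟩

lemma IsTame.symm {ψ : B3 K ≃ₐ[K] B3 K} (h : IsTame ψ) : IsTame ψ.symm :=
  Subgroup.inv_mem _ h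

variable [CharZero K]

lemma free_iff {i : Fin 3} {P : B3 K} : pderiv i P = 0 ↔ ∀ s, coeff s P ≠ 0 → s i = 0 := by
  constructor
  · intro h s hs
    by_contra hi
    have h1 := coeff_pderiv (i := i) P (s - Finsupp.single i 1)
    have h2 : s - Finsupp.single i 1 + Finsupp.single i 1 = s :=
      tsub_add_cancel_of_le (Finsupp.single_le_iff.mpr (by omega))
    rw [h, coeff_zero, h2] at h1
    have h3 := h1.symm
    rw [mul_eq_zero] at h3
    rcases h3 with h3 | h3
    · exact hs h3
    · exact absurd h3 (Nat.cast_add_one_ne_zero _)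
  · intro h
    ext m
    rw [coeff_pderiv, coeff_zero]
    by_contra h2
    have := h _ (left_ne_zero_of_mul h2)
    simp at this

lemma notMem_vars_of_free {i : Fin 3} {P : B3 K} (h : pderiv i P = 0) : i ∉ P.vars := by
  rw [mem_vars_iff_mem_support]
  rintro ⟨s, hs, hi⟩
  rw [mem_support_iff] at hs
  have := free_iff.mp h s hs
  simp [this] at hi

lemma concl_X {R : B3 K} {c : K} (hc : c ≠ 0) {i : Fin 3} (h : R = C c * X i) : Concl R := by
  refine Or.inr (Or.inl ⟨permScale (Equiv.swap 2 i) (fun _ => c) (fun _ => hc),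
    permScale_tame _ _ _, ?_⟩)
  rw [permScale_X, Equiv.swap_apply_left, h]

lemma exists_perm01 : ∀ i j : Fin 3, i ≠ j → ∃ σ : Equiv.Perm (Fin 3), σ 0 = i ∧ σ 1 = j := by
  decide

lemma concl_pow [IsAlgClosed K] {R : B3 K} {a b : K} (ha : a ≠ 0) (hb : b ≠ 0) {i j : Fin 3} (hij : i ≠ j)
    {r s : ℕ} (hr : 0 < r) (hs : 0 < s) (hrs : Nat.gcd r s = 1)
    (h : R = C a * X i ^ r + C b * X j ^ s) : Concl R := by
  obtain ⟨σ, h0, h1⟩ := exists_perm01 i j hij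
  obtain ⟨α, hα⟩ := IsAlgClosed.exists_pow_nat_eq a hr
  obtain ⟨β, hβ⟩ := IsAlgClosed.exists_pow_nat_eq b hs
  have hα0 : α ≠ 0 := by rintro rfl; rw [zero_pow hr.ne'] at hα; exact ha hα.symm
  have hβ0 : β ≠ 0 := by rintro rfl; rw [zero_pow hs.ne'] at hβ; exact hb hβ.symm
  have hc : ∀ l : Fin 3, (![α, β, 1] : Fin 3 → K) l ≠ 0 := by
    intro l; fin_cases l <;> simp [hα0, hβ0]
  refine Or.inr (Or.inr (Or.inl ⟨r, s, hrs, permScale σ ![α, β, 1] hc, permScale_tame _ _ _, ?_⟩))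
  rw [map_add, map_pow, map_pow, permScale_X, permScale_X, h0, h1, h, mul_pow, mul_pow, ← C_pow,
    ← C_pow]
  simp [hα, hβ]

lemma exists_perm02 : ∀ i j : Fin 3, i ≠ j → ∃ σ : Equiv.Perm (Fin 3), σ 0 = i ∧ σ 2 = j := by
  decide

lemma exists_inj12 {P : B3 K} (h : pderiv 2 P = 0) : ∃ Q, P = inj12 Q := by
  have h2 := notMem_vars_of_free h
  obtain ⟨Q, hQ⟩ := exists_rename_eq_of_vars_subset_range P (Fin.castSucc : Fin 2 → Fin 3)
    (Fin.castSucc_injective 2) (by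
      intro x hx
      fin_cases x
      · exact ⟨0, rfl⟩
      · exact ⟨1, rfl⟩
      · exact absurd hx h2)
  exact ⟨Q, hQ.symm⟩

lemma pderiv_permScale (σ : Equiv.Perm (Fin 3)) (c : Fin 3 → K) (hc : ∀ i, c i ≠ 0)
    (i : Fin 3) (P : B3 K) : C (c i) * permScale σ c hc (pderiv i P) =
      pderiv (σ i) (permScale σ c hc P) := by
  induction P using MvPolynomial.induction_on with
  | C a =>
    have : permScale σ c hc (C a) = C a := AlgEquiv.commutes _ a
    rw [this]; simp
  | add p q hp hq => simp only [map_add, mul_add, hp, hq]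
  | mul_X p j hp =>
    simp only [map_mul, Derivation.leibniz, smul_eq_mul, map_add, ← hp, permScale_X]
    by_cases hij : j = i
    · subst hij; simp; ring
    · have : σ j ≠ σ i := fun hh => hij (σ.injective hh)
      simp [pderiv_X_of_ne hij, pderiv_X_of_ne this]; ring

lemma concl_lin {R P : B3 K} {a : K} (ha : a ≠ 0) {i j : Fin 3} (hij : i ≠ j) {k : ℕ}
    (hP : pderiv j P = 0) (h : R = C a * X i ^ k * X j + P) : Concl R := by
  obtain ⟨σ, h0, h1⟩ := exists_perm02 i j hij
  have hc : ∀ l : Fin 3, (![1, 1, a] : Fin 3 → K) l ≠ 0 := by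
    intro l; fin_cases l <;> simp [ha]
  let ψ := permScale σ ![1, 1, a] hc
  have hψ : IsTame ψ := permScale_tame _ _ _
  have hP2 : pderiv 2 (ψ.symm P) = 0 := by
    have := pderiv_permScale σ ![1, 1, a] hc 2 (ψ.symm P)
    rw [show permScale σ ![1, 1, a] hc (ψ.symm P) = P from ψ.apply_symm_apply P, h1, hP,
      mul_eq_zero] at this
    replace this := this.resolve_left (by simp [ha])
    exact (map_eq_zero_iff _ (AlgEquiv.injective _)).mp this
  have hR : R = ψ (X 0 ^ k * X 2 + ψ.symm P) := by
    rw [map_add, map_mul, map_pow, ψ.apply_symm_apply, permScale_X, permScale_X, h0, h1, h]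
    simp; ring
  rcases Nat.eq_zero_or_pos k with rfl | hk
  · have hv := notMem_vars_of_free hP2
    refine Or.inr (Or.inl ⟨ψ * elemEquiv 2 _ hv, Subgroup.mul_mem _ hψ (elemEquiv_tame _ _ _), ?_⟩)
    rw [hR, AlgEquiv.mul_apply, elemEquiv_X_self]; simp
  · obtain ⟨Q, hQ⟩ := exists_inj12 hP2
    refine Or.inr (Or.inr (Or.inr ⟨k, Q, hk, ψ, hψ, ?_⟩))
    rw [← hQ]; exact hR

end Tame


set_option linter.unusedSectionVars false
section WH
variable {K : Type*} [Field K]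

/-- weight of an exponent, as an integer -/
def wt (d : Fin 3 → ℕ) (s : Fin 3 →₀ ℕ) : ℤ := s 0 * d 0 + s 1 * d 1 + s 2 * d 2

lemma wt_add (d : Fin 3 → ℕ) (s t : Fin 3 →₀ ℕ) : wt d (s + t) = wt d s + wt d t := by
  simp [wt]; ring

lemma wt_single (d : Fin 3 → ℕ) (i : Fin 3) (k : ℕ) : wt d (Finsupp.single i k) = k * d i := by
  fin_cases i <;> simp [wt]

lemma wt_zero (d : Fin 3 → ℕ) : wt d 0 = 0 := by simp [wt]

lemma wt_nonneg (d : Fin 3 → ℕ) (s : Fin 3 →₀ ℕ) : 0 ≤ wt d s := by unfold wt; positivity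

lemma le_wt (d : Fin 3 → ℕ) (s : Fin 3 →₀ ℕ) (i : Fin 3) : (s i : ℤ) * d i ≤ wt d s := by
  have h0 : (0 : ℤ) ≤ s 0 * d 0 := by positivity
  have h1 : (0 : ℤ) ≤ s 1 * d 1 := by positivity
  have h2 : (0 : ℤ) ≤ s 2 * d 2 := by positivity
  fin_cases i <;> simp [wt] <;> linarith

/-- All monomials have weight `n`. -/
def Hm (d : Fin 3 → ℕ) (F : B3 K) (n : ℤ) : Prop := ∀ s, coeff s F ≠ 0 → wt d s = n
/-- All monomials have weight less than `n`. -/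
def Lo (d : Fin 3 → ℕ) (F : B3 K) (n : ℤ) : Prop := ∀ s, coeff s F ≠ 0 → wt d s < n

variable {d : Fin 3 → ℕ} {F G : B3 K} {n m : ℤ}

lemma coeff_add_ne {s : Fin 3 →₀ ℕ} (h : coeff s (F + G) ≠ 0) : coeff s F ≠ 0 ∨ coeff s G ≠ 0 := by
  by_contra hh
  push Not at hh
  rw [coeff_add, hh.1, hh.2, add_zero] at h
  exact h rfl

lemma coeff_mul_ne {s : Fin 3 →₀ ℕ} (h : coeff s (F * G) ≠ 0) :
    ∃ t u, t + u = s ∧ coeff t F ≠ 0 ∧ coeff u G ≠ 0 := by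
  classical
  rw [coeff_mul] at h
  obtain ⟨x, hx, h2⟩ := Finset.exists_ne_zero_of_sum_ne_zero h
  exact ⟨x.1, x.2, by simpa using hx, left_ne_zero_of_mul h2, right_ne_zero_of_mul h2⟩

lemma Hm.zero : Hm d (0 : B3 K) n := fun s h => absurd (coeff_zero s) h
lemma Hm.add (hF : Hm d F n) (hG : Hm d G n) : Hm d (F + G) n := fun s h =>
  (coeff_add_ne h).elim (hF s) (hG s)
lemma Hm.neg (hF : Hm d F n) : Hm d (-F) n := fun s h => hF s (by simpa using h)
lemma Hm.sub (hF : Hm d F n) (hG : Hm d G n) : Hm d (F - G) n := by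
  rw [sub_eq_add_neg]; exact hF.add hG.neg
lemma Hm.mul (hF : Hm d F n) (hG : Hm d G m) : Hm d (F * G) (n + m) := fun s h => by
  obtain ⟨t, u, rfl, h1, h2⟩ := coeff_mul_ne h
  rw [wt_add, hF _ h1, hG _ h2]
lemma Hm.congr (hF : Hm d F n) (h : n = m) : Hm d F m := h ▸ hF
lemma Hm.C (a : K) : Hm d (C a : B3 K) 0 := fun s h => by
  rw [coeff_C] at h
  split_ifs at h with h1
  · rw [← h1, wt_zero]
  · exact absurd rfl h
lemma Hm.one : Hm d (1 : B3 K) 0 := by rw [← C_1]; exact Hm.C 1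
lemma Hm.C_mul (a : K) (hF : Hm d F n) : Hm d (MvPolynomial.C a * F) n := by
  simpa using (Hm.C a).mul hF
lemma Hm.X (i : Fin 3) : Hm d (X i : B3 K) (d i) := fun s h => by
  rw [coeff_X] at h
  split_ifs at h with h1
  · rw [← h1, wt_single]; simp
  · exact absurd rfl h
lemma Hm.pow (hF : Hm d F n) (k : ℕ) : Hm d (F ^ k) (k * n) := by
  induction k with
  | zero => simpa using Hm.one
  | succ k ih => rw [pow_succ]; exact (ih.mul hF).congr (by push_cast; ring)
lemma Hm.sum {ι : Type*} {T : Finset ι} {f : ι → B3 K} (h : ∀ i ∈ T, Hm d (f i) n) :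
    Hm d (∑ i ∈ T, f i) n := by
  classical
  induction T using Finset.induction_on with
  | empty => simpa using Hm.zero
  | insert a T ha ih =>
    rw [Finset.sum_insert ha]
    exact (h a (by simp)).add (ih fun i hi => h i (by simp [hi]))
lemma Hm.pderiv (hF : Hm d F n) (i : Fin 3) : Hm d (pderiv i F) (n - d i) := fun s h => by
  rw [coeff_pderiv] at h
  have := hF _ (left_ne_zero_of_mul h)
  rw [wt_add, wt_single] at this
  push_cast at this; linarith
lemma Hm.lo (hF : Hm d F n) : Lo d F (n + 1) := fun s h => by rw [hF s h]; linarith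
lemma Hm.eq_zero (hF : Hm d F n) (h : n < 0) : F = 0 := by
  ext s
  by_contra hs
  have := hF s hs
  have := wt_nonneg d s
  linarith
lemma Hm.uniq (hF : Hm d F n) (hF' : Hm d F m) (h : n ≠ m) : F = 0 := by
  ext s
  by_contra hs
  exact h ((hF s hs).symm.trans (hF' s hs))
lemma Hm.nonneg (hF : Hm d F n) (h : F ≠ 0) : 0 ≤ n := by
  by_contra hn
  exact h (hF.eq_zero (by linarith))
lemma Hm.eq_of_ne (hF : Hm d F n) (hF' : Hm d F m) (h : F ≠ 0) : n = m := by
  by_contra hn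
  exact h (hF.uniq hF' hn)
lemma exists_coeff_ne (h : F ≠ 0) : ∃ s, coeff s F ≠ 0 := by
  by_contra hh
  push Not at hh
  exact h (by ext s; simpa using hh s)

lemma Lo.zero : Lo d (0 : B3 K) n := fun s h => absurd (coeff_zero s) h
lemma Lo.add (hF : Lo d F n) (hG : Lo d G n) : Lo d (F + G) n := fun s h =>
  (coeff_add_ne h).elim (hF s) (hG s)
lemma Lo.neg (hF : Lo d F n) : Lo d (-F) n := fun s h => hF s (by simpa using h)
lemma Lo.sub (hF : Lo d F n) (hG : Lo d G n) : Lo d (F - G) n := by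
  rw [sub_eq_add_neg]; exact hF.add hG.neg
lemma Lo.mono (hF : Lo d F n) (h : n ≤ m) : Lo d F m := fun s hs => (hF s hs).trans_le h
lemma Lo.mul (hF : Lo d F n) (hG : Lo d G m) : Lo d (F * G) (n + m - 1) := fun s h => by
  obtain ⟨t, u, rfl, h1, h2⟩ := coeff_mul_ne h
  have := hF _ h1
  have := hG _ h2
  rw [wt_add]; linarith
lemma Lo.pderiv (hF : Lo d F n) (i : Fin 3) : Lo d (pderiv i F) (n - d i) := fun s h => by
  rw [coeff_pderiv] at h
  have := hF _ (left_ne_zero_of_mul h)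
  rw [wt_add, wt_single] at this
  push_cast at this; linarith
lemma Lo.eq_zero (hF : Lo d F n) (h : n ≤ 0) : F = 0 := by
  ext s
  by_contra hs
  have := hF s hs
  have := wt_nonneg d s
  linarith
lemma Lo.sum {ι : Type*} {T : Finset ι} {f : ι → B3 K} (h : ∀ i ∈ T, Lo d (f i) n) :
    Lo d (∑ i ∈ T, f i) n := by
  classical
  induction T using Finset.induction_on with
  | empty => simpa using Lo.zero
  | insert a T ha ih =>
    rw [Finset.sum_insert ha]
    exact (h a (by simp)).add (ih fun i hi => h i (by simp [hi]))
lemma Lo.eq_zero_of_hm (hF : Lo d F n) (hF' : Hm d F m) (h : n ≤ m) : F = 0 := by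
  ext s
  by_contra hs
  have := hF s hs
  have := hF' s hs
  linarith

/-- homogeneous component -/
noncomputable def comp (d : Fin 3 → ℕ) (n : ℤ) (F : B3 K) : B3 K :=
  ∑ s ∈ F.support with wt d s = n, monomial s (coeff s F)

lemma coeff_comp (s : Fin 3 →₀ ℕ) :
    coeff s (comp d n F) = if wt d s = n then coeff s F else 0 := by
  classical
  unfold comp
  rw [coeff_sum]
  simp only [coeff_monomial]
  rw [Finset.sum_ite_eq']
  simp only [Finset.mem_filter, mem_support_iff]
  by_cases h : coeff s F = 0 <;> simp [h]

lemma comp_hm : Hm d (comp d n F) n := fun s h => by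
  rw [coeff_comp] at h
  by_contra h2
  simp [h2] at h

lemma comp_lo (h : Lo d F (n + 1)) : Lo d (F - comp d n F) n := fun s hs => by
  rw [coeff_sub, coeff_comp] at hs
  split_ifs at hs with h1
  · simp at hs
  · rw [sub_zero] at hs
    have := h s hs
    omega

lemma sum_comp (F : B3 K) (d : Fin 3 → ℕ) : F = ∑ n ∈ F.support.image (wt d), comp d n F := by
  classical
  ext s
  rw [coeff_sum]
  simp only [coeff_comp]
  rw [Finset.sum_ite_eq]
  split_ifs with h
  · rfl
  · by_contra h2
    exact h (Finset.mem_image_of_mem _ (mem_support_iff.mpr h2))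

/-- weighted top part relation -/
def Tp (d : Fin 3 → ℕ) (n : ℤ) (p h : B3 K) : Prop := Hm d h n ∧ Lo d (p - h) n

lemma Tp.lo {p h : B3 K} (H : Tp d n p h) : Lo d p (n + 1) := by
  have := (H.2.mono (by linarith : n ≤ n + 1)).add H.1.lo
  simpa using this
lemma Tp.add {p h p' h' : B3 K} (H : Tp d n p h) (H' : Tp d n p' h') :
    Tp d n (p + p') (h + h') :=
  ⟨H.1.add H'.1, by
    have := H.2.add H'.2
    convert this using 1; ring⟩
lemma Tp.mul {p h p' h' : B3 K} (H : Tp d n p h) (H' : Tp d m p' h') :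
    Tp d (n + m) (p * p') (h * h') :=
  ⟨H.1.mul H'.1, by
    have h1 := H.2.mul H'.lo
    have h2 := H.1.lo.mul H'.2
    have := (h1.mono (by linarith : _ ≤ n + m)).add (h2.mono (by linarith : _ ≤ n + m))
    convert this using 1; ring⟩
lemma Tp.sum {ι : Type*} {T : Finset ι} {f g : ι → B3 K} (h : ∀ i ∈ T, Tp d n (f i) (g i)) :
    Tp d n (∑ i ∈ T, f i) (∑ i ∈ T, g i) :=
  ⟨Hm.sum fun i hi => (h i hi).1, by
    rw [← Finset.sum_sub_distrib]; exact Lo.sum fun i hi => (h i hi).2⟩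
lemma Hm.top (hF : Hm d F n) : Tp d n F F := ⟨hF, by simpa using Lo.zero⟩
lemma Tp.pderiv {p h : B3 K} (H : Tp d n p h) (i : Fin 3) :
    Tp d (n - d i) (pderiv i p) (pderiv i h) :=
  ⟨H.1.pderiv i, by rw [← map_sub]; exact H.2.pderiv i⟩
lemma Tp.pow {p h : B3 K} (H : Tp d n p h) (k : ℕ) : Tp d (k * n) (p ^ k) (h ^ k) := by
  induction k with
  | zero => simpa using (Hm.one (d := d) (K := K)).top
  | succ k ih =>
    rw [pow_succ, pow_succ]
    have := ih.mul H
    convert this using 1; push_cast; ring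
lemma Tp.C_mul {p h : B3 K} (a : K) (H : Tp d n p h) : Tp d n (C a * p) (C a * h) := by
  simpa using (Hm.C a).top.mul H
lemma Lo.top_zero (hF : Lo d F n) : Tp d n F 0 := ⟨Hm.zero, by simpa using hF⟩
lemma Tp.lo_of_zero {p h : B3 K} (H : Tp d n p h) (h0 : h = 0) : Lo d p n := by
  have := H.2; rwa [h0, sub_zero] at this
lemma Tp.h_zero {p h : B3 K} (H : Tp d n p h) (h0 : Lo d p n) : h = 0 := by
  have := h0.sub H.2
  rw [sub_sub_cancel] at this
  exact this.eq_zero_of_hm H.1 le_rfl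
lemma Lo.top_comp (h : Lo d F (n + 1)) : Tp d n F (comp d n F) := ⟨comp_hm, comp_lo h⟩
lemma Lo.comp_zero (h : Lo d F n) : comp d n F = 0 :=
  (Lo.top_comp (h.mono (by linarith))).h_zero h

lemma algHom_monomial (φ : B3 K →ₐ[K] B3 K) (s : Fin 3 →₀ ℕ) (a : K) :
    φ (monomial s a) = C a * (φ (X 0) ^ s 0 * φ (X 1) ^ s 1 * φ (X 2) ^ s 2) := by
  rw [monomial_eq, map_mul, Finsupp.prod_fintype _ _ (by simp), map_prod, Fin.prod_univ_three]
  simp only [map_pow]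
  congr 1
  exact φ.commutes a

lemma algHom_eq_sum (φ : B3 K →ₐ[K] B3 K) (F : B3 K) :
    φ F = ∑ s ∈ F.support, C (coeff s F) * (φ (X 0) ^ s 0 * φ (X 1) ^ s 1 * φ (X 2) ^ s 2) := by
  conv_lhs => rw [← support_sum_monomial_coeff F, map_sum]
  exact Finset.sum_congr rfl fun s _ => algHom_monomial φ s _

/-- transfer of leading parts along algebra maps -/
lemma Hm.transfer {d d' : Fin 3 → ℕ} {φ χ : B3 K →ₐ[K] B3 K}
    (h : ∀ j, Tp d' (d j) (φ (MvPolynomial.X j)) (χ (MvPolynomial.X j))) (hF : Hm d F n) :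
    Tp d' n (φ F) (χ F) := by
  rw [algHom_eq_sum φ, algHom_eq_sum χ]
  refine Tp.sum fun s hs => Tp.C_mul _ ?_
  have := (((h 0).pow (s 0)).mul ((h 1).pow (s 1))).mul ((h 2).pow (s 2))
  have h2 := hF s (mem_support_iff.mp hs)
  rw [← h2]; exact this

lemma Lo.transfer {d d' : Fin 3 → ℕ} {φ χ : B3 K →ₐ[K] B3 K}
    (h : ∀ j, Tp d' (d j) (φ (MvPolynomial.X j)) (χ (MvPolynomial.X j))) (hF : Lo d F n) :
    Lo d' (φ F) n := by
  rw [algHom_eq_sum φ]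
  refine Lo.sum fun s hs => ?_
  have := ((((h 0).pow (s 0)).mul ((h 1).pow (s 1))).mul ((h 2).pow (s 2))).C_mul (coeff s F)
  have h2 := hF s (mem_support_iff.mp hs)
  exact this.lo.mono (by unfold wt at h2; omega)

lemma Hm.map {d d' : Fin 3 → ℕ} {φ : B3 K →ₐ[K] B3 K}
    (h : ∀ j, Hm d' (φ (MvPolynomial.X j)) (d j)) (hF : Hm d F n) : Hm d' (φ F) n :=
  (hF.transfer (φ := φ) (χ := φ) fun j => (h j).top).1

lemma chain_rule (φ : B3 K →ₐ[K] B3 K) (i : Fin 3) (F : B3 K) :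
    pderiv i (φ F) = ∑ k, pderiv i (φ (X k)) * φ (pderiv k F) := by
  induction F using MvPolynomial.induction_on with
  | C a =>
    have : φ (C a) = C a := φ.commutes a
    rw [this]; simp
  | add p q hp hq => simp only [map_add, mul_add, hp, hq, Finset.sum_add_distrib]
  | mul_X p j hp =>
    simp only [map_mul, Derivation.leibniz, smul_eq_mul, map_add, hp, mul_add,
      Finset.sum_add_distrib]
    congr 1
    · rw [Finset.sum_eq_single j]
      · simp; ring
      · intro b _ hb; simp [pderiv_X_of_ne hb.symm]
      · simp
    · rw [Finset.mul_sum]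
      exact Finset.sum_congr rfl fun k _ => by ring

lemma der_eq (D : Derivation K (B3 K) (B3 K)) (F : B3 K) :
    D F = pderiv 0 F * D (X 0) + pderiv 1 F * D (X 1) + pderiv 2 F * D (X 2) := by
  induction F using MvPolynomial.induction_on with
  | C a =>
    have : D (C a) = 0 := D.map_algebraMap a
    rw [this]; simp
  | add p q hp hq => simp only [map_add, hp, hq]; ring
  | mul_X p j hp =>
    simp only [Derivation.leibniz, smul_eq_mul, hp]
    fin_cases j <;> simp [pderiv_X] <;> ring

lemma X_pow_dvd {i : Fin 3} {k : ℕ} (h : ∀ s, coeff s F ≠ 0 → k ≤ s i) : X i ^ k ∣ F := by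
  rw [← support_sum_monomial_coeff F]
  refine Finset.dvd_sum fun s hs => ?_
  rw [X_pow_eq_monomial, monomial_dvd_monomial]
  exact ⟨Or.inr (Finsupp.single_le_iff.mpr (h s (mem_support_iff.mp hs))), one_dvd _⟩

lemma X_dvd {i : Fin 3} (h : ∀ s, coeff s F ≠ 0 → s i ≠ 0) : X i ∣ F := by
  simpa using X_pow_dvd (k := 1) fun s hs => Nat.one_le_iff_ne_zero.mpr (h s hs)

variable [CharZero K]

lemma Hm.free {i : Fin 3} (hF : Hm d F n) (h : n < d i) : MvPolynomial.pderiv i F = 0 :=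
  (hF.pderiv i).eq_zero (by linarith)

lemma exists_div (i : Fin 3) (F : B3 K) : ∃ G H : B3 K, F = H + X i * G ∧ pderiv i H = 0 ∧
    (∀ d n, Hm d F n → Hm d H n ∧ Hm d G (n - d i)) ∧
    (∀ j, j ≠ i → pderiv j F = 0 → pderiv j H = 0 ∧ pderiv j G = 0) := by
  classical
  have hG : ∀ s, coeff s (F.divMonomial (Finsupp.single i 1)) = coeff (s + Finsupp.single i 1) F := by
    intro s; rw [coeff_divMonomial, add_comm]
  have hH : ∀ s, coeff s (F.modMonomial (Finsupp.single i 1)) ≠ 0 → coeff s F ≠ 0 ∧ s i = 0 := by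
    intro s hs
    by_cases hle : Finsupp.single i 1 ≤ s
    · exact absurd (coeff_modMonomial_of_le _ hle) hs
    · rw [coeff_modMonomial_of_not_le _ hle] at hs
      refine ⟨hs, ?_⟩
      rw [Finsupp.single_le_iff] at hle
      omega
  refine ⟨F.divMonomial (Finsupp.single i 1), F.modMonomial (Finsupp.single i 1), ?_, ?_, ?_, ?_⟩
  · rw [add_comm, divMonomial_add_modMonomial_single]
  · exact free_iff.mpr fun s hs => (hH s hs).2
  · intro d n h
    refine ⟨fun s hs => h s (hH s hs).1, fun s hs => ?_⟩
    rw [hG] at hs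
    have := h _ hs
    rw [wt_add, wt_single] at this
    push_cast at this; linarith
  · intro j hj h
    rw [free_iff] at h
    refine ⟨free_iff.mpr fun s hs => h s (hH s hs).1, free_iff.mpr fun s hs => ?_⟩
    rw [hG] at hs
    have := h _ hs
    simp at this
    exact this.1

lemma exists_anti (i : Fin 3) (F : B3 K) : ∃ Q : B3 K, pderiv i Q = F ∧
    (∀ d n, Hm d F n → Hm d Q (n + d i)) ∧ (∀ j, j ≠ i → pderiv j F = 0 → pderiv j Q = 0) := by
  classical
  let Q : B3 K := ∑ s ∈ F.support, monomial (s + Finsupp.single i 1) (coeff s F / ((s i : K) + 1))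
  have hQ : ∀ t, coeff t Q ≠ 0 → ∃ s, coeff s F ≠ 0 ∧ s + Finsupp.single i 1 = t := by
    intro t ht
    rw [coeff_sum] at ht
    obtain ⟨s, hs, h2⟩ := Finset.exists_ne_zero_of_sum_ne_zero ht
    rw [coeff_monomial] at h2
    refine ⟨s, mem_support_iff.mp hs, ?_⟩
    by_contra h3
    simp [h3] at h2
  refine ⟨Q, ?_, ?_, ?_⟩
  · rw [map_sum]
    conv_rhs => rw [← support_sum_monomial_coeff F]
    refine Finset.sum_congr rfl fun s hs => ?_
    rw [pderiv_monomial]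
    congr 1
    · simp
    · have : (s i : K) + 1 ≠ 0 := Nat.cast_add_one_ne_zero _
      simp; field_simp
  · intro d n h t ht
    obtain ⟨s, hs, rfl⟩ := hQ t ht
    rw [wt_add, wt_single, h s hs]; simp
  · intro j hj h
    rw [free_iff] at h ⊢
    intro t ht
    obtain ⟨s, hs, rfl⟩ := hQ t ht
    simp [h s hs, hj]

lemma third : ∀ i j k : Fin 3, i ≠ j → i ≠ k → j ≠ k → ∀ l, l = i ∨ l = j ∨ l = k := by decide

lemma one_var {i j k : Fin 3} (hij : i ≠ j) (hik : i ≠ k) (hjk : j ≠ k) (hd : 0 < d i) (hF : Hm d F n)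
    (h0 : F ≠ 0) (hj : pderiv j F = 0) (hk : pderiv k F = 0) :
    ∃ (c : K) (l : ℕ), c ≠ 0 ∧ F = C c * X i ^ l ∧ (l : ℤ) * d i = n := by
  obtain ⟨s, hs⟩ := exists_coeff_ne h0
  have key : ∀ t, coeff t F ≠ 0 → t = Finsupp.single i (t i) := by
    intro t ht
    ext l
    rcases third i j k hij hik hjk l with rfl | rfl | rfl
    · simp
    · simp [free_iff.mp hj t ht, hij]
    · simp [free_iff.mp hk t ht, hik]
  have hw : ∀ t, coeff t F ≠ 0 → (t i : ℤ) * d i = n := by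
    intro t ht
    rw [← hF t ht]; conv_rhs => rw [key t ht]
    rw [wt_single]
  refine ⟨coeff s F, s i, hs, ?_, hw s hs⟩
  ext t
  rw [coeff_C_mul, coeff_X_pow]
  split_ifs with h
  · rw [← key s hs] at h; rw [h]; simp
  · rw [mul_zero]
    by_contra ht
    apply h
    have h1 := (hw t ht).trans (hw s hs).symm
    have : t i = s i := by
      have hd' : (d i : ℤ) ≠ 0 := by positivity
      exact_mod_cast mul_right_cancel₀ hd' h1
    rw [key t ht, this]

lemma isUnit_iff_C : IsUnit F ↔ ∃ c : K, c ≠ 0 ∧ F = C c := by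
  rw [MvPolynomial.isUnit_iff_eq_C_of_isReduced]
  constructor
  · rintro ⟨r, hr, h⟩; exact ⟨r, hr.ne_zero, h⟩
  · rintro ⟨r, hr, h⟩; exact ⟨r, hr.isUnit, h⟩

lemma irr_dvd (hF : Irreducible F) (hG : ¬ IsUnit G) (h : G ∣ F) : ∃ c : K, c ≠ 0 ∧ F = C c * G := by
  obtain ⟨H, rfl⟩ := h
  rcases hF.isUnit_or_isUnit rfl with h | h
  · exact absurd h hG
  · obtain ⟨c, hc, rfl⟩ := isUnit_iff_C.mp h
    exact ⟨c, hc, mul_comm _ _⟩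

lemma X_not_unit (i : Fin 3) : ¬ IsUnit (X i : B3 K) := (X_prime (i := i)).not_isUnit

lemma irr_X (hF : Irreducible F) {i : Fin 3} (h : X i ∣ F) : Concl F := by
  obtain ⟨c, hc, h⟩ := irr_dvd hF (X_not_unit i) h
  exact concl_X hc h

end WH

set_option linter.unusedSectionVars false
section LND
variable {K : Type*} [Field K] [CharZero K]

/-- locally nilpotent -/
def Lnd (D : Derivation K (B3 K) (B3 K)) : Prop := ∀ a, ∃ n, D^[n] a = 0

/-- degree with respect to a locally nilpotent derivation -/
noncomputable def nu (D : Derivation K (B3 K) (B3 K)) (a : B3 K) : ℕ := sInf {n | D^[n + 1] a = 0}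

variable {D : Derivation K (B3 K) (B3 K)} {a b : B3 K} {n m : ℕ}

lemma iter_add (n : ℕ) (a b : B3 K) : D^[n] (a + b) = D^[n] a + D^[n] b :=
  iterate_map_add D n a b
lemma iter_zero (n : ℕ) : D^[n] (0 : B3 K) = 0 := iterate_map_zero D n
lemma iter_neg (n : ℕ) : D^[n] (-a) = -D^[n] a := iterate_map_neg D n a

lemma iter_le (h : D^[n] a = 0) (hn : n ≤ m) : D^[m] a = 0 := by
  obtain ⟨k, rfl⟩ := Nat.exists_eq_add_of_le hn
  rw [add_comm, Function.iterate_add_apply, h, iter_zero]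

lemma nu_le (h : D^[n + 1] a = 0) : nu D a ≤ n := Nat.sInf_le h

lemma nu_spec (hD : Lnd D) (a : B3 K) : D^[nu D a + 1] a = 0 := by
  have : {n | D^[n + 1] a = 0}.Nonempty := by
    obtain ⟨n, hn⟩ := hD a
    exact ⟨n, iter_le hn (by omega)⟩
  exact Nat.sInf_mem this

lemma nu_ne (ha : a ≠ 0) : D^[nu D a] a ≠ 0 := by
  intro h
  rcases hn : nu D a with _ | k
  · rw [hn] at h; exact ha h
  · rw [hn] at h
    have := nu_le h
    omega

lemma nu_unique (hD : Lnd D) (h0 : D^[n] a ≠ 0) (h1 : D^[n + 1] a = 0) : nu D a = n := by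
  have h2 := nu_le h1
  by_contra hne
  exact h0 (iter_le (nu_spec hD a) (by omega))

lemma nu_eq_zero (hD : Lnd D) : nu D a = 0 ↔ D a = 0 := by
  constructor
  · intro h
    have := nu_spec hD a
    rw [h] at this; exact this
  · intro h
    exact Nat.le_zero.mp (nu_le (n := 0) h)

lemma nu_D (hD : Lnd D) (h : D a ≠ 0) : nu D a = nu D (D a) + 1 :=
  nu_unique hD (nu_ne h) (nu_spec hD (D a))

lemma iter_mul (N : ℕ) : ∀ (n m : ℕ) (a b : B3 K), n + m = N → D^[n + 1] a = 0 → D^[m + 1] b = 0 →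
    D^[N] (a * b) = (N.choose n : B3 K) * (D^[n] a * D^[m] b) := by
  induction N with
  | zero =>
    intro n m a b h ha hb
    obtain ⟨rfl, rfl⟩ : n = 0 ∧ m = 0 := by omega
    simp
  | succ N ih =>
    intro n m a b h ha hb
    have hl : D (a * b) = D a * b + a * D b := by
      rw [Derivation.leibniz]; simp only [smul_eq_mul]; ring
    rw [Function.iterate_succ_apply, hl, iter_add]
    rcases n with _ | n
    · rw [show D a = 0 from ha, zero_mul, iter_zero, zero_add]
      rcases m with _ | m
      · omega
      · rw [ih 0 m a (D b) (by omega) ha hb]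
        simp
    · rcases m with _ | m
      · rw [show D b = 0 from hb, mul_zero, iter_zero, add_zero, ih n 0 (D a) b (by omega) ha hb]
        have : n = N := by omega
        subst this
        simp
      · rw [ih n (m + 1) (D a) b (by omega) ha hb, ih (n + 1) m a (D b) (by omega) ha hb,
          Nat.choose_succ_succ]
        simp only [Function.iterate_succ_apply]
        push_cast; ring

lemma nu_mul (hD : Lnd D) (ha : a ≠ 0) (hb : b ≠ 0) : nu D (a * b) = nu D a + nu D b := by
  have key := iter_mul (nu D a + nu D b) (nu D a) (nu D b) a b rfl (nu_spec hD a) (nu_spec hD b)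
  apply nu_unique hD
  · rw [key]
    refine mul_ne_zero ?_ (mul_ne_zero (nu_ne ha) (nu_ne hb))
    exact_mod_cast (Nat.choose_pos (Nat.le_add_right _ _)).ne'
  · rw [Function.iterate_succ_apply', key]
    have h1 : D (D^[nu D a] a) = 0 := by
      rw [← Function.iterate_succ_apply' (f := D)]; exact nu_spec hD a
    have h2 : D (D^[nu D b] b) = 0 := by
      rw [← Function.iterate_succ_apply' (f := D)]; exact nu_spec hD b
    simp [Derivation.leibniz, h1, h2]

lemma nu_pow (hD : Lnd D) (ha : a ≠ 0) (k : ℕ) : nu D (a ^ k) = k * nu D a := by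
  induction k with
  | zero => rw [pow_zero, zero_mul, nu_eq_zero hD]; simp
  | succ k ih => rw [pow_succ, nu_mul hD (pow_ne_zero _ ha) ha, ih]; ring

lemma nu_C (hD : Lnd D) (c : K) : nu D (C c) = 0 := by
  rw [nu_eq_zero hD]; exact D.map_algebraMap c

lemma nu_C_mul (hD : Lnd D) {c : K} (hc : c ≠ 0) (a : B3 K) : nu D (C c * a) = nu D a := by
  by_cases ha : a = 0
  · simp [ha]
  · rw [nu_mul hD (by simpa using hc) ha, nu_C hD, zero_add]

lemma nu_neg (a : B3 K) : nu D (-a) = nu D a := by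
  unfold nu; simp

lemma nu_add (hD : Lnd D) (a b : B3 K) : nu D (a + b) ≤ max (nu D a) (nu D b) := by
  apply nu_le
  rw [iter_add, iter_le (nu_spec hD a) (by omega), iter_le (nu_spec hD b) (by omega), add_zero]

lemma nu_sub (hD : Lnd D) (a b : B3 K) : nu D (a - b) ≤ max (nu D a) (nu D b) := by
  rw [sub_eq_add_neg, ← nu_neg b]; exact nu_add hD a (-b)

/-- adding an element of lower degree does not change the degree -/
lemma nu_add_of_lt (hD : Lnd D) (h : nu D a < nu D b) : nu D (a + b) = nu D b := by
  have h1 := nu_add hD a b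
  have h2 := nu_sub hD (a + b) a
  rw [add_sub_cancel_left] at h2
  omega

lemma nu_dvd (hD : Lnd D) (hb : b ≠ 0) (h : a ∣ b) : nu D a ≤ nu D b := by
  obtain ⟨c, rfl⟩ := h
  rw [nu_mul hD (left_ne_zero_of_mul hb) (right_ne_zero_of_mul hb)]; omega

lemma ker_of_dvd (hD : Lnd D) (h : a ∣ D a) : D a = 0 := by
  by_contra h0
  have h1 := nu_D hD h0
  have h2 := nu_dvd hD h0 h
  omega

lemma ker_mul (hD : Lnd D) (h0 : a * b ≠ 0) (h : D (a * b) = 0) : D a = 0 ∧ D b = 0 := by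
  rw [← nu_eq_zero hD, nu_mul hD (left_ne_zero_of_mul h0) (right_ne_zero_of_mul h0)] at h
  rw [← nu_eq_zero hD, ← nu_eq_zero hD]
  omega

/-- homogeneous of degree e -/
def HD (d : Fin 3 → ℕ) (D : Derivation K (B3 K) (B3 K)) (e : ℤ) : Prop :=
  ∀ j, Hm d (D (X j)) (d j + e)

variable {d : Fin 3 → ℕ} {e k : ℤ} {F : B3 K}

lemma HD.app (h : HD d D e) (hF : Hm d F k) : Hm d (D F) (k + e) := by
  rw [der_eq D F]
  exact ((((hF.pderiv 0).mul (h 0)).congr (by ring)).add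
    (((hF.pderiv 1).mul (h 1)).congr (by ring))).add (((hF.pderiv 2).mul (h 2)).congr (by ring))

lemma D_ne (hD0 : D ≠ 0) : ∃ j, D (X j) ≠ 0 := by
  by_contra h
  push Not at h
  exact hD0 (derivation_ext fun i => by simpa using h i)

lemma wt_mod {N : ℤ} {t : Fin 3} (hN : ∀ j, j ≠ t → N ∣ d j) (s : Fin 3 →₀ ℕ) :
    N ∣ wt d s - s t * d t := by
  unfold wt
  obtain rfl | rfl | rfl : t = 0 ∨ t = 1 ∨ t = 2 := by fin_cases t <;> simp
  · have h1 := Dvd.dvd.mul_left (hN 1 (by decide)) (s 1 : ℤ)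
    have h2 := Dvd.dvd.mul_left (hN 2 (by decide)) (s 2 : ℤ)
    exact (dvd_add h1 h2).trans (dvd_of_eq (by ring))
  · have h1 := Dvd.dvd.mul_left (hN 0 (by decide)) (s 0 : ℤ)
    have h2 := Dvd.dvd.mul_left (hN 2 (by decide)) (s 2 : ℤ)
    exact (dvd_add h1 h2).trans (dvd_of_eq (by ring))
  · have h1 := Dvd.dvd.mul_left (hN 0 (by decide)) (s 0 : ℤ)
    have h2 := Dvd.dvd.mul_left (hN 1 (by decide)) (s 1 : ℤ)
    exact (dvd_add h1 h2).trans (dvd_of_eq (by ring))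

/-- Lemma Z -/
lemma lemZ (hD : Lnd D) (hh : HD d D e) {N : ℤ} {t : Fin 3} (hN : ∀ j, j ≠ t → N ∣ d j)
    (ht : ¬ N ∣ d t) :
    D (X t) = 0 ∨ (nu D (X t) = 1 ∧ (∀ j, j ≠ t → X t ∣ D (X j)) ∧
      (¬ N ∣ 2 * d t → ∀ j, j ≠ t → X t ^ 2 ∣ D (X j))) := by
  by_cases h1 : ∀ s, coeff s (D (X t)) ≠ 0 → s t ≠ 0
  · exact Or.inl (ker_of_dvd hD (X_dvd h1))
  right
  push Not at h1
  obtain ⟨s, hs, hst⟩ := h1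
  have hne : D (X t) ≠ 0 := by rintro h; rw [h] at hs; simp at hs
  have hNe : N ∣ d t + e := by
    have := wt_mod hN s
    rw [hh t s hs, hst] at this
    simpa using this
  have h2 : D (D (X t)) = 0 := by
    by_contra h2
    have hdv : X t ∣ D (D (X t)) := by
      refine X_dvd fun u hu hut => ht ?_
      have h3 := wt_mod hN u
      rw [hh.app (hh t) u hu, hut] at h3
      have := dvd_sub (Dvd.dvd.mul_left hNe 2) h3
      simp at this; ring_nf at this; exact this
    have h4 := nu_dvd hD h2 hdv
    have h5 := nu_D hD hne
    have h6 := nu_D hD h2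
    omega
  refine ⟨?_, ?_, ?_⟩
  · rw [nu_D hD hne, (nu_eq_zero hD).mpr h2]
  · intro j hj
    refine X_dvd fun u hu hut => ht ?_
    have h3 := wt_mod hN u
    rw [hh j u hu, hut] at h3
    have := dvd_sub (dvd_add hNe (hN j hj)) h3
    simp at this; ring_nf at this; exact this
  · intro h2t j hj
    refine X_pow_dvd fun u hu => ?_
    have h3 := wt_mod hN u
    rw [hh j u hu] at h3
    by_contra hlt
    have hcase : u t = 0 ∨ u t = 1 := by omega
    rcases hcase with hut | hut
    · rw [hut] at h3
      have := dvd_sub (dvd_add hNe (hN j hj)) h3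
      simp at this; ring_nf at this; exact ht this
    · rw [hut] at h3
      have := dvd_sub (dvd_add hNe (hN j hj)) h3
      simp at this; ring_nf at this; apply h2t; rwa [mul_comm]

lemma nu_of_dvd (hD : Lnd D) {x y : B3 K} {k : ℕ} (hx : x ≠ 0) (h : x ^ k ∣ D y) :
    nu D y = 0 ∨ k * nu D x + 1 ≤ nu D y := by
  by_cases h0 : D y = 0
  · exact Or.inl ((nu_eq_zero hD).mpr h0)
  · right
    rw [nu_D hD h0, ← nu_pow hD hx]
    have := nu_dvd hD h0 h
    omega

end LND

set_option linter.unusedSectionVars false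
section LemB
variable {K : Type*} [Field K] [CharZero K] {d : Fin 3 → ℕ} {R : B3 K} {n : ℤ}

lemma elem_change {i : Fin 3} {P : B3 K} (hP : pderiv i P = 0) (hh : Hm d P (d i)) :
    ∃ ψ : B3 K ≃ₐ[K] B3 K, IsTame ψ ∧ ψ (X i) = X i + P ∧ (∀ j, j ≠ i → ψ (X j) = X j) ∧
      (∀ Q, pderiv i Q = 0 → ψ Q = Q) ∧ (∀ F n, Hm d F n → Hm d (ψ F) n) ∧
      (∀ F n, Hm d F n → Hm d (ψ.symm F) n) ∧
      (∀ F, pderiv i (ψ F) = ψ (pderiv i F)) ∧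
      (∀ j, j ≠ i → ∀ F, pderiv j (ψ F) = ψ (pderiv j F) + pderiv j P * ψ (pderiv i F)) := by
  have hv := notMem_vars_of_free hP
  have hself := elemEquiv_X_self i P hv
  have hne : ∀ j, j ≠ i → elemEquiv i P hv (X j) = X j := fun j hj => elemEquiv_X_ne i P hv hj
  refine ⟨elemEquiv i P hv, elemEquiv_tame i P hv, hself, hne,
    fun Q hQ => elemEquiv_of_notMem i P hv (notMem_vars_of_free hQ), ?_, ?_, ?_, ?_⟩
  · intro F n hF
    refine hF.map (φ := (elemEquiv i P hv).toAlgHom) fun j => ?_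
    by_cases hj : j = i
    · subst hj
      simpa [hself] using (Hm.X j).add hh
    · simpa [hne j hj] using Hm.X j
  · intro F n hF
    refine hF.map (φ := (elemEquiv i P hv).symm.toAlgHom) fun j => ?_
    by_cases hj : j = i
    · subst hj
      simpa [elemEquiv_symm_X_self] using (Hm.X j).sub hh
    · simpa [elemEquiv_symm_X_ne i P hv hj] using Hm.X j
  · intro F
    have := chain_rule (elemEquiv i P hv).toAlgHom i F
    refine this.trans ?_
    rw [Finset.sum_eq_single i]
    · simp [hself, hP]
    · intro b _ hb; simp [hne b hb, pderiv_X_of_ne hb]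
    · simp
  · intro j hj F
    have := chain_rule (elemEquiv i P hv).toAlgHom j F
    refine this.trans ?_
    rw [Finset.sum_eq_add j i hj]
    · simp [hself, hne j hj, pderiv_X_of_ne hj.symm]
    · intro b _ hb; simp [hne b hb.2, pderiv_X_of_ne hb.1]
    · simp
    · simp

lemma irr_map (hR : Irreducible R) (ψ : B3 K ≃ₐ[K] B3 K) : Irreducible (ψ R) :=
  (MulEquiv.irreducible_iff ψ).mpr hR

lemma others : ∀ i : Fin 3, ∃ j k : Fin 3, i ≠ j ∧ i ≠ k ∧ j ≠ k := by decide

lemma wt_two {i j k : Fin 3} (hij : i ≠ j) (hik : i ≠ k) (hjk : j ≠ k) (s : Fin 3 →₀ ℕ)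
    (hs : s i = 0) : wt d s = s j * d j + s k * d k := by
  have : s = Finsupp.single j (s j) + Finsupp.single k (s k) := by
    ext l
    rcases third i j k hij hik hjk l with rfl | rfl | rfl
    · simp [hs, hij, hik]
    · simp [hjk]
    · simp [hjk]
  conv_lhs => rw [this]
  rw [wt_add, wt_single, wt_single]

lemma lemB_arith {dj dk t' r' s' : ℕ} (hdj : 0 < dj) (hdk : 0 < dk) (h1 : r' * dj = t')
    (h2 : s' * dk = t') (ht : 0 < t') : ∃ a b t, 0 < a ∧ 0 < b ∧ 0 < t ∧ Nat.gcd b a = 1 ∧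
      r' = b * t ∧ s' = a * t ∧
      ∀ p q : ℕ, p * dj + q * dk = t' → ∃ i, i ≤ t ∧ p = b * i ∧ q = a * (t - i) := by
  obtain ⟨g, a, b, hg, hab, rfl, rfl⟩ := Nat.exists_coprime' (m := dj) (n := dk)
    (Nat.gcd_pos_of_pos_left _ hdj)
  have ha : 0 < a := Nat.pos_of_mul_pos_right hdj
  have hb : 0 < b := Nat.pos_of_mul_pos_right hdk
  have e1 : r' * a = s' * b := by
    have : (r' * a) * g = (s' * b) * g := by rw [mul_assoc, h1, ← h2, mul_assoc]
    exact Nat.eq_of_mul_eq_mul_right hg this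
  obtain ⟨t, rfl⟩ : b ∣ r' := by
    apply Nat.Coprime.dvd_of_dvd_mul_right hab.symm
    exact ⟨s', by rw [e1]; ring⟩
  have e2 : s' = a * t := by
    apply Nat.eq_of_mul_eq_mul_right hb; rw [← e1]; ring
  subst e2
  refine ⟨a, b, t, ha, hb, ?_, hab.symm, rfl, rfl, ?_⟩
  · rcases Nat.eq_zero_or_pos t with rfl | h
    · simp at h1; omega
    · exact h
  · intro p q hpq
    have e3 : p * a + q * b = b * t * a := by
      have : (p * a + q * b) * g = (b * t * a) * g := by rw [← h1] at hpq; linarith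
      exact Nat.eq_of_mul_eq_mul_right hg this
    obtain ⟨i, rfl⟩ : b ∣ p := by
      apply Nat.Coprime.dvd_of_dvd_mul_right hab.symm
      refine (Nat.dvd_add_left (Dvd.intro_left q rfl)).mp (?_ : b ∣ p * a + q * b)
      rw [e3]; exact ⟨t * a, by ring⟩
    have e4 : i * a + q = t * a := by
      apply Nat.eq_of_mul_eq_mul_right hb; linarith
    have hi : i ≤ t := by
      by_contra hlt
      push Not at hlt
      have := Nat.mul_lt_mul_of_pos_right hlt ha
      omega
    refine ⟨i, hi, rfl, ?_⟩
    obtain ⟨u, rfl⟩ := Nat.exists_eq_add_of_le hi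
    rw [Nat.add_sub_cancel_left]; nlinarith

lemma lemB [IsAlgClosed K] (hd : ∀ j, 0 < d j) (hR : Irreducible R) (hn : Hm d R n) {i : Fin 3}
    (hi : pderiv i R = 0) : Concl R := by
  obtain ⟨j, k, hij, hik, hjk⟩ := others i
  by_cases hXj : X j ∣ R
  · exact irr_X hR hXj
  by_cases hXk : X k ∣ R
  · exact irr_X hR hXk
  have hfree := free_iff.mp hi
  have h1 : ∃ s, coeff s R ≠ 0 ∧ s j = 0 := by
    by_contra h; push Not at h; exact hXj (X_dvd h)
  have h2 : ∃ s, coeff s R ≠ 0 ∧ s k = 0 := by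
    by_contra h; push Not at h; exact hXk (X_dvd h)
  obtain ⟨s1, hs1, hs1j⟩ := h1
  obtain ⟨s2, hs2, hs2k⟩ := h2
  have w1 : (s1 k * d k : ℤ) = n := by
    have := wt_two (d := d) hij hik hjk s1 (hfree _ hs1)
    rw [hn _ hs1, hs1j] at this; simpa using this.symm
  have w2 : (s2 j * d j : ℤ) = n := by
    have := wt_two (d := d) hij hik hjk s2 (hfree _ hs2)
    rw [hn _ hs2, hs2k] at this; simpa using this.symm
  have hn0 : 0 < s2 j * d j := by
    apply Nat.pos_of_ne_zero
    intro h0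
    have hs20 : s2 j = 0 := by
      rcases Nat.mul_eq_zero.mp h0 with h | h
      · exact h
      · exact absurd h (hd j).ne'
    have hn0 : n = 0 := by rw [← w2, hs20]; simp
    apply hR.not_isUnit
    rw [isUnit_iff_C]
    refine ⟨coeff 0 R, ?_, ?_⟩
    · have : s2 = 0 := by
        ext l
        rcases third i j k hij hik hjk l with rfl | rfl | rfl
        · exact hfree _ hs2
        · exact hs20
        · exact hs2k
      rwa [this] at hs2
    · ext t
      rw [coeff_C]
      split_ifs with ht
      · rw [ht]
      · by_contra htt
        apply ht
        have hw := hn t htt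
        rw [hn0] at hw
        ext l
        have h1 := le_wt d t l
        have h2 : (0 : ℤ) < d l := by exact_mod_cast hd l
        have h3 : (0 : ℤ) ≤ t l := by positivity
        have : (t l : ℤ) = 0 := by nlinarith
        have h4 : t l = 0 := by exact_mod_cast this
        simp [h4]
  obtain ⟨a, b, t, ha, hb, ht, hgcd, e1, e2, hall⟩ := lemB_arith (hd j) (hd k)
    (t' := s2 j * d j) (r' := s2 j) (s' := s1 k) rfl (by
      have := w1.trans w2.symm; exact_mod_cast this) hn0
  let g : ℕ → (Fin 3 →₀ ℕ) := fun l => Finsupp.single j (b * l) + Finsupp.single k (a * (t - l))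
  have hsum : R = ∑ l ∈ Finset.range (t + 1), monomial (g l) (coeff (g l) R) := by
    classical
    have hinj : Set.InjOn g (Finset.range (t + 1) : Set ℕ) := by
      intro x _ y _ hxy
      have := DFunLike.congr_fun hxy j
      simp [g, hjk] at this
      omega
    rw [← Finset.sum_image (f := fun s => monomial s (coeff s R)) hinj]
    conv_lhs => rw [← support_sum_monomial_coeff R]
    apply Finset.sum_subset
    · intro s hs
      rw [mem_support_iff] at hs
      have h0 := hfree _ hs
      have hw := wt_two (d := d) hij hik hjk s h0
      rw [hn _ hs, ← w2] at hw
      obtain ⟨l, hl, hp, hq⟩ := hall (s j) (s k) (by exact_mod_cast hw.symm)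
      rw [Finset.mem_image]
      refine ⟨l, by simp; omega, ?_⟩
      ext m
      rcases third i j k hij hik hjk m with rfl | rfl | rfl
      · simp [g, h0, hij, hik]
      · simp [g, hjk, hp]
      · simp [g, hjk, hq]
    · intro s _ hs
      rw [notMem_support_iff] at hs
      simp [hs]
  have hmon : ∀ l c, monomial (g l) c = C c * ((X j ^ b) ^ l * (X k ^ a) ^ (t - l) : B3 K) := by
    intro l c
    rw [← mul_one c, ← C_mul_monomial, mul_one, ← pow_mul, ← pow_mul]
    simp only [g]
    rw [X_pow_eq_monomial, X_pow_eq_monomial, monomial_mul, one_mul]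
  let q : Polynomial K := ∑ l ∈ Finset.range (t + 1), Polynomial.monomial l (coeff (g l) R)
  have hqc : ∀ l, l ≤ t → q.coeff l = coeff (g l) R := by
    intro l hl
    simp only [q, Polynomial.finsetSum_coeff, Polynomial.coeff_monomial]
    rw [Finset.sum_ite_eq', if_pos (by simp; omega)]
  have hgt : g t = s2 := by
    ext m
    rcases third i j k hij hik hjk m with rfl | rfl | rfl
    · simp [g, hfree _ hs2, hij]
    · simp [g, e1]
    · simp [g, hs2k, hjk]
  have hg0 : g 0 = s1 := by
    ext m
    rcases third i j k hij hik hjk m with rfl | rfl | rfl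
    · simp [g, hfree _ hs1, hik]
    · simp [g, hs1j, hjk]
    · simp [g, e2]
  obtain ⟨p, hp⟩ := IsAlgClosed.exists_root q (by
    intro hdeg
    have := Polynomial.le_degree_of_ne_zero (n := t) (p := q) (by rw [hqc t le_rfl, hgt]; exact hs2)
    rw [hdeg] at this
    have : t ≤ 0 := by exact_mod_cast this
    omega)
  have hp0 : p ≠ 0 := by
    rintro rfl
    have := Polynomial.zero_isRoot_iff_coeff_zero_eq_zero.mp hp
    rw [hqc 0 (by omega), hg0] at this
    exact hs1 this
  have hps : ∑ l ∈ Finset.range (t + 1), coeff (g l) R * p ^ l = 0 := by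
    have : q.eval p = 0 := hp
    simpa [q, Polynomial.eval_finsetSum] using this
  have hdvd : X j ^ b - C p * X k ^ a ∣ R := by
    have hR2 : R = ∑ l ∈ Finset.range (t + 1), (C (coeff (g l) R) * (X k ^ a) ^ (t - l)) *
        ((X j ^ b) ^ l - (C p * X k ^ a) ^ l) := by
      have h0 : ∑ l ∈ Finset.range (t + 1), C (coeff (g l) R) * ((X k ^ a) ^ (t - l)) *
        (C p * X k ^ a) ^ l = (0 : B3 K) := by
        have : ∀ l ∈ Finset.range (t + 1), C (coeff (g l) R) * ((X k ^ a) ^ (t - l)) *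
          (C p * X k ^ a) ^ l = C (coeff (g l) R * p ^ l) * (X k ^ a : B3 K) ^ t := by
          intro l hl
          simp at hl
          obtain ⟨u, hu⟩ := Nat.exists_eq_add_of_le (by omega : l ≤ t)
          rw [hu, Nat.add_sub_cancel_left, mul_pow, C_mul, C_pow]; ring
        rw [Finset.sum_congr rfl this, ← Finset.sum_mul, ← map_sum, hps]; simp
      conv_lhs => rw [hsum]
      rw [← sub_zero (∑ l ∈ Finset.range (t + 1), monomial (g l) (coeff (g l) R)), ← h0,
        ← Finset.sum_sub_distrib]
      refine Finset.sum_congr rfl fun l _ => ?_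
      rw [hmon]; ring
    rw [hR2]
    exact Finset.dvd_sum fun l _ => Dvd.dvd.mul_left (sub_dvd_pow_sub_pow _ _ l) _
  have hnu : ¬ IsUnit (X j ^ b - C p * X k ^ a : B3 K) := by
    intro hu
    have := hu.map (aeval (fun _ => 0 : Fin 3 → K))
    simp [ha.ne', hb.ne'] at this
  obtain ⟨c, hc, hfin⟩ := irr_dvd hR hnu hdvd
  refine concl_pow hc (b := -(c * p)) (by simp [hc, hp0]) hjk hb ha hgcd ?_
  rw [hfin]; simp only [C_neg, C_mul]; ring

lemma lemS [IsAlgClosed K] (hd : ∀ j, 0 < d j) (hR : Irreducible R) (hn : Hm d R n) {i j : Fin 3}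
    (hij : i ≠ j) {c : K} (hc : c ≠ 0) {q : B3 K} (hq : pderiv j q = 0) (hqh : Hm d q (d j - d i))
    (h : C c * pderiv i R + q * pderiv j R = 0) : Concl R := by
  obtain ⟨P, hP1, hP2, hP3⟩ := exists_anti i (C c⁻¹ * q)
  have hPj : pderiv j P = 0 := hP3 j hij.symm (by simp [Derivation.leibniz, hq])
  have hPh : Hm d P (d j) := (hP2 d _ (hqh.C_mul _)).congr (by ring)
  obtain ⟨ψ, ht, -, -, hf, hH, -, -, h2⟩ := elem_change hPj hPh
  refine Concl.of_tame ht (lemB hd (irr_map hR ψ) (hH _ _ hn) (i := i) ?_)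
  rw [h2 i hij, hP1]
  have := congrArg ψ h
  rw [map_add, map_mul, map_mul, hf q hq, map_zero, hf (C c) (by simp)] at this
  have h3 : (C c⁻¹ * C c : B3 K) = 1 := by rw [← C_mul, inv_mul_cancel₀ hc, C_1]
  linear_combination C c⁻¹ * this - ψ (pderiv i R) * h3

lemma lemA [IsAlgClosed K] (hd : ∀ j, 0 < d j) (hR : Irreducible R) (hn : Hm d R n)
    {c : K} (hc : c ≠ 0) {a b : B3 K} (ha1 : pderiv 1 a = 0) (ha2 : pderiv 2 a = 0)
    (hb2 : pderiv 2 b = 0) (hah : Hm d a (d 1 - d 0)) (hbh : Hm d b (d 2 - d 0))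
    (h : C c * pderiv 0 R + a * pderiv 1 R + b * pderiv 2 R = 0) : Concl R := by
  obtain ⟨P, hP1, hP2, hP3⟩ := exists_anti 0 (C c⁻¹ * a)
  have hPj : pderiv 1 P = 0 := hP3 1 (by decide) (by simp [Derivation.leibniz, ha1])
  have hPk : pderiv 2 P = 0 := hP3 2 (by decide) (by simp [Derivation.leibniz, ha2])
  have hPh : Hm d P (d 1) := (hP2 d _ (hah.C_mul _)).congr (by ring)
  obtain ⟨ψ, ht, -, -, hf, hH, -, -, h2⟩ := elem_change hPj hPh
  have hD2 : ∀ F, pderiv 2 (ψ F) = ψ (pderiv 2 F) := by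
    intro F; rw [h2 2 (by decide), hPk]; simp
  refine Concl.of_tame ht (lemS hd (irr_map hR ψ) (hH _ _ hn) (i := 0) (j := 2) (by decide) hc
    (q := ψ b) (by rw [hD2, hb2, map_zero]) (hH _ _ hbh) ?_)
  rw [hD2, h2 0 (by decide), hP1]
  have := congrArg ψ h
  rw [map_add, map_add, map_mul, map_mul, map_mul, hf a ha1, map_zero, hf (C c) (by simp)] at this
  have h3 : (C c⁻¹ * C c : B3 K) = 1 := by rw [← C_mul, inv_mul_cancel₀ hc, C_1]
  linear_combination this + a * ψ (pderiv 1 R) * h3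

end LemB

set_option linter.unusedSectionVars false
section EndA
variable {K : Type*} [Field K] [CharZero K] {d : Fin 3 → ℕ} {R F : B3 K} {n : ℤ}

lemma pd_comm (i j : Fin 3) (F : B3 K) : pderiv i (pderiv j F) = pderiv j (pderiv i F) := by
  ext s
  simp only [coeff_pderiv]
  by_cases h : i = j
  · subst h; rfl
  · have h' : j ≠ i := fun hh => h hh.symm
    rw [add_right_comm]
    simp [h, h']
    ring

lemma le_of_pderiv {i : Fin 3} {k : ℕ} (h : ∀ s, coeff s (pderiv i F) ≠ 0 → s i ≤ k) :
    ∀ s, coeff s F ≠ 0 → s i ≤ k + 1 := by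
  intro s hs
  by_contra hlt
  push Not at hlt
  have h2 : s - Finsupp.single i 1 + Finsupp.single i 1 = s :=
    tsub_add_cancel_of_le (Finsupp.single_le_iff.mpr (by omega))
  have h3 : coeff (s - Finsupp.single i 1) (pderiv i F) ≠ 0 := by
    rw [coeff_pderiv, h2]
    exact mul_ne_zero hs (Nat.cast_add_one_ne_zero _)
  have := h _ h3
  simp at this
  omega

lemma endA [IsAlgClosed K] (hd : ∀ j, 0 < d j) (h01 : d 0 ≤ d 1) (h12 : d 1 ≤ d 2)
    (hR : Irreducible R) (hn : Hm d R n) {D : Fin 3 → B3 K} {t : ℤ} (ht : 1 ≤ t)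
    (hD : ∀ j, Hm d (D j) (d j - t)) (hne : ∃ j, D j ≠ 0)
    (hw : D 0 = 0 → n + 4 ≤ d 0 + d 1 + d 2 + t)
    (h : D 0 * pderiv 0 R + D 1 * pderiv 1 R + D 2 * pderiv 2 R = 0) : Concl R := by
  have hd0 := hd 0
  have f00 : pderiv 0 (D 0) = 0 := (hD 0).free (by omega)
  have f01 : pderiv 1 (D 0) = 0 := (hD 0).free (by omega)
  have f02 : pderiv 2 (D 0) = 0 := (hD 0).free (by omega)
  have f11 : pderiv 1 (D 1) = 0 := (hD 1).free (by omega)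
  have f12 : pderiv 2 (D 1) = 0 := (hD 1).free (by omega)
  have f22 : pderiv 2 (D 2) = 0 := (hD 2).free (by omega)
  by_cases hD0 : D 0 = 0
  swap
  · obtain ⟨c, l, hc, hDc, hl⟩ := one_var (by decide) (by decide) (by decide : (1 : Fin 3) ≠ 2)
      (hd 0) (hD 0) hD0 f01 f02
    have hl0 : l = 0 := by
      by_contra hl0
      have : (1 : ℤ) ≤ l := by omega
      nlinarith
    subst hl0
    have htd : t = d 0 := by simp at hl; omega
    subst htd
    rw [pow_zero, mul_one] at hDc
    rw [hDc] at h
    exact lemA hd hR hn hc f11 f12 f22 (hD 1) (hD 2) h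
  rw [hD0, zero_mul, zero_add] at h
  replace hw := hw hD0
  by_cases hD1 : D 1 = 0
  · rw [hD1, zero_mul, zero_add] at h
    have hD2 : D 2 ≠ 0 := by
      obtain ⟨j, hj⟩ := hne
      fin_cases j
      · exact absurd hD0 hj
      · exact absurd hD1 hj
      · exact hj
    exact lemB hd hR hn ((mul_eq_zero.mp h).resolve_left hD2)
  obtain ⟨a, l, ha, hDa, hl⟩ := one_var (by decide) (by decide) (by decide : (1 : Fin 3) ≠ 2)
      (hd 0) (hD 1) hD1 f11 f12
  rcases Nat.eq_zero_or_pos l with rfl | hlpos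
  · have htd : t = d 1 := by simp at hl; omega
    subst htd
    rw [pow_zero, mul_one] at hDa
    rw [hDa] at h
    exact lemS hd hR hn (by decide) ha f22 (hD 2) h
  have hn' : n + 4 ≤ 2 * d 1 + d 2 := by
    have : (1 : ℤ) ≤ l := by omega
    have : (0 : ℤ) < d 0 := by omega
    nlinarith
  set A := D 1 with hA
  set q := D 2 with hq
  by_cases hR2 : pderiv 2 R = 0
  · exact lemB hd hR hn hR2
  have eq2 : A * pderiv 1 (pderiv 2 R) + q * pderiv 2 (pderiv 2 R) = 0 := by
    have := congrArg (pderiv 2) h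
    simp only [map_add, Derivation.leibniz, smul_eq_mul, f12, f22, mul_zero, add_zero, map_zero] at this
    rw [pd_comm 2 1] at this
    exact this
  by_cases hR22 : pderiv 2 (pderiv 2 R) = 0
  · rw [hR22, mul_zero, add_zero] at eq2
    have h12' := (mul_eq_zero.mp eq2).resolve_left hD1
    obtain ⟨c, k, hc, hk, -⟩ := one_var (by decide) (by decide) (by decide : (1 : Fin 3) ≠ 2)
      (hd 0) (hn.pderiv 2) hR2 h12' hR22
    refine concl_lin (P := R - C c * X 0 ^ k * X 2) hc (by decide : (0 : Fin 3) ≠ 2) (k := k) ?_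
      (by ring)
    rw [map_sub, hk]
    simp [Derivation.leibniz, Derivation.leibniz_pow]
  have hR222 : pderiv 2 (pderiv 2 (pderiv 2 R)) = 0 :=
    (((hn.pderiv 2).pderiv 2).pderiv 2).eq_zero (by omega)
  have eq3 : A * pderiv 1 (pderiv 2 (pderiv 2 R)) = 0 := by
    have := congrArg (pderiv 2) eq2
    simp only [map_add, Derivation.leibniz, smul_eq_mul, f12, f22, mul_zero, add_zero, map_zero,
      hR222] at this
    rw [pd_comm 2 1] at this
    exact this
  have hR221 := (mul_eq_zero.mp eq3).resolve_left hD1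
  have key : pderiv 1 R * pderiv 2 (pderiv 2 R) = pderiv 1 (pderiv 2 R) * pderiv 2 R := by
    have : A * (pderiv 1 R * pderiv 2 (pderiv 2 R) - pderiv 1 (pderiv 2 R) * pderiv 2 R) = 0 := by
      linear_combination pderiv 2 (pderiv 2 R) * h - pderiv 2 R * eq2
    exact sub_eq_zero.mp ((mul_eq_zero.mp this).resolve_left hD1)
  obtain ⟨c, k, hc, hk, hkn⟩ := one_var (by decide) (by decide) (by decide : (1 : Fin 3) ≠ 2)
      (hd 0) ((hn.pderiv 2).pderiv 2) hR22 hR221 hR222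
  rcases Nat.eq_zero_or_pos k with rfl | hkpos
  · rw [pow_zero, mul_one] at hk
    refine lemS hd hR hn (i := 1) (j := 2) (by decide) hc (q := -pderiv 1 (pderiv 2 R)) ?_ ?_ ?_
    · rw [map_neg, pd_comm 2 1, hR221, neg_zero]
    · refine (((hn.pderiv 2).pderiv 1).neg).congr ?_
      simp at hkn; omega
    · rw [hk] at key; linear_combination key
  have hR112 : pderiv 1 (pderiv 1 (pderiv 2 R)) = 0 :=
    (((hn.pderiv 2).pderiv 1).pderiv 1).eq_zero (by omega)
  have hR111 : pderiv 1 (pderiv 1 (pderiv 1 R)) = 0 := by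
    have := congrArg (fun x => pderiv 1 (pderiv 1 x)) key
    simp only [map_add, Derivation.leibniz, smul_eq_mul, hR221, hR112, mul_zero, add_zero, zero_add,
      map_zero] at this
    exact (mul_eq_zero.mp this).resolve_left hR22
  have hb1 := le_of_pderiv (le_of_pderiv (k := 0) fun s hs => (free_iff.mp hR111 s hs).le)
  refine irr_X hR (i := 0) (X_dvd fun s hs hs0 => ?_)
  have hs1 := hb1 s hs
  have hws := hn s hs
  have hkd : (0 : ℤ) < k * d 0 := by positivity
  simp only [wt, hs0] at hws
  have hs2 : s 2 ≤ 2 := by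
    by_contra hlt
    push Not at hlt
    have h1 := le_wt d s 2
    rw [hn s hs] at h1
    have : (3 : ℤ) ≤ s 2 := by omega
    nlinarith
  obtain ⟨x, hx⟩ : ∃ x, s 1 = x := ⟨_, rfl⟩
  obtain ⟨y, hy⟩ : ∃ y, s 2 = y := ⟨_, rfl⟩
  rw [hx, hy] at hws
  rw [hx] at hs1
  rw [hy] at hs2
  interval_cases x <;> interval_cases y <;> simp at hws <;> omega

end EndA

set_option linter.unusedSectionVars false
section Excl
variable {K : Type*} [Field K] [CharZero K] [IsAlgClosed K] {d : Fin 3 → ℕ} {R : B3 K} {n : ℤ}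
  {D : Derivation K (B3 K) (B3 K)} {e : ℤ}

/-- Context: an irreducible homogeneous polynomial killed by a nonzero homogeneous locally
nilpotent derivation. -/
structure Cx (d : Fin 3 → ℕ) (R : B3 K) (n : ℤ) (D : Derivation K (B3 K) (B3 K)) (e : ℤ) : Prop where
  hd : ∀ j, 0 < d j
  irr : Irreducible R
  hm : Hm d R n
  lnd : Lnd D
  hD : HD d D e
  ne : D ≠ 0
  ker : D R = 0

lemma Cx.two_ker (h : Cx d R n D e) {i j : Fin 3} (hij : i ≠ j) (hi : nu D (X i) = 0)
    (hj : nu D (X j) = 0) : Concl R := by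
  rw [nu_eq_zero h.lnd] at hi hj
  obtain ⟨k, hk⟩ := D_ne h.ne
  have hki : k ≠ i := fun hh => hk (hh ▸ hi)
  have hkj : k ≠ j := fun hh => hk (hh ▸ hj)
  have key : pderiv k R * D (X k) = 0 := by
    have h1 := h.ker
    have h2 : ∀ l, l ≠ k → D (X l) = 0 := by
      intro l hl
      rcases third k i j hki hkj hij l with rfl | rfl | rfl
      · exact absurd rfl hl
      · exact hi
      · exact hj
    rw [der_eq] at h1
    obtain rfl | rfl | rfl : k = 0 ∨ k = 1 ∨ k = 2 := by fin_cases k <;> simp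
    · rw [h2 1 (by decide), h2 2 (by decide)] at h1; simpa using h1
    · rw [h2 0 (by decide), h2 2 (by decide)] at h1; simpa using h1
    · rw [h2 0 (by decide), h2 1 (by decide)] at h1; simpa using h1
  exact lemB h.hd h.irr h.hm ((mul_eq_zero.mp key).resolve_right hk)

/-- repackaged Lemma Z -/
lemma Cx.lemZ (h : Cx d R n D e) (N : ℤ) (t : Fin 3) (hN : ∀ j, j ≠ t → N ∣ d j)
    (ht : ¬ N ∣ d t) :
    nu D (X t) = 0 ∨ (nu D (X t) = 1 ∧ (∀ j, j ≠ t → X t ∣ D (X j)) ∧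
      (∀ j, j ≠ t → nu D (X j) = 0 ∨ 2 ≤ nu D (X j)) ∧
      (¬ N ∣ 2 * d t → ∀ j, j ≠ t → nu D (X j) = 0 ∨ 3 ≤ nu D (X j))) := by
  rcases _root_.lemZ h.lnd h.hD hN ht with h1 | ⟨h1, h2, h3⟩
  · exact Or.inl ((nu_eq_zero h.lnd).mpr h1)
  · refine Or.inr ⟨h1, h2, fun j hj => ?_, fun hn j hj => ?_⟩
    · have := nu_of_dvd h.lnd (k := 1) (X_ne_zero t) (by simpa using h2 j hj)
      omega
    · have := nu_of_dvd h.lnd (k := 2) (X_ne_zero t) (h3 hn j hj)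
      omega

lemma fin3_cases {p : Fin 3 → Prop} (h0 : p 0) (h1 : p 1) (h2 : p 2) : ∀ j, p j := by
  intro j; fin_cases j
  · exact h0
  · exact h1
  · exact h2

lemma not_dvd_of {N a : ℤ} (g q r : ℤ) (hg : 0 < g) (k : ℤ) (hN : N = k * g) (ha : a = (q * k + r) * g)
    (hr : 0 < r) (hrk : r < k) : ¬ N ∣ a := by
  rintro ⟨x, hx⟩
  rw [hN, ha] at hx
  have h1 : q * k + r = k * x := by
    have : (q * k + r) * g = (k * x) * g := by rw [hx]; ring
    exact mul_right_cancel₀ hg.ne' this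
  have h2 : r = k * (x - q) := by linarith
  have h3 : 0 < x - q := by
    by_contra h3
    push Not at h3
    nlinarith
  nlinarith

lemma not_irr_sq {c : K} {F : B3 K} (h : Irreducible (C c * F ^ 2)) : False := by
  have hc : c ≠ 0 := by rintro rfl; exact h.ne_zero (by simp)
  have hcu : IsUnit (C c : B3 K) := isUnit_iff_C.mpr ⟨c, hc, rfl⟩
  have hFu : IsUnit F := by
    rcases h.isUnit_or_isUnit (show C c * F ^ 2 = (C c * F) * F by ring) with h1 | h1
    · exact isUnit_of_mul_isUnit_right h1
    · exact h1
  exact h.not_isUnit (hcu.mul (hFu.pow 2))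

lemma Cx.nuR (h : Cx d R n D e) : nu D R = 0 := (nu_eq_zero h.lnd).mpr h.ker

lemma exE8 (h : Cx d R n D e) {g : ℕ} (h0 : d 0 = 6 * g) (h1 : d 1 = 10 * g) (h2 : d 2 = 15 * g) :
    Concl R := by
  have hg : (0 : ℤ) < g := by have := h.hd 0; omega
  have z0 := h.lemZ (5 * g) 0 (fin3_cases (by simp) (fun _ => ⟨2, by rw [h1]; push_cast; ring⟩)
    (fun _ => ⟨3, by rw [h2]; push_cast; ring⟩))
    (not_dvd_of g 1 1 hg 5 rfl (by rw [h0]; push_cast; ring) (by norm_num) (by norm_num))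
  have z1 := h.lemZ (3 * g) 1 (fin3_cases (fun _ => ⟨2, by rw [h0]; push_cast; ring⟩) (by simp)
    (fun _ => ⟨5, by rw [h2]; push_cast; ring⟩))
    (not_dvd_of g 3 1 hg 3 rfl (by rw [h1]; push_cast; ring) (by norm_num) (by norm_num))
  have z2 := h.lemZ (2 * g) 2 (fin3_cases (fun _ => ⟨3, by rw [h0]; push_cast; ring⟩)
    (fun _ => ⟨5, by rw [h1]; push_cast; ring⟩) (by simp))
    (not_dvd_of g 7 1 hg 2 rfl (by rw [h2]; push_cast; ring) (by norm_num) (by norm_num))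
  rcases z0 with z0 | ⟨z0, -, z0', -⟩
  · rcases z1 with z1 | ⟨z1, -, z1', -⟩
    · exact h.two_ker (by decide : (0 : Fin 3) ≠ 1) z0 z1
    · have := z1' 2 (by decide)
      exact h.two_ker (by decide : (0 : Fin 3) ≠ 2) z0 (by omega)
  · have a1 := z0' 1 (by decide)
    have a2 := z0' 2 (by decide)
    exact h.two_ker (by decide : (1 : Fin 3) ≠ 2) (by omega) (by omega)

lemma exE7 (h : Cx d R n D e) {g : ℕ} (h0 : d 0 = 4 * g) (h1 : d 1 = 6 * g) (h2 : d 2 = 9 * g)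
    {c b ρ : K} (hc : c ≠ 0) (hb : b ≠ 0) (hρ : ρ ≠ 0)
    (hR : R = C c * X 2 ^ 2 + X 1 * (C b * X 1 ^ 2 + C ρ * X 0 ^ 3)) : Concl R := by
  have hg : (0 : ℤ) < g := by have := h.hd 0; omega
  have z0 := h.lemZ (3 * g) 0 (fin3_cases (by simp) (fun _ => ⟨2, by rw [h1]; push_cast; ring⟩)
    (fun _ => ⟨3, by rw [h2]; push_cast; ring⟩))
    (not_dvd_of g 1 1 hg 3 rfl (by rw [h0]; push_cast; ring) (by norm_num) (by norm_num))
  have z2 := h.lemZ (2 * g) 2 (fin3_cases (fun _ => ⟨2, by rw [h0]; push_cast; ring⟩)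
    (fun _ => ⟨3, by rw [h1]; push_cast; ring⟩) (by simp))
    (not_dvd_of g 4 1 hg 2 rfl (by rw [h2]; push_cast; ring) (by norm_num) (by norm_num))
  have hl := h.lnd
  set Q : B3 K := C b * X 1 ^ 2 + C ρ * X 0 ^ 3 with hQ
  by_cases hQ0 : Q = 0
  · exact irr_X h.irr (i := 2) ⟨C c * X 2, by rw [hR, hQ0]; ring⟩
  have e1 : X 1 * Q = R + -(C c * X 2 ^ 2) := by rw [hR]; ring
  have n1 : nu D (X 1 * Q) = nu D (X 1) + nu D Q := nu_mul hl (X_ne_zero _) hQ0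
  have n2 : nu D (-(C c * X 2 ^ 2)) = 2 * nu D (X 2) := by
    rw [nu_neg, nu_C_mul hl hc, nu_pow hl (X_ne_zero _)]
  rcases z2 with z2 | ⟨z2, -, z2', -⟩
  · have := nu_add hl R (-(C c * X 2 ^ 2))
    rw [← e1, n1, n2, h.nuR, z2] at this
    exact h.two_ker (by decide : (1 : Fin 3) ≠ 2) (by omega) z2
  · have a1 := z2' 1 (by decide)
    have a0 := z2' 0 (by decide)
    have z00 : nu D (X 0) = 0 := by omega
    rcases a1 with a1 | a1
    · exact h.two_ker (by decide : (0 : Fin 3) ≠ 1) z00 a1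
    · exfalso
      have n3 := nu_add_of_lt hl (a := R) (b := -(C c * X 2 ^ 2)) (by rw [n2, h.nuR, z2]; norm_num)
      rw [← e1, n1, n2, z2] at n3
      have n4 := nu_add_of_lt hl (a := C ρ * X 0 ^ 3) (b := C b * X 1 ^ 2) (by
        rw [nu_C_mul hl hb, nu_C_mul hl hρ, nu_pow hl (X_ne_zero _), nu_pow hl (X_ne_zero _)]; omega)
      rw [add_comm, ← hQ, nu_C_mul hl hb, nu_pow hl (X_ne_zero _)] at n4
      omega

lemma exists_sq (a b : K) (ha : a ≠ 0) (hb : b ≠ 0) : ∃ κ : K, κ ≠ 0 ∧ b = -(a * κ ^ 2) := by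
  obtain ⟨κ, hκ⟩ := IsAlgClosed.exists_pow_nat_eq (-b / a) (n := 2) (by norm_num)
  refine ⟨κ, ?_, ?_⟩
  · rintro rfl
    rw [zero_pow (by norm_num)] at hκ
    have := hκ.symm
    rw [div_eq_zero_iff] at this
    simp [ha, hb] at this
  · rw [hκ]; field_simp

lemma exE6 (h : Cx d R n D e) {g : ℕ} (h0 : d 0 = 3 * g) (h1 : d 1 = 4 * g) (h2 : d 2 = 6 * g)
    {c b σ : K} (hc : c ≠ 0) (hb : b ≠ 0) (hσ : σ ≠ 0)
    (hR : R = C c * X 2 ^ 2 + C b * X 1 ^ 3 + C σ * X 0 ^ 4) : Concl R := by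
  have hg : (0 : ℤ) < g := by have := h.hd 0; omega
  have z0 := h.lemZ (2 * g) 0 (fin3_cases (by simp) (fun _ => ⟨2, by rw [h1]; push_cast; ring⟩)
    (fun _ => ⟨3, by rw [h2]; push_cast; ring⟩))
    (not_dvd_of g 1 1 hg 2 rfl (by rw [h0]; push_cast; ring) (by norm_num) (by norm_num))
  have z1 := h.lemZ (3 * g) 1 (fin3_cases (fun _ => ⟨1, by rw [h0]; push_cast; ring⟩) (by simp)
    (fun _ => ⟨2, by rw [h2]; push_cast; ring⟩))
    (not_dvd_of g 1 1 hg 3 rfl (by rw [h1]; push_cast; ring) (by norm_num) (by norm_num))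
  have hl := h.lnd
  obtain ⟨κ, hκ0, hκ⟩ := exists_sq c σ hc hσ
  have e1 : C c * ((X 2 - C κ * X 0 ^ 2) * (X 2 + C κ * X 0 ^ 2)) = R + -(C b * X 1 ^ 3) := by
    rw [hR, hκ]; simp only [C_neg, C_mul, C_pow]; ring
  have n2 : nu D (-(C b * X 1 ^ 3)) = 3 * nu D (X 1) := by
    rw [nu_neg, nu_C_mul hl hb, nu_pow hl (X_ne_zero _)]
  set A : B3 K := X 2 - C κ * X 0 ^ 2 with hA
  set B : B3 K := X 2 + C κ * X 0 ^ 2 with hB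
  by_cases hAB : A * B = 0
  · refine irr_X h.irr (i := 1) ⟨C b * X 1 ^ 2, ?_⟩
    rw [hAB, mul_zero] at e1
    linear_combination -e1
  have n1 : nu D (C c * (A * B)) = nu D A + nu D B := by
    rw [nu_C_mul hl hc, nu_mul hl (left_ne_zero_of_mul hAB) (right_ne_zero_of_mul hAB)]
  rcases z1 with z1 | ⟨z1, -, -, z1'⟩
  · have := nu_add hl R (-(C b * X 1 ^ 3))
    rw [← e1, n1, n2, h.nuR, z1] at this
    have h3 := nu_add hl A B
    rw [show A + B = C 2 * X 2 by simp only [hA, hB, map_ofNat]; ring, nu_C_mul hl (by norm_num)] at h3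
    exact h.two_ker (by decide : (1 : Fin 3) ≠ 2) z1 (by omega)
  · have a0 := z1' (not_dvd_of g 2 2 hg 3 rfl (by rw [h1]; push_cast; ring) (by norm_num)
      (by norm_num)) 0 (by decide)
    have z00 : nu D (X 0) = 0 := by omega
    exfalso
    have n3 : nu D (C σ * X 0 ^ 4) = 0 := by
      rw [nu_C_mul hl hσ, nu_pow hl (X_ne_zero _), z00]
    have n4 := nu_sub hl R (C σ * X 0 ^ 4)
    rw [n3, h.nuR] at n4
    have n5 := nu_add_of_lt hl (a := R - C σ * X 0 ^ 4) (b := -(C b * X 1 ^ 3)) (by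
      rw [n2, z1]; omega)
    rw [n2, z1, show R - C σ * X 0 ^ 4 + -(C b * X 1 ^ 3) = C c * X 2 ^ 2 by rw [hR]; ring,
      nu_C_mul hl hc, nu_pow hl (X_ne_zero _)] at n5
    omega

lemma exDodd (h : Cx d R n D e) {g m : ℕ} (hm : 2 ≤ m) (h0 : d 0 = 2 * g) (h1 : d 1 + g = 2 * m * g)
    (h2 : d 2 = 2 * m * g) {c α γ : K} (hc : c ≠ 0) (hα : α ≠ 0) (hγ : γ ≠ 0)
    (hR : R = C c * X 2 ^ 2 + C α * (X 0 * X 1 ^ 2) + C γ * X 0 ^ (2 * m)) : Concl R := by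
  have hg : (0 : ℤ) < g := by have := h.hd 0; omega
  have z1 := h.lemZ (2 * g) 1 (fin3_cases (fun _ => ⟨1, by rw [h0]; push_cast; ring⟩) (by simp)
    (fun _ => ⟨m, by rw [h2]; push_cast; ring⟩))
    (not_dvd_of g (m - 1) 1 hg 2 rfl (by
      have : (d 1 : ℤ) + g = 2 * m * g := by exact_mod_cast h1
      linarith) (by norm_num) (by norm_num))
  have hl := h.lnd
  obtain ⟨κ, hκ0, hκ⟩ := exists_sq c γ hc hγ
  have hg2 : C γ = -(C c * C κ ^ 2 : B3 K) := by rw [hκ]; simp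
  have e1 : C c * ((X 2 - C κ * X 0 ^ m) * (X 2 + C κ * X 0 ^ m)) =
      R + -(C α * (X 0 * X 1 ^ 2)) := by
    rw [hR, hg2]; ring
  have n2 : nu D (-(C α * (X 0 * X 1 ^ 2))) = nu D (X 0) + 2 * nu D (X 1) := by
    rw [nu_neg, nu_C_mul hl hα, nu_mul hl (X_ne_zero _) (pow_ne_zero _ (X_ne_zero _)),
      nu_pow hl (X_ne_zero _)]
  by_cases hAB : (X 2 - C κ * X 0 ^ m) * (X 2 + C κ * X 0 ^ m : B3 K) = 0
  · refine irr_X h.irr (i := 0) ⟨C α * X 1 ^ 2, ?_⟩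
    rw [hAB, mul_zero] at e1
    linear_combination -e1
  have n1 : nu D (C c * ((X 2 - C κ * X 0 ^ m) * (X 2 + C κ * X 0 ^ m))) =
      nu D (X 2 - C κ * X 0 ^ m) + nu D (X 2 + C κ * X 0 ^ m) := by
    rw [nu_C_mul hl hc, nu_mul hl (left_ne_zero_of_mul hAB) (right_ne_zero_of_mul hAB)]
  have n3 := nu_sub hl (X 2 + C κ * X 0 ^ m) (X 2 - C κ * X 0 ^ m)
  rw [show (X 2 + C κ * X 0 ^ m) - (X 2 - C κ * X 0 ^ m) = C (2 * κ) * (X 0 ^ m : B3 K) by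
    simp only [C_mul, map_ofNat]; ring, nu_C_mul hl (by simp [hκ0]), nu_pow hl (X_ne_zero _)] at n3
  have hm0 : 2 * nu D (X 0) ≤ m * nu D (X 0) := Nat.mul_le_mul_right _ hm
  rcases z1 with z1 | ⟨z1, -, z1', -⟩
  · rcases Nat.eq_zero_or_pos (nu D (X 0)) with z0 | z0
    · exact h.two_ker (by decide : (0 : Fin 3) ≠ 1) z0 z1
    · exfalso
      have n4 := nu_add_of_lt hl (a := R) (b := -(C α * (X 0 * X 1 ^ 2))) (by
        rw [n2, h.nuR]; omega)
      rw [← e1, n1, n2] at n4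
      omega
  · have a0 := z1' 0 (by decide)
    have a2 := z1' 2 (by decide)
    rcases a0 with a0 | a0
    · exfalso
      have n6 : nu D (C γ * X 0 ^ (2 * m)) = 0 := by
        rw [nu_C_mul hl hγ, nu_pow hl (X_ne_zero _), a0, mul_zero]
      have n4 := nu_sub hl R (C γ * X 0 ^ (2 * m))
      rw [n6, h.nuR] at n4
      have n5 := nu_add_of_lt hl (a := R - C γ * X 0 ^ (2 * m)) (b := -(C α * (X 0 * X 1 ^ 2)))
        (by rw [n2, z1]; omega)
      rw [n2, z1, a0, show R - C γ * X 0 ^ (2 * m) + -(C α * (X 0 * X 1 ^ 2)) = C c * X 2 ^ 2 by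
        rw [hR]; ring, nu_C_mul hl hc, nu_pow hl (X_ne_zero _)] at n5
      omega
    · exfalso
      have n4 := nu_add_of_lt hl (a := R) (b := -(C α * (X 0 * X 1 ^ 2))) (by
        rw [n2, h.nuR]; omega)
      rw [← e1, n1, n2] at n4
      have hm2 : m = 2 := by
        by_contra hne
        have : 3 * nu D (X 0) ≤ m * nu D (X 0) := Nat.mul_le_mul_right _ (by omega)
        omega
      subst hm2
      have main : ∀ τ : K, C c * C τ ^ 2 = (C c * C κ ^ 2 : B3 K) →
          nu D (X 2 + C τ * X 0 ^ 2) = 0 → False := by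
        intro τ hτ hB
        have e2 : X 0 * (C α * X 1 ^ 2 - C 2 * C c * C τ * X 0 * (X 2 + C τ * X 0 ^ 2)) =
            R + -(C c * (X 2 + C τ * X 0 ^ 2) ^ 2) := by
          rw [hR, hg2, ← hτ]; simp only [map_ofNat]; ring
        have n7 : nu D (-(C c * (X 2 + C τ * X 0 ^ 2) ^ 2)) = 0 := by
          by_cases hB0 : X 2 + C τ * X 0 ^ 2 = (0 : B3 K)
          · rw [hB0]; simp [nu_eq_zero hl]
          · rw [nu_neg, nu_C_mul hl hc, nu_pow hl hB0, hB]
        have n8 := nu_add hl R (-(C c * (X 2 + C τ * X 0 ^ 2) ^ 2))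
        rw [n7, h.nuR, ← e2] at n8
        by_cases hz : (C α * X 1 ^ 2 - C 2 * C c * C τ * X 0 * (X 2 + C τ * X 0 ^ 2) : B3 K) = 0
        · rw [hz, mul_zero] at e2
          have : R = C c * (X 2 + C τ * X 0 ^ 2) ^ 2 := by linear_combination -e2
          exact not_irr_sq (this ▸ h.irr)
        · rw [nu_mul hl (X_ne_zero _) hz] at n8
          omega
      by_cases hB : nu D (X 2 + C κ * X 0 ^ 2) = 0
      · exact main κ rfl hB
      · refine main (-κ) (by simp) ?_
        rw [show X 2 + C (-κ) * X 0 ^ 2 = (X 2 - C κ * X 0 ^ 2 : B3 K) by simp; ring]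
        omega

lemma exDeven (h : Cx d R n D e) {g l : ℕ} (hl1 : 1 ≤ l) (h0 : d 0 = 2 * g) (h1 : d 1 = 2 * l * g)
    (h2 : d 2 = (2 * l + 1) * g) {c α γ : K} (hc : c ≠ 0) (hα : α ≠ 0) (hγ : γ ≠ 0)
    (hR : R = C c * X 2 ^ 2 + C α * (X 0 * X 1 ^ 2) + C γ * X 0 ^ (2 * l + 1)) : Concl R := by
  have hg : (0 : ℤ) < g := by have := h.hd 0; omega
  have z2 := h.lemZ (2 * g) 2 (fin3_cases (fun _ => ⟨1, by rw [h0]; push_cast; ring⟩)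
    (fun _ => ⟨l, by rw [h1]; push_cast; ring⟩) (by simp))
    (not_dvd_of g l 1 hg 2 rfl (by rw [h2]; push_cast; ring) (by norm_num) (by norm_num))
  have hl := h.lnd
  obtain ⟨κ, hκ0, hκ⟩ := exists_sq α γ hα hγ
  have hg2 : C γ = -(C α * C κ ^ 2 : B3 K) := by rw [hκ]; simp
  set A : B3 K := X 1 - C κ * X 0 ^ l with hA
  set B : B3 K := X 1 + C κ * X 0 ^ l with hB
  have e1 : C α * (X 0 * (A * B)) = R + -(C c * X 2 ^ 2) := by
    rw [hR, hg2, hA, hB]; ring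
  have n2 : nu D (-(C c * X 2 ^ 2)) = 2 * nu D (X 2) := by
    rw [nu_neg, nu_C_mul hl hc, nu_pow hl (X_ne_zero _)]
  by_cases hAB : A * B = 0
  · refine irr_X h.irr (i := 2) ⟨C c * X 2, ?_⟩
    rw [hAB, mul_zero, mul_zero] at e1
    linear_combination -e1
  have n1 : nu D (C α * (X 0 * (A * B))) = nu D (X 0) + (nu D A + nu D B) := by
    rw [nu_C_mul hl hα, nu_mul hl (X_ne_zero _) hAB,
      nu_mul hl (left_ne_zero_of_mul hAB) (right_ne_zero_of_mul hAB)]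
  rcases z2 with z2 | ⟨z2, z2d, z2', -⟩
  · have n3 := nu_add hl R (-(C c * X 2 ^ 2))
    rw [← e1, n1, n2, z2, h.nuR] at n3
    exact h.two_ker (by decide : (0 : Fin 3) ≠ 2) (by omega) z2
  · exfalso
    have n3 := nu_add_of_lt hl (a := R) (b := -(C c * X 2 ^ 2)) (by rw [n2, h.nuR]; omega)
    rw [← e1, n1, n2, z2] at n3
    have a0 := z2' 0 (by decide)
    have d0 := z2d 0 (by decide)
    have d1 := z2d 1 (by decide)
    have dP : X 2 ∣ D (C κ * X 0 ^ l) := by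
      rw [Derivation.leibniz, Derivation.leibniz_pow, show D (C κ) = 0 from D.map_algebraMap κ]
      simp only [smul_eq_mul, nsmul_eq_mul, mul_zero, add_zero]
      exact Dvd.dvd.mul_left (Dvd.dvd.mul_left (Dvd.dvd.mul_left d0 _) _) _
    have aA := nu_of_dvd hl (k := 1) (X_ne_zero 2) (y := A) (by
      rw [pow_one, hA, map_sub]; exact dvd_sub d1 dP)
    have aB := nu_of_dvd hl (k := 1) (X_ne_zero 2) (y := B) (by
      rw [pow_one, hB, map_add]; exact dvd_add d1 dP)
    have nP : nu D (C (2 * κ) * X 0 ^ l) = l * nu D (X 0) := by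
      rw [nu_C_mul hl (by simp [hκ0]), nu_pow hl (X_ne_zero _)]
    have n4 := nu_sub hl B A
    rw [show B - A = C (2 * κ) * X 0 ^ l by simp only [hA, hB, C_mul, map_ofNat]; ring, nP] at n4
    have n5 := nu_sub hl B (C (2 * κ) * X 0 ^ l)
    rw [show B - C (2 * κ) * X 0 ^ l = A by simp only [hA, hB, C_mul, map_ofNat]; ring, nP] at n5
    have n6 := nu_add hl A (C (2 * κ) * X 0 ^ l)
    rw [show A + C (2 * κ) * X 0 ^ l = B by simp only [hA, hB, C_mul, map_ofNat]; ring, nP] at n6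
    have hm0 : 1 * nu D (X 0) ≤ l * nu D (X 0) := Nat.mul_le_mul_right _ hl1
    rw [z2] at aA aB
    rcases a0 with a0 | a0
    · rw [a0] at n3 n5 n6
      simp at n5 n6
      omega
    · omega

end Excl

set_option linter.unusedSectionVars false
section Conj
variable {K : Type*} [Field K] [CharZero K] [IsAlgClosed K] {d : Fin 3 → ℕ} {R : B3 K} {n : ℤ}

/-- conjugate derivation -/
noncomputable def conjD (ψ : B3 K ≃ₐ[K] B3 K) (D : Derivation K (B3 K) (B3 K)) :
    Derivation K (B3 K) (B3 K) :=
  Derivation.mk' (ψ.toLinearMap ∘ₗ D.toLinearMap ∘ₗ ψ.symm.toLinearMap) (by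
    intro a b
    simp [Derivation.leibniz])

lemma conjD_apply (ψ : B3 K ≃ₐ[K] B3 K) (D : Derivation K (B3 K) (B3 K)) (a : B3 K) :
    conjD ψ D a = ψ (D (ψ.symm a)) := rfl

lemma conjD_iter (ψ : B3 K ≃ₐ[K] B3 K) (D : Derivation K (B3 K) (B3 K)) (a : B3 K) (m : ℕ) :
    (conjD ψ D)^[m] a = ψ (D^[m] (ψ.symm a)) := by
  induction m with
  | zero => simp
  | succ m ih => rw [Function.iterate_succ_apply', ih, conjD_apply, Function.iterate_succ_apply']; simp

/-- existential context -/
def CX (d : Fin 3 → ℕ) (R : B3 K) (n : ℤ) : Prop := ∃ D e, Cx d R n D e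

lemma CX.hd (h : CX d R n) : ∀ j, 0 < d j := by obtain ⟨D, e, h⟩ := h; exact h.hd
lemma CX.irr (h : CX d R n) : Irreducible R := by obtain ⟨D, e, h⟩ := h; exact h.irr
lemma CX.hm (h : CX d R n) : Hm d R n := by obtain ⟨D, e, h⟩ := h; exact h.hm

lemma CX.conj (h : CX d R n) (ψ : B3 K ≃ₐ[K] B3 K) (h1 : ∀ F n, Hm d F n → Hm d (ψ F) n)
    (h2 : ∀ F n, Hm d F n → Hm d (ψ.symm F) n) : CX d (ψ R) n := by
  obtain ⟨D, e, h⟩ := h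
  refine ⟨conjD ψ D, e, h.hd, irr_map h.irr ψ, h1 _ _ h.hm, ?_, ?_, ?_, ?_⟩
  · intro a
    obtain ⟨m, hm⟩ := h.lnd (ψ.symm a)
    exact ⟨m, by rw [conjD_iter, hm, map_zero]⟩
  · intro j
    rw [conjD_apply]
    exact h1 _ _ (h.hD.app (h2 _ _ (Hm.X j)))
  · intro h0
    apply h.ne
    ext1 j
    have := congrArg (fun E : Derivation K (B3 K) (B3 K) => E (ψ (X j))) h0
    simp only [conjD_apply, ψ.symm_apply_apply, Derivation.zero_apply] at this
    simpa using this
  · rw [conjD_apply, ψ.symm_apply_apply, h.ker, map_zero]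

/-- elementary change of variables in context -/
lemma CX.change (h : CX d R n) {i : Fin 3} {P : B3 K} (hP : pderiv i P = 0) (hh : Hm d P (d i)) :
    ∃ ψ : B3 K ≃ₐ[K] B3 K, (Concl (ψ R) → Concl R) ∧ CX d (ψ R) n ∧ ψ (X i) = X i + P ∧
      (∀ j, j ≠ i → ψ (X j) = X j) ∧ (∀ Q, pderiv i Q = 0 → ψ Q = Q) := by
  obtain ⟨ψ, h1, h2, h3, h4, h5, h6, -, -⟩ := elem_change hP hh
  exact ⟨ψ, fun hc => Concl.of_tame h1 hc, h.conj ψ h5 h6, h2, h3, h4⟩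

/-- homogeneous polynomial in the first variable only (possibly zero) -/
lemma pure0 (hd : 0 < d 0) {F : B3 K} {n : ℤ} (hF : Hm d F n) (h1 : pderiv 1 F = 0)
    (h2 : pderiv 2 F = 0) : ∃ (c : K) (l : ℕ), F = C c * X 0 ^ l ∧ (c ≠ 0 → (l : ℤ) * d 0 = n) := by
  by_cases h0 : F = 0
  · exact ⟨0, 0, by simp [h0], by simp⟩
  · obtain ⟨c, l, hc, hF, hl⟩ := one_var (by decide) (by decide) (by decide : (1 : Fin 3) ≠ 2)
      hd hF h0 h1 h2
    exact ⟨c, l, hF, fun _ => hl⟩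

lemma const0 (hd : 0 < d 0) (h01 : d 0 ≤ d 1) (h12 : d 1 ≤ d 2) {F : B3 K} {n : ℤ} (hF : Hm d F n)
    (hn : n < d 0) : ∃ c : K, F = C c ∧ (c ≠ 0 → n = 0) := by
  obtain ⟨c, l, h, hl⟩ := pure0 hd hF (hF.free (by omega)) (hF.free (by omega))
  by_cases hc : c = 0
  · exact ⟨0, by simp [h, hc], by simp⟩
  · have := hl hc
    have hl0 : l = 0 := by
      by_contra hl0
      have : (1 : ℤ) ≤ l := by omega
      nlinarith
    subst hl0
    exact ⟨c, by simp [h], fun _ => by simp at this; omega⟩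

lemma typeD (h : CX d R n) (h01 : d 0 ≤ d 1) {c α γ : K}
    (hc : c ≠ 0) (hα : α ≠ 0) (hγ : γ ≠ 0) {m : ℕ} (hw : d 0 + 2 * d 1 = 2 * d 2)
    (hm : m * d 0 = 2 * d 2)
    (hR : R = C c * X 2 ^ 2 + C α * (X 0 * X 1 ^ 2) + C γ * X 0 ^ m) : Concl R := by
  have hd0 := h.hd 0
  obtain ⟨D, e, h⟩ := h
  have hm3 : 3 ≤ m := by
    by_contra hlt
    have : m * d 0 ≤ 2 * d 0 := Nat.mul_le_mul_right _ (by omega)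
    omega
  rcases Nat.even_or_odd' m with ⟨r, rfl | rfl⟩
  · have e2 : d 2 = r * d 0 := by
      have : 2 * (r * d 0) = 2 * d 2 := by rw [← hm]; ring
      omega
    have e3 : d 0 = 2 * (d 0 / 2) := by omega
    refine exDodd h (g := d 0 / 2) (m := r) (by omega) e3 ?_ ?_ hc hα hγ hR
    · have : 2 * r * (d 0 / 2) = d 2 := by
        rw [e2, mul_comm 2 r, mul_assoc, ← e3]
      rw [this]; omega
    · rw [e2, mul_comm 2 r, mul_assoc, ← e3]
  · have e1 : d 1 = r * d 0 := by
      have : 2 * (r * d 0) + d 0 = 2 * d 2 := by rw [← hm]; ring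
      omega
    have e3 : d 0 = 2 * (d 0 / 2) := by
      have : 2 * (r * d 0) + d 0 = 2 * d 2 := by rw [← hm]; ring
      omega
    have e4 : 2 * r * (d 0 / 2) = d 1 := by
      rw [e1, mul_comm 2 r, mul_assoc, ← e3]
    refine exDeven h (g := d 0 / 2) (l := r) (by omega) e3 e4.symm ?_ hc hα hγ hR
    rw [add_mul, e4]; omega

/-- no cubic term -/
lemma endB3 (h : CX d R n) (h01 : d 0 ≤ d 1) (h12 : d 1 ≤ d 2) (hlt : d 2 < d 0 + d 1)
    {c : K} (hc : c ≠ 0) {p0 p1 p2 : B3 K} (hR : R = C c * X 2 ^ 2 + p0 + X 1 * p1 + X 1 ^ 2 * p2)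
    (f01 : pderiv 1 p0 = 0) (f02 : pderiv 2 p0 = 0) (f11 : pderiv 1 p1 = 0) (f12 : pderiv 2 p1 = 0)
    (f21 : pderiv 1 p2 = 0) (f22 : pderiv 2 p2 = 0) (w0 : Hm d p0 (2 * d 2))
    (w1 : Hm d p1 (2 * d 2 - d 1)) (w2 : Hm d p2 (2 * d 2 - 2 * d 1)) : Concl R := by
  have hd0 := h.hd 0
  obtain ⟨α, l, h2, hl⟩ := pure0 hd0 w2 f21 f22
  by_cases hα : α = 0
  · obtain ⟨β, k, h1, hk⟩ := pure0 hd0 w1 f11 f12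
    rw [h2, hα, C_0, zero_mul, mul_zero, add_zero] at hR
    by_cases hβ : β = 0
    · rw [h1, hβ, C_0, zero_mul, mul_zero, add_zero] at hR
      refine lemB h.hd h.irr h.hm (i := 1) ?_
      rw [hR]; simp [Derivation.leibniz, Derivation.leibniz_pow, f01, pderiv_X]
    · refine concl_lin (P := C c * X 2 ^ 2 + p0) hβ (by decide : (0 : Fin 3) ≠ 1) (k := k) ?_ ?_
      · simp [Derivation.leibniz, Derivation.leibniz_pow, f01, pderiv_X]
      · rw [hR, h1]; ring
  replace hl := hl hα
  have hl2 : l = 0 ∨ l = 1 := by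
    by_contra hl2
    have : (2 : ℤ) ≤ l := by omega
    nlinarith
  have h4 : (C (2 * α)⁻¹ * C 2 * C α : B3 K) = 1 := by
    rw [← C_mul, ← C_mul, ← C_1]; congr 1; field_simp
  rw [map_ofNat] at h4
  rcases hl2 with rfl | rfl
  · -- constant coefficient
    simp only [pow_zero, mul_one] at h2
    have hd12 : d 1 = d 2 := by simp at hl; omega
    obtain ⟨ψ, hψ, hCX, s1, s2, s3⟩ := h.change (i := 1) (P := C (-(2 * α)⁻¹) * p1)
      (by simp [Derivation.leibniz, f11]) ((w1.C_mul _).congr (by omega))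
    apply hψ
    have hRψ : ψ R = C c * X 2 ^ 2 + C α * X 1 ^ 2 + (p0 - C (2 * α)⁻¹ * C (2 * α)⁻¹ * C α * p1 ^ 2) := by
      rw [hR, h2]
      simp only [map_add, map_mul, map_pow, s1, s2 2 (by decide), s3 p0 f01, s3 p1 f11,
        s3 (C c) (by simp), s3 (C α) (by simp), C_neg]
      linear_combination (- X 1 * p1 + C (2 * α)⁻¹ * p1 ^ 2) * h4
    obtain ⟨κ, hκ0, hκ⟩ := exists_sq c α hc hα
    have hκ2 : C α = -(C c * C κ ^ 2 : B3 K) := by rw [hκ]; simp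
    obtain ⟨χ, hχ, -, t1, t2, t3⟩ := hCX.change (i := 2) (P := C κ * X 1)
      (by simp [Derivation.leibniz, pderiv_X]) (((Hm.X 1).C_mul _).congr (by omega))
    apply hχ
    refine concl_lin (a := 2 * c * κ) (i := 2) (j := 1) (k := 1) (by simp [hc, hκ0]) (by decide)
      (P := C c * X 2 ^ 2 + (p0 - C (2 * α)⁻¹ * C (2 * α)⁻¹ * C α * p1 ^ 2)) ?_ ?_
    · simp [Derivation.leibniz, Derivation.leibniz_pow, f01, f11, pderiv_X]
    · rw [hRψ]
      simp only [map_add, map_sub, map_mul, map_pow, t1, t2 1 (by decide), t3 p0 f02, t3 p1 f12]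
      rw [t3 (C c) (by simp), t3 (C α) (by simp), t3 (C (2 * α)⁻¹) (by simp), hκ2]
      simp only [map_ofNat]
      ring
  · -- linear coefficient
    rw [pow_one] at h2
    have hw : d 0 + 2 * d 1 = 2 * d 2 := by push_cast at hl; omega
    obtain ⟨β, k, h1, hk⟩ := pure0 hd0 w1 f11 f12
    have hβk : ∃ P : B3 K, pderiv 1 P = 0 ∧ pderiv 2 P = 0 ∧ Hm d P (d 1) ∧ p1 = X 0 * P := by
      by_cases hβ : β = 0
      · exact ⟨0, by simp, by simp, Hm.zero, by rw [h1, hβ]; simp⟩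
      · replace hk := hk hβ
        rcases k with _ | k
        · simp at hk; omega
        · refine ⟨C β * X 0 ^ k, by simp [Derivation.leibniz, Derivation.leibniz_pow, pderiv_X],
            by simp [Derivation.leibniz, Derivation.leibniz_pow, pderiv_X],
            (((Hm.X 0).pow k).C_mul _).congr ?_, by rw [h1]; ring⟩
          push_cast at hk; linarith
    obtain ⟨P, hP1, hP2, hPw, rfl⟩ := hβk
    obtain ⟨ψ, hψ, hCX, s1, s2, s3⟩ := h.change (i := 1) (P := C (-(2 * α)⁻¹) * P)
      (by simp [Derivation.leibniz, hP1]) (hPw.C_mul _)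
    apply hψ
    obtain ⟨γ, m, hγ, hm⟩ := pure0 (n := 2 * d 2) hd0
      (F := p0 - C (2 * α)⁻¹ * C (2 * α)⁻¹ * C α * X 0 * P ^ 2)
      (w0.sub (((((((Hm.C _).mul (Hm.C _)).mul (Hm.C _)).mul (Hm.X 0)).mul (hPw.pow 2))).congr
        (by push_cast; omega)))
      (by simp [Derivation.leibniz, Derivation.leibniz_pow, f01, hP1, pderiv_X])
      (by simp [Derivation.leibniz, Derivation.leibniz_pow, f02, hP2, pderiv_X])
    have hRψ : ψ R = C c * X 2 ^ 2 + C α * (X 0 * X 1 ^ 2) + C γ * X 0 ^ m := by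
      rw [← hγ, hR, h2]
      simp only [map_add, map_mul, map_pow, s1, s2 2 (by decide), s2 0 (by decide), s3 p0 f01,
        s3 P hP1, s3 (C c) (by simp), s3 (C α) (by simp), C_neg]
      linear_combination (- X 1 * X 0 * P + C (2 * α)⁻¹ * X 0 * P ^ 2) * h4
    by_cases hγ0 : γ = 0
    · refine concl_lin (a := α) (i := 1) (j := 0) (k := 2) hα (by decide) (P := C c * X 2 ^ 2) ?_ ?_
      · simp [Derivation.leibniz, Derivation.leibniz_pow, pderiv_X]
      · rw [hRψ, hγ0]; simp; ring
    · refine typeD hCX h01 hc hα hγ0 hw ?_ hRψ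
      exact_mod_cast hm hγ0

end Conj

set_option linter.unusedSectionVars false
set_option linter.unusedSimpArgs false
set_option linter.unusedVariables false
section EndB
variable {K : Type*} [Field K] [CharZero K] [IsAlgClosed K] {d : Fin 3 → ℕ} {R : B3 K} {n : ℤ}

lemma exists_cubic_root {u v w b : K} (h : ¬ (u = 0 ∧ v = 0 ∧ w = 0)) :
    ∃ θ : K, u * θ ^ 3 + v * θ ^ 2 + w * θ + b = 0 := by
  let p : Polynomial K := Polynomial.C u * Polynomial.X ^ 3 + Polynomial.C v * Polynomial.X ^ 2 +
    Polynomial.C w * Polynomial.X + Polynomial.C b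
  have c1 : p.coeff 1 = w := by simp [p, Polynomial.coeff_X]
  have c2 : p.coeff 2 = v := by simp [p, Polynomial.coeff_X, Polynomial.coeff_C]
  have c3 : p.coeff 3 = u := by simp [p, Polynomial.coeff_X, Polynomial.coeff_C]
  have hp : p.degree ≠ 0 := by
    intro h0
    have hC := Polynomial.eq_C_of_degree_eq_zero h0
    apply h
    refine ⟨?_, ?_, ?_⟩
    · rw [← c3, hC]; simp [Polynomial.coeff_C]
    · rw [← c2, hC]; simp [Polynomial.coeff_C]
    · rw [← c1, hC]; simp [Polynomial.coeff_C]
  obtain ⟨θ, hθ⟩ := IsAlgClosed.exists_root p hp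
  refine ⟨θ, ?_⟩
  simpa [p, Polynomial.IsRoot] using hθ

lemma endB2 (h : CX d R n) (h01 : d 0 ≤ d 1) (h12 : d 1 ≤ d 2) (hlt : d 2 < d 0 + d 1)
    {c : K} (hc : c ≠ 0) {p : B3 K} (hR : R = C c * X 2 ^ 2 + p)
    (f : pderiv 2 p = 0) (wp : Hm d p (2 * d 2)) : Concl R := by
  have hd0 := h.hd 0
  obtain ⟨g1, p0, rfl, f01, hw0, hf0⟩ := exists_div 1 p
  obtain ⟨f02, fg1⟩ := hf0 2 (by decide) f
  obtain ⟨w0, wg1⟩ := hw0 d _ wp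
  obtain ⟨g2, p1, rfl, f11, hw1, hf1⟩ := exists_div 1 g1
  obtain ⟨f12, fg2⟩ := hf1 2 (by decide) fg1
  obtain ⟨w1, wg2⟩ := hw1 d _ wg1
  obtain ⟨g3, p2, rfl, f21, hw2, hf2⟩ := exists_div 1 g2
  obtain ⟨f22, fg3⟩ := hf2 2 (by decide) fg2
  obtain ⟨w2, wg3⟩ := hw2 d _ wg2
  replace w2 := w2.congr (m := 2 * d 2 - 2 * d 1) (by ring)
  obtain ⟨b, rfl, hb⟩ := const0 hd0 h01 h12 wg3 (by omega)
  by_cases hb0 : b = 0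
  · subst hb0
    exact endB3 h h01 h12 hlt hc (by rw [hR]; simp; ring) f01 f02 f11 f12 f21 f22 w0 w1 w2
  replace hb : 2 * d 2 = 3 * d 1 := by have := hb hb0; omega
  obtain ⟨w, l2, rfl, hl2⟩ := pure0 hd0 w2 f21 f22
  obtain ⟨v, l1, rfl, hl1⟩ := pure0 hd0 w1 f11 f12
  obtain ⟨u, l0, rfl, hl0⟩ := pure0 hd0 w0 f01 f02
  have key : ∀ {l m : ℕ} {x : ℤ}, (l : ℤ) * d 0 = x → (m : ℤ) * d 0 ≤ x → m ≤ l := by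
    intro l m x h1 h2
    by_contra hh
    have : (l : ℤ) + 1 ≤ m := by omega
    have hd0' : (0 : ℤ) < d 0 := by exact_mod_cast hd0
    nlinarith
  have key2 : ∀ {l m : ℕ} {x : ℤ}, (l : ℤ) * d 0 = x → x < (m : ℤ) * d 0 → l < m := by
    intro l m x h1 h2
    by_contra hh
    have : (m : ℤ) ≤ l := by omega
    have hd0' : (0 : ℤ) < d 0 := by exact_mod_cast hd0
    nlinarith
  by_cases hall : u = 0 ∧ v = 0 ∧ w = 0
  · obtain ⟨rfl, rfl, rfl⟩ := hall
    refine lemB h.hd h.irr h.hm (i := 0) ?_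
    rw [hR]; simp [Derivation.leibniz, Derivation.leibniz_pow, pderiv_X]
  rcases h01.eq_or_lt with h01' | h01'
  · -- equal weights
    have e2 : C w * X 0 ^ l2 = (C w * X 0 : B3 K) := by
      by_cases hw : w = 0
      · simp [hw]
      · have := hl2 hw
        have a1 := key (m := 1) this (by push_cast; omega)
        have a2 := key2 (m := 2) this (by push_cast; omega)
        obtain rfl : l2 = 1 := by omega
        simp
    have e1 : C v * X 0 ^ l1 = (C v * X 0 ^ 2 : B3 K) := by
      by_cases hw : v = 0
      · simp [hw]
      · have := hl1 hw
        have a1 := key (m := 2) this (by push_cast; omega)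
        have a2 := key2 (m := 3) this (by push_cast; omega)
        obtain rfl : l1 = 2 := by omega
        simp
    have e0 : C u * X 0 ^ l0 = (C u * X 0 ^ 3 : B3 K) := by
      by_cases hw : u = 0
      · simp [hw]
      · have := hl0 hw
        have a1 := key (m := 3) this (by push_cast; omega)
        have a2 := key2 (m := 4) this (by push_cast; omega)
        obtain rfl : l0 = 3 := by omega
        simp
    rw [e0, e1, e2] at hR
    obtain ⟨θ, hθ⟩ := exists_cubic_root (b := b) hall
    obtain ⟨ψ, hψ, hCX, s1, s2, s3⟩ := h.change (i := 0) (P := C θ * X 1)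
      (by simp [Derivation.leibniz, pderiv_X]) (((Hm.X 1).C_mul _).congr (by omega))
    apply hψ
    have hθ' := congrArg (C : K → B3 K) hθ
    simp only [map_add, map_mul, map_pow, C_0] at hθ'
    refine endB3 hCX h01 h12 hlt hc (p0 := C u * X 0 ^ 3) (p1 := C (3 * u * θ + v) * X 0 ^ 2)
      (p2 := C (3 * u * θ ^ 2 + 2 * v * θ + w) * X 0) ?_ ?_ ?_ ?_ ?_ ?_ ?_ ?_ ?_ ?_
    · rw [hR]
      simp only [map_add, map_mul, map_pow, s1, s2 1 (by decide), s2 2 (by decide),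
        s3 (C c) (by simp), s3 (C u) (by simp), s3 (C v) (by simp), s3 (C w) (by simp),
        s3 (C b) (by simp), map_ofNat]
      linear_combination (X 1 ^ 3) * hθ'
    all_goals first
      | (simp [Derivation.leibniz, Derivation.leibniz_pow, pderiv_X]; done)
      | skip
    · exact (((Hm.X 0).pow 3).C_mul _).congr (by push_cast; omega)
    · exact (((Hm.X 0).pow 2).C_mul _).congr (by push_cast; omega)
    · exact ((Hm.X 0).C_mul _).congr (by omega)
  · have hw : w = 0 := by
      by_contra hw
      have := hl2 hw
      have a1 := key2 (m := 2) this (by push_cast; omega)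
      have a2 := key (m := 1) this (by push_cast; omega)
      obtain rfl : l2 = 1 := by omega
      push_cast at this; omega
    subst hw
    by_cases hv : v = 0
    · subst hv
      have hu : u ≠ 0 := fun hu => hall ⟨hu, rfl, rfl⟩
      have := hl0 hu
      have a1 := key2 (m := 6) this (by push_cast; omega)
      have a2 := key (m := 3) this (by push_cast; omega)
      have a3 : l0 ≠ 3 := by rintro rfl; push_cast at this; omega
      obtain ⟨D, e, h⟩ := h
      obtain rfl | rfl : l0 = 4 ∨ l0 = 5 := by omega
      · push_cast at this
        refine exE6 h (g := d 0 / 3) (by omega) (by omega) (by omega) hc hb0 hu ?_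
        rw [hR]; simp; ring
      · push_cast at this
        exact exE8 h (g := d 0 / 6) (by omega) (by omega) (by omega)
    · have h3 := hl1 hv
      have a1 := key2 (m := 4) h3 (by push_cast; omega)
      have a2 := key (m := 2) h3 (by push_cast; omega)
      have a3 : l1 ≠ 2 := by rintro rfl; push_cast at h3; omega
      obtain rfl : l1 = 3 := by omega
      push_cast at h3
      have hu : u = 0 := by
        by_contra hu
        have := hl0 hu
        have a1 := key2 (m := 5) this (by push_cast; omega)
        have a2 := key (m := 4) this (by push_cast; omega)
        obtain rfl : l0 = 4 := by omega
        push_cast at this; omega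
      obtain ⟨D, e, h⟩ := h
      refine exE7 h (g := d 0 / 4) (by omega) (by omega) (by omega) hc hb0 hv ?_
      rw [hR, hu]; simp; ring

lemma endB (h : CX d R n) (h01 : d 0 ≤ d 1) (h12 : d 1 ≤ d 2) (hlt : n < d 0 + d 1 + d 2) :
    Concl R := by
  have hd0 := h.hd 0
  obtain ⟨G, H, hR, fH, hwH, -⟩ := exists_div 2 R
  obtain ⟨wH, wG⟩ := hwH d _ h.hm
  obtain ⟨G2, A, rfl, fA, hwA, -⟩ := exists_div 2 G
  obtain ⟨wA, wG2⟩ := hwA d _ wG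
  obtain ⟨c, rfl, hc⟩ := const0 hd0 h01 h12 wG2 (by omega)
  by_cases hc0 : c = 0
  · subst hc0
    rw [C_0, mul_zero, add_zero] at hR
    obtain ⟨A1, A0, rfl, fA0, hwA0, hfA⟩ := exists_div 1 A
    obtain ⟨wA0, wA1⟩ := hwA0 d _ wA
    obtain ⟨fA02, fA1⟩ := hfA 2 (by decide) fA
    obtain ⟨β, rfl, hβ⟩ := const0 hd0 h01 h12 wA1 (by omega)
    obtain ⟨α, k, rfl, -⟩ := pure0 hd0 wA0 fA0 fA02
    by_cases hβ0 : β = 0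
    · subst hβ0
      by_cases hα : α = 0
      · subst hα
        refine lemB h.hd h.irr h.hm (i := 2) ?_
        rw [hR]; simp [fH]
      · exact concl_lin hα (by decide : (0 : Fin 3) ≠ 2) (k := k) fH (by rw [hR]; simp; ring)
    · replace hβ := hβ hβ0
      obtain ⟨ψ, hψ, s1, s2, s3, -, -, -, s4⟩ := elem_change (d := d) (i := 1)
        (P := C (-β⁻¹) * (C α * X 0 ^ k))
        (by simp [Derivation.leibniz, Derivation.leibniz_pow, pderiv_X])
        ((wA0.C_mul _).congr (by omega))
      apply Concl.of_tame hψ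
      have hbb : (C β * C β⁻¹ : B3 K) = 1 := by rw [← C_mul, mul_inv_cancel₀ hβ0, C_1]
      refine concl_lin hβ0 (by decide : (1 : Fin 3) ≠ 2) (k := 1) (P := ψ H) ?_ ?_
      · rw [s4 2 (by decide), fH]
        simp [Derivation.leibniz, Derivation.leibniz_pow, pderiv_X]
      · rw [hR]
        simp only [map_add, map_mul, map_pow, s1, s2 0 (by decide), s2 2 (by decide),
          s3 (C α) (by simp), s3 (C β) (by simp), C_neg]
        linear_combination (- X 2 * C α * X 0 ^ k) * hbb
  · replace hc := hc hc0
    obtain ⟨ψ, hψ, hCX, s1, s2, s3⟩ := h.change (i := 2) (P := C (-(2 * c)⁻¹) * A)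
      (by simp [Derivation.leibniz, fA]) ((wA.C_mul _).congr (by omega))
    apply hψ
    have h4 : (C (2 * c)⁻¹ * C 2 * C c : B3 K) = 1 := by
      rw [← C_mul, ← C_mul, ← C_1]; congr 1; field_simp
    rw [map_ofNat] at h4
    refine endB2 hCX h01 h12 (by omega) hc0
      (p := H - C (2 * c)⁻¹ * C (2 * c)⁻¹ * C c * A ^ 2) ?_ ?_ ?_
    · rw [hR]
      simp only [map_add, map_mul, map_pow, s1, s3 H fH, s3 A fA, s3 (C c) (by simp), C_neg]
      linear_combination (- X 2 * A + C (2 * c)⁻¹ * A ^ 2) * h4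
    · simp [Derivation.leibniz, Derivation.leibniz_pow, fH, fA]
    · exact (wH.congr (by omega)).sub (((((Hm.C _).mul (Hm.C _)).mul (Hm.C _)).mul (wA.pow 2)).congr
        (by push_cast; omega))
end EndB

set_option linter.unusedSectionVars false
section Grading
variable {K : Type*} [Field K] [CharZero K] {d : Fin 3 → ℕ} {F G R : B3 K} {n m : ℤ}

lemma exists_top (d : Fin 3 → ℕ) (hF : F ≠ 0) : ∃ N, Lo d F (N + 1) ∧ comp d N F ≠ 0 := by
  have hs : F.support.Nonempty := by
    rwa [Finset.nonempty_iff_ne_empty, Ne, MvPolynomial.support_eq_empty]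
  obtain ⟨s, hs, hmax⟩ := F.support.exists_max_image (wt d) hs
  refine ⟨wt d s, fun t ht => ?_, fun h0 => ?_⟩
  · have := hmax t (mem_support_iff.mpr ht)
    omega
  · have := congrArg (coeff s) h0
    rw [coeff_comp, if_pos rfl, coeff_zero] at this
    exact mem_support_iff.mp hs this

lemma exists_lo (d : Fin 3 → ℕ) (F : B3 K) : ∃ N : ℤ, Lo d F N := by
  by_cases hF : F = 0
  · exact ⟨0, hF ▸ Lo.zero⟩
  · obtain ⟨N, h, -⟩ := exists_top d hF
    exact ⟨_, h⟩

lemma Lo.step (h : Lo d F (n + 1)) (h0 : comp d n F = 0) : Lo d F n := by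
  have := comp_lo h
  rwa [h0, sub_zero] at this

lemma Tp.uniq {p h h' : B3 K} (H : Tp d n p h) (H' : Tp d n p h') : h = h' := by
  have h1 : Lo d (h - h') n := by
    have := H'.2.sub H.2
    rwa [show p - h' - (p - h) = h - h' by ring] at this
  exact sub_eq_zero.mp (h1.eq_zero_of_hm (H.1.sub H'.1) le_rfl)

lemma Hm.div (hA : Hm d F n) (hF : F ≠ 0) (h : Hm d (F * G) m) : Hm d G (m - n) := by
  by_cases hQ : G - comp d (m - n) G = 0
  · rw [sub_eq_zero.mp hQ]; exact comp_hm
  exfalso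
  obtain ⟨M, h1, h2⟩ := exists_top d hQ
  have hM : M ≠ m - n := by
    intro hM
    obtain ⟨s, hs⟩ := exists_coeff_ne h2
    have hw := comp_hm s hs
    rw [coeff_comp, if_pos hw, coeff_sub, coeff_comp, if_pos (hw.trans hM), sub_self] at hs
    exact hs rfl
  have h3 : Hm d (F * (G - comp d (m - n) G)) m := by
    rw [mul_sub]
    exact h.sub ((hA.mul comp_hm).congr (by ring))
  have h4 := hA.top.mul h1.top_comp
  rcases lt_or_gt_of_ne hM with hlt | hlt
  · exact mul_ne_zero hF hQ ((h4.lo).eq_zero_of_hm h3 (by omega))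
  · exact mul_ne_zero hF h2 (h4.h_zero (h3.lo.mono (by omega)))

lemma dvd_wt (hA : Hm d F n) (h : Hm d G m) (hd : F ∣ G) (hlt : m < n) : G = 0 := by
  by_cases hF : F = 0
  · rw [hF] at hd; exact zero_dvd_iff.mp hd
  obtain ⟨Q, rfl⟩ := hd
  rw [(Hm.div hA hF h).eq_zero (by omega), mul_zero]

lemma eq_C_of_lo (hd : ∀ j, 0 < d j) (h : Lo d F 1) : ∃ c, F = C c := by
  refine ⟨coeff 0 F, ?_⟩
  ext s
  rw [coeff_C]
  split_ifs with h0
  · rw [h0]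
  · by_contra hs
    apply h0
    have h1 := h s hs
    ext i
    have h2 := le_wt d s i
    have h3 := hd i
    by_contra h4
    have h5 : 1 ≤ s i := Nat.one_le_iff_ne_zero.mpr (fun h => h4 (by simp [h]))
    have : (1 : ℤ) ≤ s i * d i := by exact_mod_cast Nat.mul_pos h5 h3
    omega

lemma exists_pderiv_ne (h : ∀ c, F ≠ C c) : ∃ k, pderiv k F ≠ 0 := by
  by_contra! hh
  apply h (coeff 0 F)
  ext s
  rw [coeff_C]
  split_ifs with h0
  · rw [h0]
  · by_contra hs
    apply h0
    ext i
    simpa using (free_iff.mp (hh i) s hs).symm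

/-- standard weights -/
def one3 : Fin 3 → ℕ := fun _ => 1

lemma wt_one3 (s : Fin 3 →₀ ℕ) : wt one3 s = s.degree := by
  simp [wt, one3, Finsupp.degree_eq_sum, Fin.sum_univ_three]

lemma lt_tp (p : B3 K) : Tp one3 p.totalDegree p (ltStd p) := by
  constructor
  · intro s hs
    unfold ltStd at hs
    rw [coeff_homogeneousComponent] at hs
    rw [wt_one3]
    by_contra h
    exact hs (if_neg (fun h' => h (by exact_mod_cast h')))
  · intro s hs
    unfold ltStd at hs
    rw [coeff_sub, coeff_homogeneousComponent] at hs
    rw [wt_one3]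
    split_ifs at hs with h
    · simp at hs
    · rw [sub_zero] at hs
      have := le_totalDegree (mem_support_iff.mpr hs)
      have h2 : s.sum (fun _ e => e) = s.degree := by
        rfl
      rw [h2] at this
      exact_mod_cast lt_of_le_of_ne this h

lemma lt_ne {p : B3 K} (h : p ≠ 0) : ltStd p ≠ 0 := by
  intro h0
  obtain ⟨N, h1, h2⟩ := exists_top one3 h
  have h3 := (lt_tp p).lo_of_zero h0
  obtain ⟨s, hs, hmax⟩ := p.support.exists_max_image (fun s => s.degree)
    (by rwa [Finset.nonempty_iff_ne_empty, Ne, MvPolynomial.support_eq_empty])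
  have h4 := h3 s (mem_support_iff.mp hs)
  rw [wt_one3] at h4
  have h5 : p.totalDegree ≤ s.degree := by
    rw [totalDegree]
    apply Finset.sup_le
    intro t ht
    have h2 : t.sum (fun _ e => e) = t.degree := by
      rfl
    rw [h2]
    exact hmax t ht
  omega

lemma pderiv_lnd (i : Fin 3) (F : B3 K) : ∃ k, (pderiv i)^[k] F = 0 := by
  obtain ⟨N, hN⟩ := exists_lo one3 F
  have : ∀ k : ℕ, Lo one3 ((pderiv i)^[k] F) (N - k) := by
    intro k
    induction k with
    | zero => simpa using hN
    | succ k ih =>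
      rw [Function.iterate_succ_apply']
      exact (ih.pderiv i).mono (by simp [one3]; omega)
  exact ⟨N.toNat, (this _).eq_zero (by omega)⟩
end Grading

set_option linter.unusedSectionVars false
section Main
variable {K : Type*} [Field K] [CharZero K]

/-- main context -/
structure Mx (f g : Fin 3 → B3 K) (d : Fin 3 → ℕ) (R : B3 K) : Prop where
  bij : Function.Bijective (aeval f : B3 K →ₐ[K] B3 K)
  tp : ∀ j, Tp one3 (d j) (f j) (g j)
  hd : ∀ j, 0 < d j
  gne : ∀ j, g j ≠ 0
  ker : ∀ P : B3 K, aeval g P = 0 ↔ R ∣ P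
  rne : R ≠ 0

variable {f g : Fin 3 → B3 K} {d : Fin 3 → ℕ} {R : B3 K}

lemma Mx.tp' (h : Mx f g d R) (j : Fin 3) : Tp one3 (d j) (aeval f (X j : B3 K)) (aeval g (X j : B3 K)) := by
  simpa using h.tp j

lemma Mx.tt (h : Mx f g d R) {P H : B3 K} {n : ℤ} (hP : Tp d n P H) :
    Tp one3 n (aeval f P) (aeval g H) := by
  have h1 := hP.1.transfer h.tp'
  have h2 := hP.2.transfer h.tp'
  refine ⟨h1.1, ?_⟩
  have := h2.add h1.2
  rw [map_sub] at this
  rwa [sub_add_sub_cancel] at this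

lemma Mx.prime (h : Mx f g d R) : Prime R := by
  refine ⟨h.rne, fun hu => ?_, fun a b hab => ?_⟩
  · have := (h.ker 1).mpr (isUnit_iff_dvd_one.mp hu)
    simp at this
  · rw [← h.ker, map_mul, mul_eq_zero, h.ker, h.ker] at hab
    exact hab

lemma Mx.hom (h : Mx f g d R) : ∃ n, Hm d R n := by
  obtain ⟨N, h1, h2⟩ := exists_top d h.rne
  have h3 : aeval g (comp d N R) = 0 := by
    have hg : ∀ j, Tp one3 (d j) (aeval g (X j : B3 K)) (aeval g (X j : B3 K)) := fun j => (h.tp' j).1.top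
    have e1 := (comp_hm (d := d) (n := N) (F := R)).transfer hg
    have e2 := (comp_lo h1).transfer hg
    rw [map_sub, (h.ker R).mpr dvd_rfl, zero_sub] at e2
    exact (by simpa using e2.neg : Lo one3 (aeval g (comp d N R)) N).eq_zero_of_hm e1.1 le_rfl
  rw [h.ker] at h3
  obtain ⟨Q, hQ⟩ := h3
  have hQ0 : Q ≠ 0 := by rintro rfl; exact h2 (by rw [hQ, mul_zero])
  obtain ⟨M, h4, h5⟩ := exists_top d hQ0
  have h6 := h1.top_comp.mul h4.top_comp
  rw [← hQ] at h6
  have h7 : M ≤ 0 := by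
    by_contra hM
    exact mul_ne_zero h2 h5 (h6.h_zero ((comp_hm (d := d)).lo.mono (by omega)))
  obtain ⟨c, rfl⟩ := eq_C_of_lo h.hd (h4.mono (by omega : M + 1 ≤ 1))
  have hc : c ≠ 0 := by rintro rfl; simp at hQ0
  refine ⟨N, ?_⟩
  have : R = C c⁻¹ * comp d N R := by
    rw [hQ, mul_comm R, ← mul_assoc, ← C_mul, inv_mul_cancel₀ hc, C_1, one_mul]
  rw [this]
  exact comp_hm.C_mul _

/-- Jacobian matrix -/
noncomputable def jac (f : Fin 3 → B3 K) : Matrix (Fin 3) (Fin 3) (B3 K) :=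
  Matrix.of fun i j => pderiv i (f j)

lemma jac_det (h : Mx f g d R) : ∃ c : K, c ≠ 0 ∧ (jac f).det = C c := by
  rw [← isUnit_iff_C]
  choose q hq using h.bij.2
  have : jac f * Matrix.of (fun k l => aeval f (pderiv k (q (X l)))) = 1 := by
    ext1 i l
    rw [Matrix.mul_apply]
    have := chain_rule (aeval f : B3 K →ₐ[K] B3 K) i (q (X l))
    rw [hq, pderiv_X] at this
    simp only [aeval_X] at this
    simp only [jac, Matrix.of_apply, ← this, Matrix.one_apply, Pi.single_apply]
    simp [eq_comm]
  exact (Matrix.isUnit_iff_isUnit_det _).mp (IsUnit.of_mul_eq_one _ this)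

lemma det_lo {A : Matrix (Fin 3) (Fin 3) (B3 K)} {w : Fin 3 → ℤ} (h : ∀ i j, Lo one3 (A i j) (w j)) :
    Lo one3 A.det (w 0 + w 1 + w 2 - 2) := by
  rw [Matrix.det_fin_three]
  have key : ∀ i j k, Lo one3 (A i 0 * A j 1 * A k 2) (w 0 + w 1 + w 2 - 2) := fun i j k =>
    (((h i 0).mul (h j 1)).mul (h k 2)).mono (by omega)
  have e1 : A 0 0 * A 1 2 * A 2 1 = A 0 0 * A 2 1 * A 1 2 := by ring
  have e2 : A 0 1 * A 1 0 * A 2 2 = A 1 0 * A 0 1 * A 2 2 := by ring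
  have e3 : A 0 1 * A 1 2 * A 2 0 = A 2 0 * A 0 1 * A 1 2 := by ring
  have e4 : A 0 2 * A 1 0 * A 2 1 = A 1 0 * A 2 1 * A 0 2 := by ring
  have e5 : A 0 2 * A 1 1 * A 2 0 = A 2 0 * A 1 1 * A 0 2 := by ring
  rw [e1, e2, e3, e4, e5]
  exact (((((key _ _ _).sub (key _ _ _)).sub (key _ _ _)).add (key _ _ _)).add (key _ _ _)).sub
    (key _ _ _)

lemma det_upd (h : Mx f g d R) (Q : B3 K) (k : Fin 3) :
    ((jac f).updateCol k (fun i => pderiv i (aeval f Q))).det = (jac f).det * aeval f (pderiv k Q) := by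
  rw [← Matrix.cramer_apply, Matrix.cramer_eq_adjugate_mulVec]
  have : (fun i => pderiv i (aeval f Q)) = (jac f).mulVec (fun k => aeval f (pderiv k Q)) := by
    ext1 i
    rw [chain_rule (aeval f : B3 K →ₐ[K] B3 K)]
    simp [Matrix.mulVec, dotProduct, jac]
  rw [this, Matrix.mulVec_mulVec, Matrix.adjugate_mul, Matrix.smul_mulVec, Matrix.one_mulVec]
  simp

lemma Mx.der_lo (h : Mx f g d R) {Q : B3 K} {M : ℤ} (hQ : Lo one3 (aeval f Q) (M + 1)) (k : Fin 3) :
    Lo one3 (aeval f (pderiv k Q)) (M + (d 0 + d 1 + d 2 - 3) - d k + 1) := by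
  obtain ⟨c, hc, hdet⟩ := jac_det h
  have h1 := det_upd h Q k
  rw [hdet] at h1
  have h2 : aeval f (pderiv k Q) = C c⁻¹ *
      ((jac f).updateCol k (fun i => pderiv i (aeval f Q))).det := by
    rw [h1, ← mul_assoc, ← C_mul, inv_mul_cancel₀ hc, C_1, one_mul]
  rw [h2]
  have h3 : ∀ i j, Lo one3 ((jac f).updateCol k (fun i => pderiv i (aeval f Q)) i j)
      (Function.update (fun j => (d j : ℤ)) k M j) := by
    intro i j
    rw [Matrix.updateCol_apply]
    split_ifs with hj
    · subst hj
      rw [Function.update_self]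
      exact (hQ.pderiv i).mono (by simp [one3])
    · rw [Function.update_of_ne hj]
      exact ((h.tp j).lo.pderiv i).mono (by simp [one3])
  have h4 := det_lo h3
  have h5 := ((Hm.C (d := one3) c⁻¹).lo.mul h4)
  refine h5.mono ?_
  fin_cases k <;> simp [Function.update] <;> omega

lemma Mx.not_dvd_pderiv (h : Mx f g d R) : ∃ k, ¬ R ∣ pderiv k R := by
  obtain ⟨n, hn⟩ := h.hom
  have hC : ∀ c, R ≠ C c := by
    intro c hc
    have : c ≠ 0 := by rintro rfl; exact h.rne (by rw [hc, C_0])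
    exact h.prime.not_isUnit (isUnit_iff_C.mpr ⟨c, this, hc⟩)
  obtain ⟨k, hk⟩ := exists_pderiv_ne hC
  refine ⟨k, fun hdvd => hk ?_⟩
  exact dvd_wt hn (hn.pderiv k) hdvd (by have := h.hd k; omega)

/-- parachute inequality -/
lemma Mx.parachute (h : Mx f g d R) (m : ℕ) : ∀ (Q G : B3 K) (N M : ℤ), Tp d N Q (R ^ m * G) → ¬ R ∣ G →
    Lo one3 (aeval f Q) (M + 1) → N ≤ M + m * (d 0 + d 1 + d 2 - 3) := by
  induction m with
  | zero =>
    intro Q G N M hQ hG hM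
    simp only [pow_zero, one_mul] at hQ
    have := h.tt hQ
    by_contra hlt
    push Not at hlt
    exact hG ((h.ker _).mp (this.h_zero (hM.mono (by push_cast at hlt; omega))))
  | succ m ih =>
    intro Q G N M hQ hG hM
    obtain ⟨k, hk⟩ := h.not_dvd_pderiv
    have h1 := hQ.pderiv k
    have h2 : pderiv k (R ^ (m + 1) * G) = R ^ m * (C ((m : K) + 1) * (G * pderiv k R) + R * pderiv k G) := by
      simp only [Derivation.leibniz, Derivation.leibniz_pow, smul_eq_mul, nsmul_eq_mul, C_add, C_1, add_tsub_cancel_right]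
      simp
      ring
    rw [h2] at h1
    have h3 := ih _ _ _ _ h1 ?_ (h.der_lo hM k)
    · push_cast; linarith
    · intro hdvd
      rw [dvd_add_left (dvd_mul_right _ _)] at hdvd
      rcases h.prime.dvd_or_dvd hdvd with h4 | h4
      · refine h.prime.not_isUnit (isUnit_of_dvd_unit h4 (isUnit_iff_C.mpr ⟨_, ?_, rfl⟩))
        exact_mod_cast Nat.succ_ne_zero m
      · rcases h.prime.dvd_or_dvd h4 with h4 | h4
        · exact hG h4
        · exact hk h4

end Main

set_option linter.unusedSectionVars false
section Final
variable {K : Type*} [Field K] [CharZero K] [IsAlgClosed K]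
variable {f g : Fin 3 → B3 K} {d : Fin 3 → ℕ} {R : B3 K}

lemma Mx.exists_der (h : Mx f g d R) (i : Fin 3) : ∃ D : Derivation K (B3 K) (B3 K), Lnd D ∧
    ∀ P, aeval f (D P) = pderiv i (aeval f P) := by
  let A : B3 K ≃ₐ[K] B3 K := AlgEquiv.ofBijective (aeval f) h.bij
  have hA : ∀ x, A x = aeval f x := fun x => rfl
  refine ⟨conjD A.symm (pderiv i), fun a => ?_, fun P => ?_⟩
  · obtain ⟨k, hk⟩ := pderiv_lnd i (A a)
    exact ⟨k, by rw [conjD_iter]; simp [hk]⟩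
  · rw [conjD_apply, ← hA, ← hA]; simp

lemma Mx.caseII (h : Mx f g d R) (h01 : d 0 ≤ d 1) (h12 : d 1 ≤ d 2)
    {D : Fin 3 → Derivation K (B3 K) (B3 K)}
    (hD : ∀ i P, aeval f (D i P) = pderiv i (aeval f P))
    (hlo : ∀ i j, Lo d (D i (X j)) (d j)) : Concl R := by
  obtain ⟨n, hn⟩ := h.hom
  have hg0 : ∀ c, g 0 ≠ C c := by
    intro c hc
    have h1 := (h.tp 0).1
    rw [hc] at h1
    refine h.gne 0 ?_
    rw [hc]
    exact (Hm.C c).uniq h1 (by have := h.hd 0; omega)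
  obtain ⟨i, hi⟩ := exists_pderiv_ne hg0
  let E : Fin 3 → B3 K := fun j => comp d (d j - 1) (D i (X j))
  have hE : ∀ j, aeval g (E j) = pderiv i (g j) := by
    intro j
    have h1 : Tp d (d j - 1) (D i (X j)) (E j) := ((hlo i j).mono (by omega)).top_comp
    have h2 := h.tt h1
    rw [hD, aeval_X] at h2
    exact h2.uniq ((h.tp j).pderiv i)
  have hEw : ∀ j, Hm d (E j) (d j - 1) := fun j => comp_hm
  have h0 : E 0 ≠ 0 := by
    intro h0
    have := hE 0
    rw [h0, map_zero] at this
    exact hi this.symm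
  refine endA h.hd h01 h12 h.prime.irreducible hn (D := E) le_rfl hEw ⟨0, h0⟩
    (fun hh => absurd hh h0) ?_
  refine dvd_wt hn (m := n - 1) ?_ ?_ (by omega)
  · exact ((((hEw 0).mul (hn.pderiv 0)).congr (by ring)).add
      (((hEw 1).mul (hn.pderiv 1)).congr (by ring))).add
      (((hEw 2).mul (hn.pderiv 2)).congr (by ring))
  · rw [← h.ker]
    have := chain_rule (aeval g : B3 K →ₐ[K] B3 K) i R
    rw [(h.ker R).mpr dvd_rfl, map_zero, Fin.sum_univ_three] at this
    simp only [aeval_X] at this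
    simp only [map_add, map_mul, hE, this]

/-- the leading part of a derivation -/
lemma exists_e {D : Derivation K (B3 K) (B3 K)} (hlo : ∃ j, ¬ Lo d (D (X j)) (d j)) :
    ∃ e : ℕ, (∀ j, Lo d (D (X j)) (d j + e + 1)) ∧ ∃ j, comp d (d j + e) (D (X j)) ≠ 0 := by
  classical
  have hex : ∃ e : ℕ, ∀ j, Lo d (D (X j)) (d j + e + 1) := by
    choose N hN using fun j => exists_lo d (D (X j))
    refine ⟨(N 0).toNat + (N 1).toNat + (N 2).toNat, fin3_cases ?_ ?_ ?_⟩
    · exact (hN 0).mono (by push_cast; omega)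
    · exact (hN 1).mono (by push_cast; omega)
    · exact (hN 2).mono (by push_cast; omega)
  refine ⟨Nat.find hex, Nat.find_spec hex, ?_⟩
  by_contra! hall
  have hst : ∀ j, Lo d (D (X j)) (d j + Nat.find hex) := fun j => (Nat.find_spec hex j).step (hall j)
  rcases he : Nat.find hex with _ | e
  · rw [he] at hst
    obtain ⟨j, hj⟩ := hlo
    exact hj (by simpa using hst j)
  · refine Nat.find_min hex (m := e) (by omega) fun j => ?_
    exact (hst j).mono (by rw [he]; push_cast; omega)

lemma lead_tp {D D' : Derivation K (B3 K) (B3 K)} {e : ℤ}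
    (hD : ∀ j, Tp d (d j + e) (D (X j)) (D' (X j))) {P H : B3 K} {n : ℤ} (hP : Tp d n P H) :
    Tp d (n + e) (D P) (D' H) := by
  rw [der_eq D, der_eq D']
  have key : ∀ j, Tp d (n + e) (pderiv j P * D (X j)) (pderiv j H * D' (X j)) := by
    intro j
    have := (hP.pderiv j).mul (hD j)
    rwa [show n - d j + (d j + e) = n + e by ring] at this
  exact ((key 0).add (key 1)).add (key 2)

lemma lead_lnd {D D' : Derivation K (B3 K) (B3 K)} {e : ℤ}
    (hD : ∀ j, Tp d (d j + e) (D (X j)) (D' (X j))) (hl : Lnd D) : Lnd D' := by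
  intro a
  rw [sum_comp a d]
  refine Finset.sum_induction _ (fun a => ∃ n, D'^[n] a = 0) ?_ ⟨0, rfl⟩ ?_
  · rintro a b ⟨k, hk⟩ ⟨l, hl⟩
    refine ⟨k + l, ?_⟩
    rw [iter_add, iter_le hk (by omega), iter_le hl (by omega), add_zero]
  · intro n _
    obtain ⟨k, hk⟩ := hl (comp d n a)
    have : ∀ m : ℕ, Tp d (n + m * e) (D^[m] (comp d n a)) (D'^[m] (comp d n a)) := by
      intro m
      induction m with
      | zero => simpa using (comp_hm (d := d) (n := n) (F := a)).top
      | succ m ih =>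
        rw [Function.iterate_succ_apply', Function.iterate_succ_apply']
        have := lead_tp hD ih
        rwa [show n + (m : ℤ) * e + e = n + ((m + 1 : ℕ) : ℤ) * e by push_cast; ring] at this
    refine ⟨k, (this k).h_zero ?_⟩
    rw [hk]; exact Lo.zero

lemma Mx.caseIII (h : Mx f g d R) (h01 : d 0 ≤ d 1) (h12 : d 1 ≤ d 2)
    {D : Derivation K (B3 K) (B3 K)} {i : Fin 3} (hl : Lnd D)
    (hD : ∀ P, aeval f (D P) = pderiv i (aeval f P))
    (hlo : ∃ j, ¬ Lo d (D (X j)) (d j)) : Concl R := by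
  obtain ⟨n, hn⟩ := h.hom
  obtain ⟨e, he, j1, hj1⟩ := exists_e hlo
  let D' : Derivation K (B3 K) (B3 K) := mkDerivation K fun j => comp d (d j + e) (D (X j))
  have hD'X : ∀ j, D' (X j) = comp d (d j + e) (D (X j)) := fun j => mkDerivation_X _ _ _
  have htp : ∀ j, Tp d (d j + (e : ℤ)) (D (X j)) (D' (X j)) := fun j => by
    rw [hD'X]; exact (he j).top_comp
  have hl' : Lnd D' := lead_lnd htp hl
  have hfl : ∀ j, Lo one3 (aeval f (D (X j))) (d j) := by
    intro j
    rw [hD, aeval_X]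
    exact ((h.tp j).lo.pderiv i).mono (by simp [one3])
  have hdvd : ∀ j, R ∣ D' (X j) := fun j =>
    (h.ker _).mp ((h.tt (htp j)).h_zero ((hfl j).mono (by omega)))
  have hHD : HD d D' e := fun j => (htp j).1
  have hker : D' R = 0 := by
    apply ker_of_dvd hl'
    rw [der_eq D' R]
    exact ((((hdvd 0).mul_left _).add ((hdvd 1).mul_left _))).add ((hdvd 2).mul_left _)
  have hne : D' (X j1) ≠ 0 := by rw [hD'X]; exact hj1
  have hne' : D' ≠ 0 := by
    intro h0; rw [h0] at hne; exact hne rfl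
  have hd0 := h.hd 0
  by_cases hb : n < d 0 + d 1 + d 2 - 3
  · exact endB ⟨D', e, h.hd, h.prime.irreducible, hn, hl', hHD, hne', hker⟩ h01 h12 (by omega)
  classical
  have hex : ∃ M : ℕ, ∃ j, ¬ R ^ (M + 1) ∣ D' (X j) := by
    have hfin : FiniteMultiplicity R (D' (X j1)) :=
      FiniteMultiplicity.of_not_isUnit h.prime.not_isUnit hne
    obtain ⟨M, hM⟩ := hfin
    exact ⟨M, j1, hM⟩
  obtain ⟨M, ⟨j0, hj0⟩, hmin⟩ : ∃ M : ℕ, (∃ j, ¬ R ^ (M + 1) ∣ D' (X j)) ∧ ∀ j, R ^ M ∣ D' (X j) := by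
    refine ⟨Nat.find hex, Nat.find_spec hex, fun j => ?_⟩
    rcases hM : Nat.find hex with _ | M
    · simp
    · by_contra hj
      exact Nat.find_min hex (m := M) (by omega) ⟨j, hj⟩
  choose E hE using hmin
  have hR0 : ∀ k : ℕ, R ^ k ≠ 0 := fun k => pow_ne_zero k h.rne
  have hEj : ¬ R ∣ E j0 := by
    rintro ⟨q, hq⟩
    exact hj0 ⟨q, by rw [hE, hq]; ring⟩
  have hpar := h.parachute M (D (X j0)) (E j0) (d j0 + e) (d j0 - 1) (by rw [← hE]; exact htp j0) hEj
    (by simpa using hfl j0)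
  have hM1 : 1 ≤ M := by
    by_contra hM
    obtain rfl : M = 0 := by omega
    simp at hpar
    omega
  have hnM : (M : ℤ) * (n - (d 0 + d 1 + d 2 - 3)) ≥ n - (d 0 + d 1 + d 2 - 3) := by
    have h1 : (1 : ℤ) ≤ M := by exact_mod_cast hM1
    nlinarith
  have hEw : ∀ j, Hm d (E j) (d j - (M * n - e)) := by
    intro j
    have := (htp j).1
    rw [hE j] at this
    exact ((hn.pow M).div (hR0 M) this).congr (by ring)
  refine endA h.hd h01 h12 h.prime.irreducible hn (D := E) (t := M * n - e) ?_ hEw ⟨j0, ?_⟩ ?_ ?_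
  · linarith
  · intro h0; exact hEj (h0 ▸ dvd_zero _)
  · intro _; linarith
  · have h1 := hker
    rw [der_eq, hE 0, hE 1, hE 2] at h1
    refine (mul_eq_zero.mp (?_ : R ^ M * _ = 0)).resolve_left (hR0 M)
    rw [← h1]; ring

lemma Mx.sorted (h : Mx f g d R) (h01 : d 0 ≤ d 1) (h12 : d 1 ≤ d 2) : Concl R := by
  choose D hl hD using h.exists_der
  by_cases hlo : ∀ i j, Lo d (D i (X j)) (d j)
  · exact h.caseII h01 h12 hD hlo
  · push Not at hlo
    obtain ⟨i, j, hij⟩ := hlo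
    exact h.caseIII h01 h12 (hl i) (hD i) ⟨j, hij⟩

lemma Mx.concl (h : Mx f g d R) : Concl R := by
  let σ := Tuple.sort d
  have hm : Monotone (d ∘ σ) := Tuple.monotone_sort d
  let ψ : B3 K ≃ₐ[K] B3 K := permScale σ (fun _ => 1) (fun _ => one_ne_zero)
  have hψ : ∀ j, ψ (X j) = X (σ j) := fun j => by simp [ψ, permScale_X]
  have hcomp : ∀ (u : Fin 3 → B3 K) (P : B3 K), aeval (u ∘ σ) P = aeval u (ψ P) := by
    intro u P
    have : (aeval (u ∘ σ) : B3 K →ₐ[K] B3 K) = (aeval u).comp (ψ : B3 K →ₐ[K] B3 K) := by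
      ext1 j
      simp [hψ]
    rw [this]; rfl
  have hψt : IsTame ψ.symm := (permScale_tame _ _ _).symm
  apply Concl.of_tame hψt
  have hM : Mx (f ∘ σ) (g ∘ σ) (d ∘ σ) (ψ.symm R) := by
    refine ⟨?_, fun j => h.tp _, fun j => h.hd _, fun j => h.gne _, fun P => ?_, ?_⟩
    · have : ⇑(aeval (f ∘ σ) : B3 K →ₐ[K] B3 K) = ⇑(aeval f : B3 K →ₐ[K] B3 K) ∘ ⇑ψ := by
        funext P; exact hcomp f P
      rw [this]
      exact h.bij.comp ψ.bijective
    · rw [hcomp, h.ker]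
      constructor
      · rintro ⟨Q, hQ⟩
        exact ⟨ψ.symm Q, by rw [← map_mul, ← hQ, ψ.symm_apply_apply]⟩
      · rintro ⟨Q, hQ⟩
        exact ⟨ψ Q, by rw [hQ, map_mul, ψ.apply_symm_apply]⟩
    · simpa using h.rne
  exact hM.sorted (hm (by decide)) (hm (by decide))

end Final

theorem stmt3 {K : Type*} [Field K] [IsAlgClosed K] [CharZero K]
    (f : Fin 3 → MvPolynomial (Fin 3) K)
    (hf : Function.Bijective
      ⇑(aeval f : MvPolynomial (Fin 3) K →ₐ[K] MvPolynomial (Fin 3) K))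
    (R : MvPolynomial (Fin 3) K)
    (hI : relIdealStd f = Ideal.span {R}) :
    TamelyEquiv R 0 ∨
    TamelyEquiv R (X 2) ∨
    (∃ r s : ℕ, Nat.gcd r s = 1 ∧ TamelyEquiv R (X 0 ^ r + X 1 ^ s)) ∨
    (∃ (k : ℕ) (P : MvPolynomial (Fin 2) K), 1 ≤ k ∧
      TamelyEquiv R (X 0 ^ k * X 2 + inj12 P)) := by
  by_cases hR : R = 0
  · left
    exact ⟨AlgEquiv.refl, Subgroup.one_mem _, by simp [hR]⟩
  have hnC : ∀ j, ∀ c, f j ≠ C c := by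
    intro j c hc
    have : (X j : B3 K) = C c := hf.1 (by rw [aeval_X, hc, algHom_C]; rfl)
    have h2 := congrArg (pderiv j) this
    simp at h2
  have hM : Mx f (fun i => ltStd (f i)) (fun i => (f i).totalDegree) R := by
    refine ⟨hf, fun j => lt_tp _, fun j => ?_, fun j => lt_ne ?_, fun P => ?_, hR⟩
    · rw [Nat.pos_iff_ne_zero]
      intro h0
      exact hnC j _ (totalDegree_eq_zero_iff_eq_C.mp h0)
    · intro h0
      exact hnC j 0 (by rw [h0, C_0])
    · rw [← Ideal.mem_span_singleton, ← hI]
      rfl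
  exact hM.concl
end

section
/- (Jung–van der Kulk) Every polynomial automorphism of K^2 is tame, i.e. it is a composition of affine automorphisms and elementary automorphisms. -/
open MvPolynomial

namespace Jung

set_option linter.unusedSectionVars false

section LND
variable {K A : Type*} [Field K] [CharZero K] [CommRing A] [IsDomain A] [Algebra K A]

theorem iter_const_mul (D : Derivation K A A) {f : A} (hf : D f = 0) (g : A) (n : ℕ) :
    D^[n] (f * g) = f * D^[n] g := by
  induction n generalizing g with
  | zero => rfl
  | succ n ih => 
    rw [Function.iterate_succ_apply, Function.iterate_succ_apply, D.leibniz, hf]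
    simp [ih]

theorem iter_add (D : Derivation K A A) (f g : A) (n : ℕ) :
    D^[n] (f + g) = D^[n] f + D^[n] g := by
  induction n generalizing f g with
  | zero => rfl
  | succ n ih => simp

theorem iter_zero (D : Derivation K A A) (n : ℕ) : D^[n] (0 : A) = 0 := by
  induction n with
  | zero => rfl
  | succ n ih => simp

theorem iter_le (D : Derivation K A A) {f : A} {n k : ℕ} (h : D^[n] f = 0) (hk : n ≤ k) :
    D^[k] f = 0 := by
  obtain ⟨c, rfl⟩ := Nat.exists_eq_add_of_le hk
  rw [Nat.add_comm, Function.iterate_add_apply, h, iter_zero]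

theorem iter_mul (D : Derivation K A A) : ∀ (N a b : ℕ) (f g : A), a + b = N →
    D^[a+1] f = 0 → D^[b+1] g = 0 →
    D^[N] (f * g) = ((a+b).choose a : A) * (D^[a] f * D^[b] g) := by
  intro N
  induction N with
  | zero =>
    intro a b f g h hf hg
    obtain ⟨rfl, rfl⟩ : a = 0 ∧ b = 0 := by omega
    simp
  | succ N ih =>
    intro a b f g h hf hg
    rcases a with _ | a
    · simp only [Nat.zero_add] at h hf
      rw [iter_const_mul D (by simpa using hf), ← h]; simp
    rcases b with _ | b
    · simp only [Nat.add_zero] at h hg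
      rw [mul_comm f, iter_const_mul D (by simpa using hg), ← h]; simp [mul_comm]
    rw [Function.iterate_succ_apply, D.leibniz, iter_add, smul_eq_mul, smul_eq_mul, mul_comm g,
      ih (a+1) b f (D g) (by omega) hf hg, ih a (b+1) (D f) g (by omega) hf hg]
    rw [show a + 1 + (b+1) = (a + b + 1) + 1 by ring, Nat.choose_succ_succ,
      show a + 1 + b = a + b + 1 by ring, show a + (b + 1) = a + b + 1 by ring]
    push_cast
    simp only [Function.iterate_succ_apply]
    ring

def IsDeg (D : Derivation K A A) (f : A) (a : ℕ) : Prop := D^[a] f ≠ 0 ∧ D^[a+1] f = 0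

theorem IsDeg.uniq {D : Derivation K A A} {f : A} {a b : ℕ} (h : IsDeg D f a) (h' : IsDeg D f b) :
    a = b := by
  rcases lt_trichotomy a b with c | c | c
  · exact absurd (iter_le D h.2 c) h'.1
  · exact c
  · exact absurd (iter_le D h'.2 c) h.1

theorem IsDeg.mul {D : Derivation K A A} {f g : A} {a b : ℕ} (h : IsDeg D f a) (h' : IsDeg D g b) :
    IsDeg D (f * g) (a + b) := by
  have : CharZero A := charZero_of_injective_algebraMap (algebraMap K A).injective
  have key := iter_mul D (a+b) a b f g rfl h.2 h'.2
  constructor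
  · rw [key]
    refine mul_ne_zero ?_ (mul_ne_zero h.1 h'.1)
    exact_mod_cast (Nat.choose_pos (by omega)).ne'
  · rw [Function.iterate_succ_apply', key, D.leibniz, D.leibniz, ← Function.iterate_succ_apply' D,
      ← Function.iterate_succ_apply' D, h.2, h'.2]
    simp

theorem IsDeg.one (D : Derivation K A A) : IsDeg D (1 : A) 0 := by
  constructor <;> simp

theorem IsDeg.pow {D : Derivation K A A} {f : A} {a : ℕ} (h : IsDeg D f a) (k : ℕ) :
    IsDeg D (f ^ k) (k * a) := by
  induction k with
  | zero => simpa using IsDeg.one D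
  | succ k ih => rw [pow_succ, Nat.succ_mul]; exact ih.mul h

def LN (D : Derivation K A A) (f : A) : Prop := ∃ n, D^[n] f = 0

theorem LN.exists_deg {D : Derivation K A A} {f : A} (h : LN D f) (h0 : f ≠ 0) :
    ∃ a, IsDeg D f a := by
  classical
  have := Nat.find_spec h
  rcases hn : Nat.find h with _ | k
  · rw [hn] at this; exact absurd this h0
  · rw [hn] at this
    exact ⟨k, Nat.find_min h (by omega), this⟩

theorem LN.add {D : Derivation K A A} {f g : A} (h : LN D f) (h' : LN D g) : LN D (f + g) := by
  obtain ⟨a, ha⟩ := h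
  obtain ⟨b, hb⟩ := h'
  exact ⟨a + b, by rw [iter_add, iter_le D ha (by omega), iter_le D hb (by omega), add_zero]⟩

theorem LN.mul {D : Derivation K A A} {f g : A} (h : LN D f) (h' : LN D g) : LN D (f * g) := by
  by_cases hf : f = 0
  · exact ⟨0, by simp [hf]⟩
  by_cases hg : g = 0
  · exact ⟨0, by simp [hg]⟩
  obtain ⟨a, ha⟩ := h.exists_deg hf
  obtain ⟨b, hb⟩ := h'.exists_deg hg
  exact ⟨_, (ha.mul hb).2⟩

theorem fact_closed {D : Derivation K A A} (hD : ∀ f, LN D f) {f g : A} (hfg : f * g ≠ 0)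
    (h : D (f * g) = 0) : D f = 0 := by
  obtain ⟨a, ha⟩ := (hD f).exists_deg (left_ne_zero_of_mul hfg)
  obtain ⟨b, hb⟩ := (hD g).exists_deg (right_ne_zero_of_mul hfg)
  have h0 : IsDeg D (f * g) 0 := ⟨hfg, h⟩
  have := (ha.mul hb).uniq h0
  obtain rfl : a = 0 := by omega
  exact ha.2

theorem IsDeg.le_of_dvd {D : Derivation K A A} (hD : ∀ f, LN D f) {f g : A} {a b : ℕ}
    (hf : IsDeg D f a) (hg : IsDeg D g b) (h : f ∣ g) : a ≤ b := by
  obtain ⟨c, rfl⟩ := h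
  have h0 : f * c ≠ 0 := by
    intro h; have := hg.1; rw [h, iter_zero] at this; exact this rfl
  obtain ⟨k, hk⟩ := (hD c).exists_deg (right_ne_zero_of_mul h0)
  have := (hf.mul hk).uniq hg
  omega

theorem IsDeg.deriv {D : Derivation K A A} {f : A} {a : ℕ} (hf : IsDeg D f a) (h : D f ≠ 0) :
    1 ≤ a ∧ IsDeg D (D f) (a - 1) := by
  rcases a with _ | a
  · exact absurd hf.2 h
  · exact ⟨by omega, hf⟩

end LND

section poly
variable {K : Type*} [Field K] [CharZero K]

local notation "R" => MvPolynomial (Fin 2) K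

theorem LN_all (D : Derivation K R R) (h : ∀ i, LN D (X i)) (f : R) : LN D f := by
  induction f using MvPolynomial.induction_on with
  | C a => exact ⟨1, by simpa using D.map_algebraMap a⟩
  | add p q hp hq => exact hp.add hq
  | mul_X p i hp => exact hp.mul (h i)

/-- The Jacobian derivation. -/
noncomputable def J (F : R) : Derivation K R R :=
  (pderiv 0 F) • pderiv 1 - (pderiv 1 F) • pderiv 0

theorem J_apply (F G : R) : J F G = pderiv 0 F * pderiv 1 G - pderiv 1 F * pderiv 0 G := by
  simp [J]

theorem chain (ψ : R →ₐ[K] R) (i : Fin 2) (f : R) :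
    pderiv i (ψ f) = ψ (pderiv 0 f) * pderiv i (ψ (X 0)) + ψ (pderiv 1 f) * pderiv i (ψ (X 1)) := by
  induction f using MvPolynomial.induction_on with
  | C a => 
    have : ψ (C a) = C a := ψ.commutes a
    simp [this]
  | add p q hp hq => simp only [map_add, hp, hq]; ring
  | mul_X p j hp => 
    simp only [map_mul, Derivation.leibniz, map_add, smul_eq_mul, hp]
    fin_cases j <;> simp [pderiv_X] <;> ring

theorem J_chain (ψ : R →ₐ[K] R) (f g : R) :
    J (ψ f) (ψ g) = ψ (J f g) * J (ψ (X 0)) (ψ (X 1)) := by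
  simp only [J_apply, chain ψ _ f, chain ψ _ g, map_sub, map_mul]
  ring

theorem J_const (ψ : R ≃ₐ[K] R) : ∃ c : K, c ≠ 0 ∧ J (ψ (X 0)) (ψ (X 1)) = C c := by
  have h := J_chain ψ.toAlgHom (ψ.symm (X 0)) (ψ.symm (X 1))
  change J (ψ (ψ.symm (X 0))) (ψ (ψ.symm (X 1))) = ψ _ * J (ψ (X 0)) (ψ (X 1)) at h
  rw [ψ.apply_symm_apply, ψ.apply_symm_apply] at h
  have h1 : J (X 0 : R) (X 1) = 1 := by simp [J_apply, pderiv_X]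
  rw [h1] at h
  have hu : IsUnit (J (ψ (X 0)) (ψ (X 1))) := IsUnit.of_mul_eq_one _ (by rw [mul_comm]; exact h.symm)
  rw [MvPolynomial.isUnit_iff_eq_C_of_isReduced] at hu
  obtain ⟨c, hc, h⟩ := hu
  exact ⟨c, hc.ne_zero, h⟩

theorem LN_J (ψ : R ≃ₐ[K] R) (f : R) : LN (J (ψ (X 0))) f := by
  obtain ⟨c, -, hc⟩ := J_const ψ
  have step : ∀ g, J (ψ (X 0)) (ψ g) = C c * ψ (pderiv 1 g) := by
    intro g
    have := J_chain ψ.toAlgHom (X 0) g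
    change J (ψ (X 0)) (ψ g) = ψ _ * J (ψ (X 0)) (ψ (X 1)) at this
    rw [this, hc, mul_comm]
    simp [J_apply, pderiv_X]
  have it : ∀ n g, (J (ψ (X 0)))^[n] (ψ g) = C c ^ n * ψ ((pderiv 1)^[n] g) := by
    intro n
    induction n with
    | zero => intro g; simp
    | succ n ih =>
      intro g
      rw [Function.iterate_succ_apply, step, iter_const_mul _ (by simp [J_apply]), ih,
        Function.iterate_succ_apply]
      ring
  obtain ⟨N, hN⟩ := LN_all (pderiv 1 : Derivation K R R) (by
    intro i; refine ⟨2, ?_⟩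
    fin_cases i <;> simp [pderiv_X]) (ψ.symm f)
  refine ⟨N, ?_⟩
  have := it N (ψ.symm f)
  rwa [ψ.apply_symm_apply, hN, map_zero, mul_zero] at this


def wt (m n : ℕ) (a : Fin 2 →₀ ℕ) : ℤ := m * a 0 + n * a 1

def WS (m n : ℕ) (S : Set ℤ) (f : R) : Prop := ∀ a, coeff a f ≠ 0 → wt m n a ∈ S

theorem WS.mono {m n : ℕ} {S T : Set ℤ} {f : R} (h : WS m n S f) (hST : S ⊆ T) : WS m n T f :=
  fun a ha => hST (h a ha)

theorem WS.add {m n : ℕ} {S : Set ℤ} {f g : R} (h : WS m n S f) (h' : WS m n S g) :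
    WS m n S (f + g) := by
  intro a ha
  rw [coeff_add] at ha
  by_cases hf : coeff a f = 0
  · exact h' a (by simpa [hf] using ha)
  · exact h a hf

theorem WS.sub {m n : ℕ} {S : Set ℤ} {f g : R} (h : WS m n S f) (h' : WS m n S g) :
    WS m n S (f - g) := by
  intro a ha
  rw [coeff_sub] at ha
  by_cases hf : coeff a f = 0
  · exact h' a (by simpa [hf] using ha)
  · exact h a hf

theorem WS.mul {m n : ℕ} {S T U : Set ℤ} {f g : R} (h : WS m n S f) (h' : WS m n T g)
    (hU : ∀ s ∈ S, ∀ t ∈ T, s + t ∈ U) : WS m n U (f * g) := by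
  classical
  intro a ha
  rw [coeff_mul] at ha
  obtain ⟨⟨b, c⟩, hbc, hne⟩ := Finset.exists_ne_zero_of_sum_ne_zero ha
  rw [Finset.HasAntidiagonal.mem_antidiagonal] at hbc
  have := hU _ (h b (left_ne_zero_of_mul hne)) _ (h' c (right_ne_zero_of_mul hne))
  convert this using 1
  simp only at hbc
  rw [← hbc]
  simp only [wt, Finsupp.add_apply]
  push_cast
  ring

theorem WS.pderiv0 {m n : ℕ} {S : Set ℤ} {f : R} (h : WS m n S f) :
    WS m n {s | s + m ∈ S} (pderiv 0 f) := by
  intro a ha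
  rw [coeff_pderiv] at ha
  have := h _ (left_ne_zero_of_mul ha)
  simp only [wt, Finsupp.add_apply] at this
  simp only [Set.mem_ofPred_eq, wt]
  convert this using 1
  simp
  ring

theorem WS.pderiv1 {m n : ℕ} {S : Set ℤ} {f : R} (h : WS m n S f) :
    WS m n {s | s + n ∈ S} (pderiv 1 f) := by
  intro a ha
  rw [coeff_pderiv] at ha
  have := h _ (left_ne_zero_of_mul ha)
  simp only [wt, Finsupp.add_apply] at this
  simp only [Set.mem_ofPred_eq, wt]
  convert this using 1
  simp
  ring

theorem WS.J {m n : ℕ} {S T U : Set ℤ} {f g : R} (h : WS m n S f) (h' : WS m n T g)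
    (hU : ∀ s ∈ S, ∀ t ∈ T, s + t - m - n ∈ U) : WS m n U (J f g) := by
  rw [J_apply]
  apply WS.sub
  · refine h.pderiv0.mul h'.pderiv1 ?_
    intro s hs t ht
    convert hU _ hs _ ht using 1
    ring
  · refine h.pderiv1.mul h'.pderiv0 ?_
    intro s hs t ht
    convert hU _ hs _ ht using 1
    ring

/-- `g` is the leading form of weight `s` of `f`. -/
def Top (m n : ℕ) (s : ℤ) (f g : R) : Prop := WS m n {s} g ∧ WS m n (Set.Iio s) (f - g)

theorem J_sub (f g k : R) : J (f - g) k = J f k - J g k := by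
  simp only [J_apply, map_sub]; ring

theorem Top.J {m n : ℕ} {d s : ℤ} {F Φ f g : R} (hF : Top m n d F Φ) (hf : Top m n s f g) :
    Top m n (s + (d - m - n)) (J F f) (J Φ g) := by
  constructor
  · refine hF.1.J hf.1 ?_
    rintro a rfl b rfl
    simp only [Set.mem_singleton_iff]
    ring
  · have e : Jung.J F f - Jung.J Φ g
        = (Jung.J (F - Φ) (f - g) + Jung.J (F - Φ) g) + Jung.J Φ (f - g) := by
      simp only [J_sub, map_sub]; ring
    rw [e]
    refine WS.add (WS.add ?_ ?_) ?_
    · refine hF.2.J hf.2 ?_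
      intro a ha b hb
      simp only [Set.mem_Iio] at *
      linarith
    · refine hF.2.J hf.1 ?_
      intro a ha b hb
      simp only [Set.mem_Iio, Set.mem_singleton_iff] at *
      linarith
    · refine hF.1.J hf.2 ?_
      intro a ha b hb
      simp only [Set.mem_Iio, Set.mem_singleton_iff] at *
      linarith

theorem Top.zero {m n : ℕ} {s : ℤ} {g : R} (h : Top m n s 0 g) : g = 0 := by
  ext a
  rw [coeff_zero]
  by_contra hne
  have h1 := h.1 a hne
  have h2 := h.2 a (by simpa using hne)
  simp only [Set.mem_Iio, Set.mem_singleton_iff] at *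
  omega

theorem Top.iter {m n : ℕ} {d s : ℤ} {F Φ f g : R} (hF : Top m n d F Φ) (hf : Top m n s f g)
    (N : ℕ) : Top m n (s + N * (d - m - n)) ((Jung.J F)^[N] f) ((Jung.J Φ)^[N] g) := by
  induction N with
  | zero => simpa using hf
  | succ N ih =>
    rw [Function.iterate_succ_apply', Function.iterate_succ_apply']
    convert hF.J ih using 1
    push_cast
    ring

theorem Top_X (m n : ℕ) (i : Fin 2) : ∃ s, Top m n s (X i : R) (X i) := by
  refine ⟨wt m n (Finsupp.single i 1), ?_, ?_⟩
  · intro a ha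
    have : Finsupp.single i 1 = a := by
      by_contra hne
      rw [coeff_X, if_neg hne] at ha
      exact ha rfl
    simp [this]
  · intro a ha
    simp at ha

theorem Top.LN {m n : ℕ} {d : ℤ} {F Φ : R} (hF : Top m n d F Φ) (h : ∀ f, LN (Jung.J F) f) (f : R) :
    LN (Jung.J Φ) f := by
  apply LN_all
  intro i
  obtain ⟨s, hs⟩ := Top_X (K := K) m n i
  obtain ⟨N, hN⟩ := h (X i)
  refine ⟨N, ?_⟩
  have := hF.iter hs N
  rw [hN] at this
  exact this.zero

theorem mono_eq (a : Fin 2 →₀ ℕ) (c : K) : (monomial a c : R) = C c * X 0 ^ a 0 * X 1 ^ a 1 := by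
  rw [monomial_eq, Finsupp.prod_fintype _ _ (by simp)]
  simp [Fin.prod_univ_two, mul_assoc]

theorem hom_root [IsAlgClosed K] {u v : ℕ} (hv : 0 < v) (huv : u.Coprime v) (Φ : R) (d : ℤ)
    (hΦ : WS u v {d} Φ)
    (h2 : ∃ a b, coeff a Φ ≠ 0 ∧ coeff b Φ ≠ 0 ∧ a ≠ b) :
    ∃ lam : K, lam ≠ 0 ∧ (X 0 ^ v - C lam * X 1 ^ u : R) ∣ Φ := by
  classical
  obtain ⟨a', b', ha', hb', hab⟩ := h2
  obtain ⟨z, hz, hmin⟩ := Finset.exists_min_image Φ.support (fun a => a 0)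
    ⟨a', mem_support_iff.2 ha'⟩
  have key : ∀ a ∈ Φ.support, ∃ k, a 0 = z 0 + v * k ∧ z 1 = a 1 + u * k := by
    intro a ha
    have h1 := hΦ a (mem_support_iff.1 ha)
    have h2 := hΦ z (mem_support_iff.1 hz)
    simp only [wt, Set.mem_singleton_iff] at h1 h2
    obtain ⟨t, ht⟩ := Nat.exists_eq_add_of_le (hmin a ha)
    have e : (u : ℤ) * t = v * ((z 1 : ℤ) - a 1) := by
      rw [ht] at h1; push_cast at h1; linarith
    have hd : (v : ℤ) ∣ t := by
      have : (v : ℤ) ∣ u * t := ⟨_, e⟩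
      exact (Nat.isCoprime_iff_coprime.2 huv.symm).dvd_of_dvd_mul_left this
    obtain ⟨k, hk⟩ := Int.natCast_dvd_natCast.1 hd
    refine ⟨k, by rw [ht, hk], ?_⟩
    rw [hk] at e
    push_cast at e
    have hv' : (v : ℤ) ≠ 0 := by exact_mod_cast hv.ne'
    have : (u : ℤ) * k = (z 1 : ℤ) - a 1 := by
      apply mul_left_cancel₀ hv'; linarith
    have : (z 1 : ℤ) = a 1 + u * k := by linarith
    exact_mod_cast this
  have inj : ∀ a ∈ Φ.support, ∀ b ∈ Φ.support, a 0 = b 0 → a = b := by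
    intro a ha b hb h
    obtain ⟨k, h1, h2⟩ := key a ha
    obtain ⟨l, h3, h4⟩ := key b hb
    have : v * k = v * l := by omega
    have := Nat.eq_of_mul_eq_mul_left hv this
    subst this
    ext i
    fin_cases i
    · exact h
    · simp; omega
  let q : Polynomial K := ∑ a ∈ Φ.support, Polynomial.monomial (a 0 - z 0) (coeff a Φ)
  have hq : ∀ a ∈ Φ.support, q.coeff (a 0 - z 0) = coeff a Φ := by
    intro a ha
    simp only [q, Polynomial.finsetSum_coeff, Polynomial.coeff_monomial]
    rw [Finset.sum_eq_single a]
    · simp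
    · intro b hb hba
      rw [if_neg]
      intro h
      have := hmin a ha
      have := hmin b hb
      exact hba (inj b hb a ha (by omega))
    · intro h; exact absurd ha h
  have hq0 : q.coeff 0 ≠ 0 := by
    have := hq z hz
    rw [Nat.sub_self] at this
    rw [this]; exact mem_support_iff.1 hz
  obtain ⟨w, hw, hwz⟩ : ∃ w ∈ Φ.support, w ≠ z := by
    by_cases h : a' = z
    · exact ⟨b', mem_support_iff.2 hb', fun h' => hab (h.trans h'.symm)⟩
    · exact ⟨a', mem_support_iff.2 ha', h⟩
  have hdeg : q.degree ≠ 0 := by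
    intro h
    have h1 : q.coeff (w 0 - z 0) = 0 := by
      apply Polynomial.coeff_eq_zero_of_degree_lt
      rw [h]
      have : 0 < w 0 - z 0 := by
        have := hmin w hw
        have : w 0 ≠ z 0 := fun h => hwz (inj w hw z hz h)
        omega
      exact_mod_cast this
    rw [hq w hw] at h1
    exact mem_support_iff.1 hw h1
  obtain ⟨ρ, hρ⟩ := IsAlgClosed.exists_root q hdeg
  have hρ0 : ρ ≠ 0 := by
    rintro rfl
    rw [Polynomial.IsRoot, ← Polynomial.coeff_zero_eq_eval_zero] at hρ
    exact hq0 hρ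
  refine ⟨ρ ^ v, pow_ne_zero _ hρ0, ?_⟩
  have hsum : ∑ a ∈ Φ.support, coeff a Φ * ρ ^ (a 0 - z 0) = 0 := by
    rw [Polynomial.IsRoot] at hρ
    simpa [q, Polynomial.eval_finsetSum, Polynomial.eval_monomial] using hρ
  have hs : Φ = ∑ a ∈ Φ.support, (monomial a (coeff a Φ)
      - monomial z (coeff a Φ * ρ ^ (a 0 - z 0))) := by
    rw [Finset.sum_sub_distrib, ← map_sum, hsum, map_zero, sub_zero]
    exact Φ.as_sum
  rw [hs]
  apply Finset.dvd_sum
  intro a ha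
  obtain ⟨k, h1, h2⟩ := key a ha
  have e : (monomial a (coeff a Φ) - monomial z (coeff a Φ * ρ ^ (a 0 - z 0)) : R)
      = (C (coeff a Φ) * X 0 ^ z 0 * X 1 ^ a 1)
        * ((X 0 ^ v) ^ k - (C (ρ ^ v) * X 1 ^ u) ^ k) := by
    rw [mono_eq, mono_eq, h2, h1, Nat.add_sub_cancel_left]
    simp only [C_mul, C_pow, mul_pow, ← pow_mul, pow_add]
    ring
  rw [e]
  exact Dvd.dvd.mul_left (sub_dvd_pow_sub_pow _ _ k) _

theorem not_X_dvd_X_pow {i j : Fin 2} (h : i ≠ j) (k : ℕ) : ¬ (X i : R) ∣ X j ^ k := by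
  intro hd
  have := (X_prime : Prime (X i : R)).dvd_of_dvd_pow hd
  rw [X_dvd_X] at this
  simp_all

theorem not_X_dvd_C (i : Fin 2) (c : K) (hc : c ≠ 0) : ¬ (X i : R) ∣ C c := by
  intro hd
  have h1 : IsUnit (C c : R) := (isUnit_iff_ne_zero.2 hc).map C
  exact (X_prime : Prime (X i : R)).not_isUnit (isUnit_of_dvd_unit hd h1)

theorem hom_key [IsAlgClosed K] {m n : ℕ} (hm : 0 < m) (hmn : m ≤ n) (Φ : R) (d : ℤ)
    (hΦ : WS m n {d} Φ) (hLN : ∀ f, LN (J Φ) f) (hx : pderiv 0 Φ ≠ 0) (hy : pderiv 1 Φ ≠ 0) :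
    ∃ b, n = b * m ∧ ∃ lam : K, lam ≠ 0 ∧ J Φ (X 0 ^ b - C lam * X 1) = 0 := by
  have hΦ0 : Φ ≠ 0 := by rintro rfl; simp at hx
  have hDx : J Φ (X 0) = - pderiv 1 Φ := by simp [J_apply, pderiv_X]
  have hDy : J Φ (X 1) = pderiv 0 Φ := by simp [J_apply, pderiv_X]
  have hDx0 : J Φ (X 0) ≠ 0 := by rw [hDx]; simpa using hy
  have hDy0 : J Φ (X 1) ≠ 0 := by rw [hDy]; exact hx
  have hDΦ : J Φ Φ = 0 := by rw [J_apply]; ring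
  have fc : ∀ h : R, h ∣ Φ → J Φ h = 0 := by
    rintro h ⟨k, hk⟩
    apply fact_closed hLN (g := k)
    · rw [← hk]; exact hΦ0
    · rw [← hk]; exact hDΦ
  obtain ⟨g, u, v, hg, huv, hmu, hnv⟩ := Nat.exists_coprime' (m := m) (n := n)
    (Nat.gcd_pos_of_pos_left _ hm)
  have hu : 0 < u := Nat.pos_of_ne_zero (by rintro rfl; omega)
  have huv' : u ≤ v := by
    rw [hmu, hnv] at hmn
    exact Nat.le_of_mul_le_mul_right hmn hg
  have hv : 0 < v := by omega
  obtain ⟨z, hz⟩ := MvPolynomial.exists_coeff_ne_zero hΦ0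
  have hΦ' : WS u v {wt u v z} Φ := by
    intro a ha
    have h1 := hΦ a ha
    have h2 := hΦ z hz
    have hg' : (g : ℤ) ≠ 0 := by exact_mod_cast hg.ne'
    simp only [wt, Set.mem_singleton_iff, hmu, hnv] at *
    apply mul_left_cancel₀ hg'
    push_cast at h1 h2
    linarith
  have h2 : ∃ a b, coeff a Φ ≠ 0 ∧ coeff b Φ ≠ 0 ∧ a ≠ b := by
    by_contra hcon
    push Not at hcon
    have e : Φ = monomial z (coeff z Φ) := by
      ext a
      rw [coeff_monomial]
      split_ifs with h
      · rw [h]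
      · by_contra hne
        exact h (hcon z a hz hne)
    have hz0 : z 0 ≠ 0 := by
      intro h
      apply hx
      rw [e, pderiv_monomial, h]; simp
    apply hDx0
    apply fc
    rw [e, mono_eq]
    exact Dvd.dvd.mul_right (Dvd.dvd.mul_left (dvd_pow_self _ hz0) _) _
  obtain ⟨lam, hlam, hdvd⟩ := hom_root hv huv Φ _ hΦ' h2
  have hker := fc _ hdvd
  have hu1 : u = 1 := by
    by_contra hne
    have hu2 : 2 ≤ u := by omega
    have hv2 : 2 ≤ v := by omega
    have e : C (v : K) * X 0 ^ (v - 1) * J Φ (X 0) = C (lam * u) * X 1 ^ (u - 1) * J Φ (X 1) := by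
      rw [map_sub, Derivation.leibniz, Derivation.leibniz_pow, Derivation.leibniz_pow,
        derivation_C] at hker
      simp only [nsmul_eq_mul, smul_eq_mul, mul_zero, add_zero] at hker
      rw [C_mul, map_natCast, map_natCast]
      linear_combination hker
    have d1 : (X 1 : R) ∣ J Φ (X 0) := by
      have : (X 1 : R) ∣ C (v : K) * X 0 ^ (v - 1) * J Φ (X 0) := by
        rw [e]
        exact Dvd.dvd.mul_right (Dvd.dvd.mul_left (dvd_pow_self _ (by omega)) _) _
      rcases X_prime.dvd_or_dvd this with h | h
      · rcases X_prime.dvd_or_dvd h with h | h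
        · exact absurd h (not_X_dvd_C _ _ (by exact_mod_cast hv.ne'))
        · exact absurd h (not_X_dvd_X_pow (by decide) _)
      · exact h
    have d2 : (X 0 : R) ∣ J Φ (X 1) := by
      have : (X 0 : R) ∣ C (lam * u) * X 1 ^ (u - 1) * J Φ (X 1) := by
        rw [← e]
        exact Dvd.dvd.mul_right (Dvd.dvd.mul_left (dvd_pow_self _ (by omega)) _) _
      rcases X_prime.dvd_or_dvd this with h | h
      · rcases X_prime.dvd_or_dvd h with h | h
        · exact absurd h (not_X_dvd_C _ _ (mul_ne_zero hlam (by exact_mod_cast hu.ne')))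
        · exact absurd h (not_X_dvd_X_pow (by decide) _)
      · exact h
    obtain ⟨p, hp⟩ := (hLN (X 0)).exists_deg (X_ne_zero _)
    obtain ⟨q, hq⟩ := (hLN (X 1)).exists_deg (X_ne_zero _)
    obtain ⟨p1, hp'⟩ := hp.deriv hDx0
    obtain ⟨q1, hq'⟩ := hq.deriv hDy0
    have := hq.le_of_dvd hLN hp' d1
    have := hp.le_of_dvd hLN hq' d2
    omega
  subst hu1
  refine ⟨v, by rw [hnv, hmu]; ring, lam, hlam, ?_⟩
  simpa using hker


theorem pderiv_zero {i : Fin 2} {f : R} (h : pderiv i f = 0) {a : Fin 2 →₀ ℕ}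
    (ha : coeff a f ≠ 0) : a i = 0 := by
  by_contra hne
  have h1 := coeff_pderiv (i := i) f (a - Finsupp.single i 1)
  have h2 : a - Finsupp.single i 1 + Finsupp.single i 1 = a := by
    apply tsub_add_cancel_of_le
    rw [Finsupp.single_le_iff]; omega
  rw [h, coeff_zero, h2] at h1
  rcases mul_eq_zero.1 h1.symm with h3 | h3
  · exact ha h3
  · exact Nat.cast_add_one_ne_zero _ h3

theorem pderiv_zero_vars {i : Fin 2} {f : R} (h : pderiv i f = 0) : i ∉ f.vars := by
  rw [mem_vars_iff_mem_support]
  rintro ⟨a, ha, hi⟩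
  exact (Finsupp.mem_support_iff.1 hi) (pderiv_zero h (mem_support_iff.1 ha))

theorem const_of_pderiv {f : R} (h0 : pderiv 0 f = 0) (h1 : pderiv 1 f = 0) : ∃ c, f = C c := by
  refine ⟨coeff 0 f, ?_⟩
  ext a
  rw [coeff_C]
  split_ifs with h
  · rw [h]
  · by_contra hne
    apply h
    ext i
    fin_cases i
    · exact (pderiv_zero h0 hne).symm
    · exact (pderiv_zero h1 hne).symm

/-- the elementary automorphism -/
noncomputable def el (μ : K) (b : ℕ) : R ≃ₐ[K] R :=
  AlgEquiv.ofAlgHom (aeval ![X 0, X 1 + C μ * X 0 ^ b]) (aeval ![X 0, X 1 - C μ * X 0 ^ b])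
    (by ext i : 1; fin_cases i <;> simp [← algebraMap_eq])
    (by ext i : 1; fin_cases i <;> simp [← algebraMap_eq])

theorem el_X0 (μ : K) (b : ℕ) : el μ b (X 0) = X 0 := by simp [el]
theorem el_X1 (μ : K) (b : ℕ) : el μ b (X 1) = X 1 + C μ * X 0 ^ b := by simp [el]

theorem el_elem (μ : K) (b : ℕ) : IsElemAut (el μ b) := by
  refine ⟨1, C μ * X 0 ^ b, ?_, el_X1 μ b, ?_⟩
  · apply pderiv_zero_vars
    simp [pderiv_X]
  · intro j hj
    obtain rfl : j = 0 := by omega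
    exact el_X0 μ b

/-- the diagonal affine automorphism -/
noncomputable def af (α β γ : K) (hα : α ≠ 0) (hγ : γ ≠ 0) : R ≃ₐ[K] R :=
  AlgEquiv.ofAlgHom (aeval ![C α * X 0 + C β, C γ * X 1])
    (aeval ![C α⁻¹ * (X 0 - C β), C γ⁻¹ * X 1])
    (by
      ext i : 1; fin_cases i
      · simp [algHom_C]
        rw [← mul_assoc, ← C_mul, inv_mul_cancel₀ hα, C_1, one_mul]
      · simp [algHom_C]
        rw [← mul_assoc, ← C_mul, inv_mul_cancel₀ hγ, C_1, one_mul])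
    (by
      ext i : 1; fin_cases i
      · simp [algHom_C]
        rw [← mul_assoc, ← C_mul, mul_inv_cancel₀ hα, C_1, one_mul, sub_add_cancel]
      · simp [algHom_C]
        rw [← mul_assoc, ← C_mul, mul_inv_cancel₀ hγ, C_1, one_mul])

theorem af_X0 (α β γ : K) (hα : α ≠ 0) (hγ : γ ≠ 0) : af α β γ hα hγ (X 0) = C α * X 0 + C β := by
  simp [af]
theorem af_X1 (α β γ : K) (hα : α ≠ 0) (hγ : γ ≠ 0) : af α β γ hα hγ (X 1) = C γ * X 1 := by
  simp [af]

theorem deg_le (c : K) (i : Fin 2) : (C c * X i : R).totalDegree ≤ 1 := by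
  refine (totalDegree_mul _ _).trans ?_
  simp

theorem af_affine (α β γ : K) (hα : α ≠ 0) (hγ : γ ≠ 0) : IsAffineAut (af α β γ hα hγ) := by
  intro i
  fin_cases i
  · change (af α β γ hα hγ (X 0)).totalDegree ≤ 1
    rw [af_X0]
    refine (totalDegree_add _ _).trans (max_le (deg_le _ _) ?_)
    simp
  · change (af α β γ hα hγ (X 1)).totalDegree ≤ 1
    rw [af_X1]
    exact deg_le _ _

theorem tame_of_mul {τ ψ : R ≃ₐ[K] R} (hτ : IsAffineAut τ ∨ IsElemAut τ) (h : IsTame (τ * ψ)) :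
    IsTame ψ := by
  have h1 : τ ∈ Subgroup.closure {φ : R ≃ₐ[K] R | IsAffineAut φ ∨ IsElemAut φ} :=
    Subgroup.subset_closure hτ
  exact (Subgroup.mul_mem_cancel_left _ h1).1 h

theorem base (ψ : R ≃ₐ[K] R) (h : pderiv 1 (ψ (X 0)) = 0) : IsTame ψ := by
  obtain ⟨c, hc, hJ⟩ := J_const ψ
  rw [J_apply, h, zero_mul, sub_zero] at hJ
  have hu : IsUnit (pderiv 0 (ψ (X 0)) * pderiv 1 (ψ (X 1))) := by
    rw [hJ]; exact (isUnit_iff_ne_zero.2 hc).map C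
  obtain ⟨hu1, hu2⟩ := IsUnit.mul_iff.1 hu
  rw [MvPolynomial.isUnit_iff_eq_C_of_isReduced] at hu1 hu2
  obtain ⟨α, hα, h1⟩ := hu1
  obtain ⟨γ, hγ, h2⟩ := hu2
  obtain ⟨β, hβ⟩ : ∃ β, ψ (X 0) - C α * X 0 = C β := by
    apply const_of_pderiv
    · simp [pderiv_X, h1]
    · simp [pderiv_X, h]
  have hF : ψ (X 0) = C α * X 0 + C β := by rw [← hβ]; ring
  let q : R := ψ (X 1) - C γ * X 1
  have hq : pderiv 1 q = 0 := by simp [q, pderiv_X, h2]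
  have hG : ψ (X 1) = C γ * X 1 + q := by simp [q]
  let A := af α β γ hα.ne_zero hγ.ne_zero
  have hA0 : A.symm (C α * X 0 + C β) = X 0 := by
    rw [← af_X0 α β γ hα.ne_zero hγ.ne_zero]; exact A.symm_apply_apply _
  have hA1 : A.symm (C γ * X 1) = X 1 := by
    rw [← af_X1 α β γ hα.ne_zero hγ.ne_zero]; exact A.symm_apply_apply _
  have hE : IsElemAut (A⁻¹ * ψ) := by
    refine ⟨1, A.symm q, ?_, ?_, ?_⟩
    · apply pderiv_zero_vars
      have := chain A.symm.toAlgHom 1 q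
      rw [hq] at this
      change pderiv 1 (A.symm q) = _ at this
      rw [this]
      have e : A.symm (X 0) = C α⁻¹ * (X 0 - C β) := by simp [A, af]
      change _ * pderiv 1 (A.symm (X 0)) + _ = _
      rw [e]
      simp [pderiv_X]
    · change A.symm (ψ (X 1)) = _
      rw [hG, map_add, hA1]
    · intro j hj
      obtain rfl : j = 0 := by omega
      change A.symm (ψ (X 0)) = _
      rw [hF, hA0]
  have h3 : IsTame A := Subgroup.subset_closure (Or.inl (af_affine _ _ _ _ _))
  have h4 : IsTame (A⁻¹ * ψ) := Subgroup.subset_closure (Or.inr hE)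
  have := Subgroup.mul_mem _ h3 h4
  rwa [mul_inv_cancel_left] at this

theorem WS.sum {m n : ℕ} {S : Set ℤ} {ι : Type*} (s : Finset ι) (f : ι → R)
    (h : ∀ i ∈ s, WS m n S (f i)) : WS m n S (∑ i ∈ s, f i) := by
  intro a ha
  rw [coeff_sum] at ha
  obtain ⟨i, hi, hne⟩ := Finset.exists_ne_zero_of_sum_ne_zero ha
  exact h i hi a hne

theorem WS_monomial (m n : ℕ) (a : Fin 2 →₀ ℕ) (c : K) :
    WS m n {wt m n a} (monomial a c : R) := by
  classical
  intro b hb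
  rw [coeff_monomial] at hb
  split_ifs at hb with h
  · simp [h]
  · exact absurd rfl hb

theorem WS.pow {m n : ℕ} {s : ℤ} {f : R} (h : WS m n {s} f) (k : ℕ) :
    WS m n {k * s} (f ^ k) := by
  induction k with
  | zero =>
    have := WS_monomial (K := K) m n 0 1
    simpa [wt] using this
  | succ k ih =>
    rw [pow_succ]
    refine ih.mul h ?_
    rintro _ rfl _ rfl
    simp only [Set.mem_singleton_iff]
    push_cast; ring

theorem WS_X0 (m n : ℕ) : WS m n {(m : ℤ)} (X 0 : R) := by
  have := WS_monomial (K := K) m n (Finsupp.single 0 1) 1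
  have e : wt m n (Finsupp.single 0 1) = m := by simp [wt]
  rw [e] at this
  exact this

theorem WS_X1 (m n : ℕ) : WS m n {(n : ℤ)} (X 1 : R) := by
  have := WS_monomial (K := K) m n (Finsupp.single 1 1) 1
  have e : wt m n (Finsupp.single 1 1) = n := by simp [wt]
  rw [e] at this
  exact this

theorem WS_C (m n : ℕ) (c : K) : WS m n {(0 : ℤ)} (C c : R) := by
  have := WS_monomial (K := K) m n 0 c
  simpa [wt] using this

theorem WS.el {m n b : ℕ} (hb : n = b * m) (μ : K) {S : Set ℤ} {f : R} (h : WS m n S f) :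
    WS m n S (el μ b f) := by
  rw [f.as_sum, map_sum]
  apply WS.sum
  intro a ha
  have h1 : WS m n {(n : ℤ)} (X 1 + C μ * X 0 ^ b : R) := by
    apply (WS_X1 m n).add
    refine (WS_C m n μ).mul ((WS_X0 m n).pow b) ?_
    rintro _ rfl _ rfl
    simp [hb]
  have hC : Jung.el μ b (C (coeff a f)) = C (coeff a f) := (Jung.el μ b).commutes _
  have hw : WS m n {wt m n a} (Jung.el μ b (monomial a (coeff a f))) := by
    rw [mono_eq, map_mul, map_mul, map_pow, map_pow, el_X0, el_X1, hC]
    refine ((WS_C m n _).mul ((WS_X0 m n).pow (a 0)) (U := {(a 0 * m : ℤ)}) ?_).mul (h1.pow _) ?_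
    · rintro _ rfl _ rfl; simp
    · rintro _ rfl _ rfl; simp [wt, mul_comm]
  apply hw.mono
  simpa using h a (mem_support_iff.1 ha)

theorem el_sub_dvd (μ : K) {b : ℕ} (hb : b ≠ 0) (f : R) : X 0 ∣ el μ b f - f := by
  induction f using MvPolynomial.induction_on with
  | C a =>
    have hC : el μ b (C a) = C a := (el μ b).commutes _
    simp [hC]
  | add p q hp hq =>
    rw [map_add, add_sub_add_comm]; exact dvd_add hp hq
  | mul_X p j hp =>
    have hX : X 0 ∣ el μ b (X j) - X j := by
      fin_cases j
      · simp [el_X0]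
      · simp only [Fin.mk_one, el_X1, add_sub_cancel_left]
        exact Dvd.dvd.mul_left (dvd_pow_self _ hb) _
    have e : el μ b (p * X j) - p * X j = (el μ b p - p) * el μ b (X j)
        + p * (el μ b (X j) - X j) := by rw [map_mul]; ring
    rw [e]
    exact dvd_add (Dvd.dvd.mul_right hp _) (Dvd.dvd.mul_left hX _)

theorem coeff_el (μ : K) {b : ℕ} (hb : b ≠ 0) (f : R) {a : Fin 2 →₀ ℕ} (ha : a 0 = 0) :
    coeff a (el μ b f) = coeff a f := by
  obtain ⟨g, hg⟩ := el_sub_dvd μ hb f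
  have : el μ b f = f + X 0 * g := by rw [← hg]; ring
  rw [this, coeff_add, coeff_X_mul', if_neg (by simpa using ha), add_zero]

theorem exists_degreeOf (f : R) (hf : f ≠ 0) (i : Fin 2) : ∃ a, coeff a f ≠ 0 ∧ a i = degreeOf i f := by
  rw [degreeOf_eq_sup]
  obtain ⟨a, ha, h⟩ := Finset.exists_mem_eq_sup f.support (support_nonempty.2 hf) (fun a => a i)
  exact ⟨a, mem_support_iff.1 ha, h.symm⟩

theorem step [IsAlgClosed K] (F : R) (hLN : ∀ f, LN (J F) f) (hm : 0 < degreeOf 1 F)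
    (hmn : degreeOf 1 F ≤ degreeOf 0 F) :
    ∃ (μ : K) (b : ℕ), degreeOf 0 (el μ b F) < degreeOf 0 F ∧
      degreeOf 1 (el μ b F) ≤ degreeOf 1 F := by
  classical
  have hF0 : F ≠ 0 := by rintro rfl; simp at hm
  obtain ⟨a, ha, hai⟩ := exists_degreeOf F hF0 0
  obtain ⟨b, hb, hbi⟩ := exists_degreeOf F hF0 1
  have le0 : ∀ c, coeff c F ≠ 0 → c 0 ≤ degreeOf 0 F := fun c hc =>
    degreeOf_le_iff.1 le_rfl c (mem_support_iff.2 hc)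
  have le1 : ∀ c, coeff c F ≠ 0 → c 1 ≤ degreeOf 1 F := fun c hc =>
    degreeOf_le_iff.1 le_rfl c (mem_support_iff.2 hc)
  generalize hn' : degreeOf 0 F = n at *
  generalize hm' : degreeOf 1 F = m at *
  have hn : 0 < n := by omega
  obtain ⟨z, hz, hmax⟩ := Finset.exists_max_image F.support (wt m n) (support_nonempty.2 hF0)
  rw [mem_support_iff] at hz
  obtain ⟨d, hd⟩ : ∃ d, wt m n z = d := ⟨_, rfl⟩
  have hmax : ∀ c, coeff c F ≠ 0 → wt m n c ≤ d := fun c hc =>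
    hd ▸ hmax c (mem_support_iff.2 hc)
  have hwa : (m * n : ℤ) ≤ wt m n a := by
    simp only [wt, hai]
    have : (0 : ℤ) ≤ n * a 1 := by positivity
    linarith
  have hwb : (m * n : ℤ) ≤ wt m n b := by
    simp only [wt, hbi]
    have : (0 : ℤ) ≤ m * b 0 := by positivity
    linarith
  have hdmn : (m * n : ℤ) ≤ d := hwa.trans (hmax a ha)
  have hmZ : (0 : ℤ) < m := by exact_mod_cast hm
  have hnZ : (0 : ℤ) < n := by exact_mod_cast hn
  obtain ⟨Φ, hcoef⟩ : ∃ Φ : R, ∀ c, coeff c Φ = if wt m n c = d then coeff c F else 0 := by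
    refine ⟨∑ c ∈ F.support with wt m n c = d, monomial c (coeff c F), ?_⟩
    intro c
    rw [coeff_sum]
    simp only [coeff_monomial]
    rw [Finset.sum_ite_eq']
    simp only [Finset.mem_filter, mem_support_iff]
    by_cases h1 : wt m n c = d
    · by_cases h2 : coeff c F = 0 <;> simp [h1, h2]
    · simp [h1]
  have hTop : Top m n d F Φ := by
    constructor
    · intro c hc
      rw [hcoef] at hc
      rw [Set.mem_singleton_iff]
      by_contra h
      rw [if_neg h] at hc
      exact hc rfl
    · intro c hc
      rw [coeff_sub, hcoef] at hc
      split_ifs at hc with h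
      · simp at hc
      · rw [sub_zero] at hc
        exact lt_of_le_of_ne (hmax c hc) h
  have hin : ∀ c, coeff c F ≠ 0 → d ≤ wt m n c → coeff c Φ ≠ 0 := by
    intro c hc h
    rw [hcoef, if_pos (le_antisymm (hmax c hc) h)]
    exact hc
  have hzΦ : coeff z Φ ≠ 0 := hin z hz hd.ge
  have hx : pderiv 0 Φ ≠ 0 := by
    intro h
    have h1 := pderiv_zero h hzΦ
    have h2 : d ≤ m * n := by
      have : (z 1 : ℤ) ≤ m := by exact_mod_cast le1 z hz
      rw [← hd]; simp only [wt, h1]; push_cast; nlinarith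
    have := pderiv_zero h (hin a ha (h2.trans hwa))
    omega
  have hy : pderiv 1 Φ ≠ 0 := by
    intro h
    have h1 := pderiv_zero h hzΦ
    have h2 : d ≤ m * n := by
      have : (z 0 : ℤ) ≤ n := by exact_mod_cast le0 z hz
      rw [← hd]; simp only [wt, h1]; push_cast; nlinarith
    have := pderiv_zero h (hin b hb (h2.trans hwb))
    omega
  obtain ⟨e, hne, lam, hlam, hker⟩ := hom_key hm hmn Φ d hTop.1 (hTop.LN hLN) hx hy
  have he0 : e ≠ 0 := by rintro rfl; omega
  refine ⟨lam⁻¹, e, ?_⟩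
  have hp : pderiv 0 (el lam⁻¹ e Φ) = 0 := by
    have h1 := chain (el lam⁻¹ e).toAlgHom 0 Φ
    change pderiv 0 (el lam⁻¹ e Φ) = el lam⁻¹ e (pderiv 0 Φ) * pderiv 0 (el lam⁻¹ e (X 0))
      + el lam⁻¹ e (pderiv 1 Φ) * pderiv 0 (el lam⁻¹ e (X 1)) at h1
    rw [h1, el_X0, el_X1]
    have h2 : pderiv 0 Φ * C lam + pderiv 1 Φ * ((e : R) * X 0 ^ (e - 1)) = 0 := by
      rw [J_apply] at hker
      simp [pderiv_X] at hker
      linear_combination -hker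
    have h3 := congrArg (el lam⁻¹ e) h2
    have hC : el lam⁻¹ e (C lam) = C lam := (el lam⁻¹ e).commutes _
    simp only [map_add, map_mul, map_pow, el_X0, hC, map_zero, map_natCast] at h3
    have h4 : (C lam⁻¹ : R) * C lam = 1 := by rw [← C_mul, inv_mul_cancel₀ hlam, C_1]
    simp [pderiv_X]
    linear_combination C lam⁻¹ * h3 - el lam⁻¹ e (pderiv 0 Φ) * h4
  have hT1 : WS m n {d} (el lam⁻¹ e Φ) := hTop.1.el hne _
  have hT2 : WS m n (Set.Iio d) (el lam⁻¹ e (F - Φ)) := hTop.2.el hne _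
  have hdle : d ≤ m * n := by
    have h0 : el lam⁻¹ e Φ ≠ 0 := by
      rw [Ne, EmbeddingLike.map_eq_zero_iff]
      rintro rfl
      simp at hx
    obtain ⟨c, hc⟩ := MvPolynomial.exists_coeff_ne_zero h0
    have hc0 := pderiv_zero hp hc
    have hw := hT1 c hc
    rw [coeff_el _ he0 _ hc0, hcoef] at hc
    split_ifs at hc with h
    · have : (c 1 : ℤ) ≤ m := by exact_mod_cast le1 c hc
      rw [← h]; simp only [wt, hc0]; push_cast; nlinarith
    · exact absurd rfl hc
  have hsplit : el lam⁻¹ e F = el lam⁻¹ e Φ + el lam⁻¹ e (F - Φ) := by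
    rw [← map_add]; congr 1; ring
  have hall : ∀ c, coeff c (el lam⁻¹ e F) ≠ 0 → wt m n c ≤ d := by
    rw [hsplit]
    have : WS m n (Set.Iic d) (el lam⁻¹ e Φ + el lam⁻¹ e (F - Φ)) :=
      (hT1.mono (by simp)).add (hT2.mono Set.Iio_subset_Iic_self)
    exact this
  constructor
  · rw [degreeOf_lt_iff hn]
    intro c hc
    rw [mem_support_iff] at hc
    by_contra hcon
    have hcn : (n : ℤ) ≤ c 0 := by exact_mod_cast not_lt.1 hcon
    have hw : d ≤ wt m n c := by
      simp only [wt]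
      have : (0 : ℤ) ≤ n * c 1 := by positivity
      nlinarith
    have h1 : coeff c (el lam⁻¹ e (F - Φ)) = 0 := by
      by_contra h
      exact absurd (hT2 c h) (by simpa using hw)
    rw [hsplit, coeff_add, h1, add_zero] at hc
    have := pderiv_zero hp hc
    omega
  · rw [degreeOf_le_iff]
    intro c hc
    rw [mem_support_iff] at hc
    have hw := (hall c hc).trans hdle
    simp only [wt] at hw
    have : (0 : ℤ) ≤ m * c 0 := by positivity
    have : (n : ℤ) * c 1 ≤ n * m := by linarith
    exact_mod_cast le_of_mul_le_mul_left this hnZ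

/-- the swap automorphism -/
noncomputable def sw : R ≃ₐ[K] R := renameEquiv K (Equiv.swap 0 1)

theorem sw_affine : IsAffineAut (sw : R ≃ₐ[K] R) := by
  intro i
  simp [sw]

theorem sw_deg (f : R) (i : Fin 2) : degreeOf (Equiv.swap 0 1 i) (sw f) = degreeOf i f :=
  degreeOf_rename_of_injective (Equiv.swap (0 : Fin 2) 1).injective i

theorem main [IsAlgClosed K] : ∀ (N : ℕ) (ψ : R ≃ₐ[K] R),
    degreeOf 0 (ψ (X 0)) + degreeOf 1 (ψ (X 0)) = N → IsTame ψ := by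
  intro N
  induction N using Nat.strong_induction_on with
  | _ N ih =>
    have aux : ∀ ψ : R ≃ₐ[K] R, degreeOf 0 (ψ (X 0)) + degreeOf 1 (ψ (X 0)) = N →
        degreeOf 1 (ψ (X 0)) ≤ degreeOf 0 (ψ (X 0)) → IsTame ψ := by
      intro ψ hN hle
      rcases Nat.eq_zero_or_pos (degreeOf 1 (ψ (X 0))) with h0 | hpos
      · apply base
        apply pderiv_eq_zero_of_notMem_vars
        rw [mem_vars_iff_mem_support]
        rintro ⟨a, ha, hi⟩
        have h1 := degreeOf_le_iff.1 h0.le a ha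
        rw [Finsupp.mem_support_iff] at hi
        omega
      · obtain ⟨μ, b, h1, h2⟩ := step (ψ (X 0)) (LN_J ψ) hpos hle
        apply tame_of_mul (τ := el μ b) (Or.inr (el_elem μ b))
        exact ih _ (by rw [← hN]; exact add_lt_add_of_lt_of_le h1 h2) (el μ b * ψ) rfl
    intro ψ hN
    rcases le_total (degreeOf 1 (ψ (X 0))) (degreeOf 0 (ψ (X 0))) with h | h
    · exact aux ψ hN h
    · apply tame_of_mul (τ := sw) (Or.inl sw_affine)
      have e0 := sw_deg (ψ (X 0)) 0
      have e1 := sw_deg (ψ (X 0)) 1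
      rw [Equiv.swap_apply_left] at e0
      rw [Equiv.swap_apply_right] at e1
      apply aux (sw * ψ)
      · change degreeOf 0 (sw (ψ (X 0))) + degreeOf 1 (sw (ψ (X 0))) = N
        omega
      · change degreeOf 1 (sw (ψ (X 0))) ≤ degreeOf 0 (sw (ψ (X 0)))
        omega

end poly
end Jung

/-- The Jung–van der Kulk theorem: every polynomial automorphism of `K²` is tame. -/
theorem stmt4 {K : Type*} [Field K] [IsAlgClosed K] [CharZero K]
    (ψ : MvPolynomial (Fin 2) K ≃ₐ[K] MvPolynomial (Fin 2) K) : IsTame ψ := by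
  exact Jung.main _ ψ rfl
end
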